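/- Approximate solution counting: let k ≥ 2, s ≥ 1 be integers and ε > 0. There exists C = C(k,s,ε) such that for every integer N ≥ 1 and every choice of points t_n with (n−1)/N < t_n < n/N for 1 ≤ n ≤ N, the number of 2s-tuples (n₁,…,n_{2s}) of integers in {1,…,N} satisfying |t_{n₁}^j + ⋯ + t_{n_s}^j − t_{n_{s+1}}^j − ⋯ − t_{n_{2s}}^j| < N^{−k} for all 1 ≤ j ≤ k is at most C · N^ε · (N^s + N^{2s − k(k+1)/2}). -/

import Mathlib

namespace MomentCurve

open Finset Polynomial

/-! ### `ℓ^d` norms of functions on finite types -/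

/-- The `ℓ^d` norm of a real function on a finite type. -/
noncomputable def nrm {α : Type*} [Fintype α] (d : ℕ) (F : α → ℝ) : ℝ :=
  (∑ x, |F x| ^ d) ^ (1 / (d : ℝ))

/-- The square of the `ℓ^{2d}` norm of a complex function on a finite type. -/
noncomputable def nsq {α : Type*} [Fintype α] (d : ℕ) (f : α → ℂ) : ℝ :=
  nrm d (fun x => ‖f x‖ ^ 2)

section norms
variable {α β : Type*} [Fintype α] [Fintype β]

lemma nrm_nonneg (d : ℕ) (F : α → ℝ) : 0 ≤ nrm d F := by
  unfold nrm; positivity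

lemma nsq_nonneg (d : ℕ) (f : α → ℂ) : 0 ≤ nsq d f := nrm_nonneg _ _

lemma nrm_pow {d : ℕ} (hd : 1 ≤ d) (F : α → ℝ) : nrm d F ^ d = ∑ x, |F x| ^ d := by
  unfold nrm
  rw [one_div]
  exact Real.rpow_inv_natCast_pow (by positivity) (by omega)

lemma nsq_pow {d : ℕ} (hd : 1 ≤ d) (f : α → ℂ) : nsq d f ^ d = ∑ x, ‖f x‖ ^ (2 * d) := by
  unfold nsq
  rw [nrm_pow hd]
  refine sum_congr rfl fun x _ => ?_
  rw [abs_of_nonneg (by positivity), ← pow_mul]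

lemma nrm_le_of_pow_le {d : ℕ} (hd : 1 ≤ d) {F : α → ℝ} {B : ℝ} (hB : 0 ≤ B)
    (h : ∑ x, |F x| ^ d ≤ B ^ d) : nrm d F ≤ B := by
  rw [← nrm_pow hd] at h
  exact le_of_pow_le_pow_left₀ (by omega) hB h

lemma nrm_add_le {d : ℕ} (hd : 1 ≤ d) (F G : α → ℝ) :
    nrm d (fun x => F x + G x) ≤ nrm d F + nrm d G := by
  have := Real.Lp_add_le univ F G (p := d) (by exact_mod_cast hd)
  simpa [nrm, Real.rpow_natCast] using this

lemma nrm_zero {d : ℕ} (hd : 1 ≤ d) : nrm d (fun _ : α => (0 : ℝ)) = 0 := by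
  have h : d ≠ 0 := by omega
  simp [nrm, h]

lemma nrm_sum_le {d : ℕ} (hd : 1 ≤ d) {ι : Type*} (s : Finset ι) (F : ι → α → ℝ) :
    nrm d (fun x => ∑ i ∈ s, F i x) ≤ ∑ i ∈ s, nrm d (F i) := by
  classical
  induction s using Finset.induction_on with
  | empty => simp [nrm_zero hd]
  | insert a s ha ih =>
    simp only [sum_insert ha]
    exact (nrm_add_le hd _ _).trans (by gcongr)

lemma nrm_mono {d : ℕ} {F G : α → ℝ} (h : ∀ x, |F x| ≤ |G x|) : nrm d F ≤ nrm d G := by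
  unfold nrm
  exact Real.rpow_le_rpow (by positivity)
    (sum_le_sum fun x _ => pow_le_pow_left₀ (abs_nonneg _) (h x) _) (by positivity)

lemma nrm_const_mul {d : ℕ} (hd : 1 ≤ d) (c : ℝ) (F : α → ℝ) :
    nrm d (fun x => c * F x) = |c| * nrm d F := by
  unfold nrm
  simp only [abs_mul, mul_pow, ← mul_sum]
  rw [Real.mul_rpow (by positivity) (by positivity), one_div,
    Real.pow_rpow_inv_natCast (by positivity) (by omega)]

lemma nsq_sum_le {d : ℕ} (hd : 1 ≤ d) {ι : Type*} (s : Finset ι) (f : ι → α → ℂ) :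
    nsq d (∑ i ∈ s, f i) ≤ (s.card : ℝ) * ∑ i ∈ s, nsq d (f i) := by
  unfold nsq
  calc nrm d (fun x => ‖(∑ i ∈ s, f i) x‖ ^ 2)
      ≤ nrm d (fun x => (s.card : ℝ) * ∑ i ∈ s, ‖f i x‖ ^ 2) := by
        refine nrm_mono fun x => abs_le_abs_of_nonneg (by positivity) ?_
        rw [Finset.sum_apply]
        calc ‖∑ i ∈ s, f i x‖ ^ 2 ≤ (∑ i ∈ s, ‖f i x‖) ^ 2 := by
              gcongr; exact norm_sum_le _ _
          _ ≤ _ := sq_sum_le_card_mul_sum_sq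
    _ = (s.card : ℝ) * nrm d (fun x => ∑ i ∈ s, ‖f i x‖ ^ 2) := by
        rw [nrm_const_mul hd, abs_of_nonneg (by positivity)]
    _ ≤ _ := by gcongr; exact nrm_sum_le hd _ _

lemma nsq_congr {d : ℕ} (e : α ≃ β) {f : α → ℂ} {g : β → ℂ} (h : ∀ x, ‖f x‖ = ‖g (e x)‖) :
    nsq d f = nsq d g := by
  unfold nsq nrm
  simp only [h]
  rw [Equiv.sum_comp e (fun x => |‖g x‖ ^ 2| ^ d)]

/-- Hölder's inequality for three exponents summing to `1`, in the form of a product of powers. -/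
lemma sum_mul_pow_le {d a b : ℕ} (hd : 1 ≤ d) (hab : a + b = d) (F G : α → ℝ)
    (hF : ∀ x, 0 ≤ F x) (hG : ∀ x, 0 ≤ G x) :
    ∑ x, F x ^ a * G x ^ b ≤ nrm d F ^ a * nrm d G ^ b := by
  rcases Nat.eq_zero_or_pos a with rfl | ha
  · obtain rfl : b = d := by omega
    simp only [pow_zero, one_mul]
    rw [nrm_pow hd]
    exact le_of_eq (sum_congr rfl fun x _ => by rw [abs_of_nonneg (hG x)])
  rcases Nat.eq_zero_or_pos b with rfl | hb
  · obtain rfl : a = d := by omega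
    simp only [pow_zero, mul_one]
    rw [nrm_pow hd]
    exact le_of_eq (sum_congr rfl fun x _ => by rw [abs_of_nonneg (hF x)])
  have haR : (0:ℝ) < a := by exact_mod_cast ha
  have hbR : (0:ℝ) < b := by exact_mod_cast hb
  have hdR : (d:ℝ) = a + b := by exact_mod_cast hab.symm
  have hconj : ((d:ℝ)/a).HolderConjugate (d/b) := by
    rw [Real.holderConjugate_iff]
    constructor
    · rw [hdR, lt_div_iff₀ haR]; linarith
    · rw [inv_div, inv_div, hdR]; field_simp
  have := Real.inner_le_Lp_mul_Lq_of_nonneg univ (f := fun x => F x ^ a) (g := fun x => G x ^ b)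
    hconj (fun x _ => by have := hF x; positivity) (fun x _ => by have := hG x; positivity)
  refine this.trans (le_of_eq ?_)
  unfold nrm
  congr 1
  · rw [← Real.rpow_natCast, ← Real.rpow_mul (by positivity)]
    congr 1
    · refine sum_congr rfl fun x _ => ?_
      rw [abs_of_nonneg (hF x), ← Real.rpow_natCast, ← Real.rpow_mul (hF x), ← Real.rpow_natCast]
      congr 1; field_simp
    · field_simp
  · rw [← Real.rpow_natCast, ← Real.rpow_mul (by positivity)]
    congr 1
    · refine sum_congr rfl fun x _ => ?_
      rw [abs_of_nonneg (hG x), ← Real.rpow_natCast, ← Real.rpow_mul (hG x), ← Real.rpow_natCast]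
      congr 1; field_simp
    · field_simp

end norms

/-! ### Characters -/

/-- The finite group used as physical space. -/
abbrev Gp (v l : ℕ) : Type := Fin l → ZMod (2 * v + 1)

/-- The character of frequency `ξ`. -/
noncomputable def ex {v l : ℕ} (ξ : Fin l → ℤ) (x : Gp v l) : ℂ :=
  ZMod.stdAddChar (∑ i, (ξ i : ZMod (2 * v + 1)) * x i)

/-- Functions with frequencies in `S`. -/
noncomputable def Sp (v : ℕ) {l : ℕ} (S : Set (Fin l → ℤ)) : Submodule ℂ (Gp v l → ℂ) :=
  Submodule.span ℂ (ex '' S)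

section chars
variable {v l : ℕ}

lemma ex_add (ξ η : Fin l → ℤ) (x : Gp v l) : ex (ξ + η) x = ex ξ x * ex η x := by
  unfold ex
  rw [← AddChar.map_add_eq_mul, ← sum_add_distrib]
  congr 1
  exact sum_congr rfl fun i _ => by simp [add_mul]

lemma ex_add_right (ξ : Fin l → ℤ) (x y : Gp v l) : ex ξ (x + y) = ex ξ x * ex ξ y := by
  unfold ex
  rw [← AddChar.map_add_eq_mul, ← sum_add_distrib]
  congr 1
  exact sum_congr rfl fun i _ => by simp [mul_add]

@[simp] lemma ex_zero (x : Gp v l) : ex 0 x = 1 := by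
  simp [ex]

@[simp] lemma ex_zero_right (ξ : Fin l → ℤ) : ex ξ (0 : Gp v l) = 1 := by
  simp [ex]

@[simp] lemma norm_ex (ξ : Fin l → ℤ) (x : Gp v l) : ‖ex ξ x‖ = 1 := by
  unfold ex; exact AddChar.norm_apply _ _

lemma ex_neg (ξ : Fin l → ℤ) (x : Gp v l) : ex (-ξ) x = (starRingEnd ℂ) (ex ξ x) := by
  have h1 : ex (-ξ) x * ex ξ x = 1 := by rw [← ex_add]; simp
  have h2 : (starRingEnd ℂ) (ex ξ x) * ex ξ x = 1 := by
    rw [mul_comm, Complex.mul_conj, Complex.normSq_eq_norm_sq, norm_ex]; simp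
  have h3 : ex ξ x ≠ 0 := by
    intro h; have := norm_ex ξ x; rw [h] at this; simp at this
  exact mul_right_cancel₀ h3 (h1.trans h2.symm)

lemma ex_neg_right (ξ : Fin l → ℤ) (x : Gp v l) : ex ξ (-x) = ex (-ξ) x := by
  unfold ex; congr 1; exact sum_congr rfl fun i _ => by simp

lemma Sp_mono {S T : Set (Fin l → ℤ)} (h : S ⊆ T) : Sp v S ≤ Sp v T :=
  Submodule.span_mono (Set.image_mono h)

lemma ex_mem_Sp {S : Set (Fin l → ℤ)} {ξ} (h : ξ ∈ S) : (ex ξ : Gp v l → ℂ) ∈ Sp v S :=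
  Submodule.subset_span ⟨ξ, h, rfl⟩

lemma map_mem_of_Sp {W : Type*} [AddCommGroup W] [Module ℂ W] (L : (Gp v l → ℂ) →ₗ[ℂ] W)
    {S : Set (Fin l → ℤ)} {T : Submodule ℂ W} (h : ∀ ξ ∈ S, L (ex ξ) ∈ T) {f : Gp v l → ℂ}
    (hf : f ∈ Sp v S) : L f ∈ T := by
  have : Sp v S ≤ T.comap L := by
    unfold Sp
    rw [Submodule.span_le]
    rintro _ ⟨ξ, hξ, rfl⟩
    exact h ξ hξ
  exact this hf

lemma mul_mem_Sp {S T R : Set (Fin l → ℤ)} (h : ∀ ξ ∈ S, ∀ η ∈ T, ξ + η ∈ R) {f g : Gp v l → ℂ}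
    (hf : f ∈ Sp v S) (hg : g ∈ Sp v T) : f * g ∈ Sp v R := by
  have h1 : ∀ ξ ∈ S, (ex ξ : Gp v l → ℂ) * g ∈ Sp v R := by
    intro ξ hξ
    refine map_mem_of_Sp (LinearMap.mulLeft ℂ (ex ξ : Gp v l → ℂ)) (fun η hη => ?_) hg
    have : LinearMap.mulLeft ℂ (ex ξ : Gp v l → ℂ) (ex η) = ex (ξ + η) := by
      funext x; simp [ex_add]
    rw [this]
    exact ex_mem_Sp (h ξ hξ η hη)
  exact map_mem_of_Sp (LinearMap.mulRight ℂ g) (fun ξ hξ => by simpa using h1 ξ hξ) hf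

lemma sum_ex_eq_zero {ξ : Fin l → ℤ} {i : Fin l} (h : (ξ i : ZMod (2 * v + 1)) ≠ 0) :
    ∑ x : Gp v l, ex ξ x = 0 := by
  classical
  set y : Gp v l := Pi.single i 1 with hy
  have h1 : ex ξ y ≠ 1 := by
    unfold ex
    intro h2
    rw [← AddChar.map_zero_eq_one (ZMod.stdAddChar (N := 2 * v + 1))] at h2
    have := ZMod.injective_stdAddChar h2
    rw [Finset.sum_eq_single i] at this
    · simp [hy] at this; exact h this
    · intro j _ hj; simp [hy, hj]
    · simp
  have h2 : ∑ x : Gp v l, ex ξ x = (∑ x : Gp v l, ex ξ x) * ex ξ y := by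
    rw [sum_mul, ← Equiv.sum_comp (Equiv.addRight y)]
    exact sum_congr rfl fun x _ => by simp [ex_add_right]
  have h3 : (∑ x : Gp v l, ex ξ x) * (ex ξ y - 1) = 0 := by
    rw [mul_sub, ← h2]; ring
  rcases mul_eq_zero.1 h3 with h | h
  · exact h
  · exact absurd (sub_eq_zero.1 h) h1

lemma intCast_ne_zero_of_abs_lt {a : ℤ} (h0 : a ≠ 0) (h : |a| < 2 * v + 1) :
    (a : ZMod (2 * v + 1)) ≠ 0 := by
  intro h1
  rw [ZMod.intCast_zmod_eq_zero_iff_dvd] at h1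
  have := Int.eq_zero_of_abs_lt_dvd h1 (by push_cast; exact h)
  exact h0 this

/-- Functions with well separated frequencies are orthogonal. -/
lemma inner_eq_zero_of_Sp {S T : Set (Fin l → ℤ)}
    (h : ∀ ξ ∈ S, ∀ η ∈ T, ∃ i, ((ξ i - η i : ℤ) : ZMod (2 * v + 1)) ≠ 0) {f g : Gp v l → ℂ}
    (hf : f ∈ Sp v S) (hg : g ∈ Sp v T) : ∑ x, f x * (starRingEnd ℂ) (g x) = 0 := by
  have h1 : ∀ ξ ∈ S, ∑ x, (starRingEnd ℂ) (ex ξ x : ℂ) * g x = 0 := by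
    intro ξ hξ
    let L : (Gp v l → ℂ) →ₗ[ℂ] ℂ :=
      ∑ x, (starRingEnd ℂ) (ex ξ x : ℂ) • LinearMap.proj x
    have hL : ∀ g, L g = ∑ x, (starRingEnd ℂ) (ex ξ x : ℂ) * g x := by
      intro g; simp [L]
    rw [← hL]
    have := map_mem_of_Sp (T := ⊥) L (fun η hη => ?_) hg
    · simpa using this
    · obtain ⟨i, hi⟩ := h ξ hξ η hη
      rw [Submodule.mem_bot, hL]
      have : ∀ x : Gp v l, (starRingEnd ℂ) (ex ξ x : ℂ) * ex η x = ex (η - ξ) x := by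
        intro x; rw [sub_eq_add_neg, ex_add, ex_neg]; ring
      simp only [this]
      refine sum_ex_eq_zero (i := i) ?_
      rw [Pi.sub_apply, ← neg_sub, Int.cast_neg]
      exact neg_ne_zero.2 hi
  let L : (Gp v l → ℂ) →ₗ[ℂ] ℂ := ∑ x, (starRingEnd ℂ) (g x : ℂ) • LinearMap.proj x
  have hL : ∀ f, L f = ∑ x, f x * (starRingEnd ℂ) (g x) := by
    intro f; simp [L, mul_comm]
  rw [← hL]
  have := map_mem_of_Sp (T := ⊥) L (fun ξ hξ => ?_) hf
  · simpa using this
  · rw [Submodule.mem_bot, hL]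
    have := congrArg (starRingEnd ℂ) (h1 ξ hξ)
    simpa [map_sum] using this

end chars

/-! ### Dyadic families of frequency sets -/

/-- The linear functional on polynomials sending `1` to `Λ` and `X ^ (r + 1)` to `ξ r`. -/
noncomputable def ev {R : Type*} [CommRing R] {k : ℕ} (Λ : ℤ) (ξ : Fin k → ℤ) : R[X] →ₗ[R] R :=
  (Λ : R) • lcoeff R 0 + ∑ r : Fin k, (ξ r : R) • lcoeff R (r + 1)

lemma ev_apply {R : Type*} [CommRing R] {k : ℕ} (Λ : ℤ) (ξ : Fin k → ℤ) (P : R[X]) :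
    ev Λ ξ P = Λ * P.coeff 0 + ∑ r : Fin k, (ξ r : R) * P.coeff (r + 1) := by
  simp [ev]

lemma ev_map {R S : Type*} [CommRing R] [CommRing S] (φ : R →+* S) {k : ℕ} (Λ : ℤ)
    (ξ : Fin k → ℤ) (P : R[X]) : ev Λ ξ (P.map φ) = φ (ev Λ ξ P) := by
  simp [ev_apply]

/-- Bounds for a functional on powers of `Y` transfer to powers of `α Y + β`. -/
lemma abs_map_affine_pow_le (φ : ℝ[X] →ₗ[ℝ] ℝ) (Y : ℝ[X]) {m : ℕ} {B : ℝ}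
    (h : ∀ r ≤ m, |φ (Y ^ r)| ≤ B) (α β : ℝ) :
    |φ ((C α * Y + C β) ^ m)| ≤ (|α| + |β|) ^ m * B := by
  have h1 : ∀ r, φ ((C α * Y) ^ r * C β ^ (m - r) * (m.choose r : ℝ[X])) =
      α ^ r * β ^ (m - r) * m.choose r * φ (Y ^ r) := by
    intro r
    have : (C α * Y) ^ r * C β ^ (m - r) * (m.choose r : ℝ[X]) =
        (α ^ r * β ^ (m - r) * m.choose r) • Y ^ r := by
      rw [smul_eq_C_mul]; simp; ring
    rw [this, map_smul, smul_eq_mul]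
  rw [add_pow, map_sum, add_pow, sum_mul]
  refine (abs_sum_le_sum_abs _ _).trans (sum_le_sum fun r hr => ?_)
  rw [h1, abs_mul, abs_mul, abs_mul, abs_pow, abs_pow, Nat.abs_cast]
  gcongr
  exact h r (by simpa [Nat.lt_succ_iff] using hr)

/-- The linear polynomial vanishing at `a / 2 ^ n`, scaled by `2 ^ n`. -/
noncomputable def lin (n : ℕ) (a : ℤ) : ℝ[X] := C ((2 : ℝ) ^ n) * X - C (a : ℝ)

lemma coeff_lin_zero (n : ℕ) (a : ℤ) : (lin n a).coeff 0 = -a := by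
  simp only [lin, coeff_sub, coeff_C_mul, coeff_X_zero, coeff_C_zero]; ring

lemma coeff_lin_one (n : ℕ) (a : ℤ) : (lin n a).coeff 1 = 2 ^ n := by
  simp only [lin, coeff_sub, coeff_C_mul, coeff_X_one, coeff_C_succ]; ring

/-- The frequencies close to the part of the moment curve above the dyadic interval `a` of
generation `n`. -/
def U (k : ℕ) (A : ℝ) (Λ : ℤ) (n : ℕ) (a : ℤ) : Set (Fin k → ℤ) :=
  {ξ | ∀ m ≤ k, |ev (R := ℝ) Λ ξ (lin n a ^ m)| ≤ A * Λ}

/-- The descendants of the interval `a`, `m` generations later. -/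
noncomputable def chd (m : ℕ) (a : ℤ) : Finset ℤ := Finset.Ico (a * 2 ^ m) ((a + 1) * 2 ^ m)

lemma mem_chd {m : ℕ} {a b : ℤ} : b ∈ chd m a ↔ b / 2 ^ m = a := by
  have h : (0 : ℤ) < 2 ^ m := by positivity
  unfold chd
  rw [Finset.mem_Ico, Int.ediv_eq_iff_of_pos h, add_mul, one_mul]

lemma card_chd (m : ℕ) (a : ℤ) : (chd m a).card = 2 ^ m := by
  unfold chd
  rw [Int.card_Ico]
  have : (a + 1) * 2 ^ m - a * 2 ^ m = (2 : ℤ) ^ m := by ring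
  rw [this]
  norm_cast

lemma chd_zero (a : ℤ) : chd 0 a = {a} := by
  ext b; simp [mem_chd]

lemma sum_chd_add {E : Type*} [AddCommMonoid E] (m m' : ℕ) (a : ℤ) (h : ℤ → E) :
    ∑ b ∈ chd (m + m') a, h b = ∑ b' ∈ chd m a, ∑ b ∈ chd m' b', h b := by
  have key : ∀ b : ℤ, b / 2 ^ (m + m') = b / 2 ^ m' / 2 ^ m := by
    intro b
    rw [Int.ediv_ediv_of_nonneg (by positivity), ← pow_add, add_comm m m']
  rw [← Finset.sum_fiberwise_of_maps_to (s := chd (m + m') a) (t := chd m a)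
    (g := fun b => b / 2 ^ m')]
  · refine sum_congr rfl fun b' hb' => sum_congr ?_ fun _ _ => rfl
    ext b
    rw [mem_chd] at hb'
    simp only [mem_filter, mem_chd, key]
    constructor
    · exact fun h => h.2
    · intro h; exact ⟨by rw [h, hb'], h⟩
  · intro b hb
    rw [mem_chd] at *
    rw [← key, hb]

lemma sum_chd_shift {E : Type*} [AddCommMonoid E] (m : ℕ) (a c : ℤ) (h : ℤ → E) :
    ∑ b ∈ chd m (a + c), h b = ∑ b ∈ chd m a, h (b + c * 2 ^ m) := by
  unfold chd
  rw [add_mul, show (a + c + 1) * 2 ^ m = (a + 1) * 2 ^ m + c * 2 ^ m by ring,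
    ← Finset.sum_image (s := Finset.Ico (a * 2 ^ m) ((a + 1) * 2 ^ m)) (g := fun b => b + c * 2 ^ m)]
  · rw [Finset.image_add_right_Ico]
  · intro x _ y _ h; simpa using h

lemma lin_eq_affine {n m : ℕ} (a b : ℤ) :
    lin n a = C (((2 : ℝ) ^ m)⁻¹) * lin (n + m) b + C (((2 : ℝ) ^ m)⁻¹ * (b - a * 2 ^ m)) := by
  unfold lin
  have h : (2 : ℝ) ^ m ≠ 0 := by positivity
  rw [mul_sub, ← mul_assoc, ← C_mul, ← C_mul]
  have h1 : ((2 : ℝ) ^ m)⁻¹ * 2 ^ (n + m) = 2 ^ n := by rw [pow_add]; field_simp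
  rw [h1, sub_add, ← C_sub]
  congr 2
  field_simp
  ring

/-- Frequencies above an interval are above its ancestors. -/
lemma U_subset_parent {k : ℕ} {A : ℝ} (hA : 0 ≤ A) {Λ : ℤ} (hΛ : 0 ≤ Λ) {n m : ℕ} {a b : ℤ}
    (hb : b ∈ chd m a) : U k A Λ (n + m) b ⊆ U k (2 ^ k * A) Λ n a := by
  intro ξ hξ r hr
  have hΛ' : (0 : ℝ) ≤ Λ := by exact_mod_cast hΛ
  rw [lin_eq_affine (m := m) a b]
  refine (abs_map_affine_pow_le _ _ (fun s hs => hξ s (hs.trans hr)) _ _).trans ?_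
  rw [mul_assoc]
  have h2 : (1 : ℝ) ≤ 2 ^ m := one_le_pow₀ (by norm_num)
  have hb' : |(b : ℝ) - a * 2 ^ m| ≤ 2 ^ m - 1 := by
    unfold chd at hb
    rw [Finset.mem_Ico] at hb
    have h1 : (0 : ℤ) ≤ b - a * 2 ^ m := by linarith [hb.1]
    have h3 : b - a * 2 ^ m ≤ 2 ^ m - 1 := by have := hb.2; rw [add_mul] at this; linarith
    have h1' : (0 : ℝ) ≤ b - a * 2 ^ m := by exact_mod_cast h1
    rw [abs_of_nonneg h1']
    exact_mod_cast h3
  have h4 : |((2 : ℝ) ^ m)⁻¹| + |((2 : ℝ) ^ m)⁻¹ * (b - a * 2 ^ m)| ≤ 2 := by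
    rw [abs_mul, abs_of_pos (by positivity : (0 : ℝ) < (2 ^ m)⁻¹)]
    have : ((2 : ℝ) ^ m)⁻¹ * |(b : ℝ) - a * 2 ^ m| ≤ (2 ^ m)⁻¹ * (2 ^ m - 1) := by gcongr
    have e : ((2 : ℝ) ^ m)⁻¹ * (2 ^ m - 1) = 1 - (2 ^ m)⁻¹ := by field_simp
    linarith
  have h5 : (|((2 : ℝ) ^ m)⁻¹| + |((2 : ℝ) ^ m)⁻¹ * (b - a * 2 ^ m)|) ^ r ≤ 2 ^ k :=
    (pow_le_pow_left₀ (by positivity) h4 r).trans (pow_le_pow_right₀ (by norm_num) hr)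
  gcongr

/-- A family of functions adapted to the intervals of generation `n`. -/
def Fam (k : ℕ) (A : ℝ) (Λ : ℤ) (v n : ℕ) (f : ℤ → Gp v k → ℂ) : Prop :=
  ∀ b, f b ∈ Sp v (U k A Λ n b)

/-- Half of the critical exponent `k (k + 1)`. -/
def dd (k : ℕ) : ℕ := ∑ i ∈ range (k + 1), i

lemma two_mul_dd (k : ℕ) : 2 * dd k = k * (k + 1) := by
  unfold dd
  have := Finset.sum_range_id_mul_two (k + 1)
  rw [mul_comm] at this; rw [this]; simp [mul_comm]

lemma one_le_dd {k : ℕ} (hk : 1 ≤ k) : 1 ≤ dd k := by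
  have := two_mul_dd k; nlinarith

lemma dd_mono {k l : ℕ} (h : l ≤ k) : dd l ≤ dd k := by
  unfold dd
  exact sum_le_sum_of_subset (by intro x; simp; omega)

/-- Decoupling inequality on `Gp v k` at generation `n` with constant `D`. -/
def DecAt (k : ℕ) (A : ℝ) (Λ : ℤ) (v n : ℕ) (D : ℝ) : Prop :=
  ∀ f, Fam k A Λ v n f →
    nsq (dd k) (∑ b ∈ chd n 0, f b) ≤ D * ∑ b ∈ chd n 0, nsq (dd k) (f b)

/-- Decoupling inequality at generation `n` with constant `D`. -/
def Dec (k : ℕ) (A : ℝ) (n : ℕ) (D : ℝ) : Prop :=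
  ∀ Λ : ℤ, 1 ≤ Λ → ∀ᶠ v in Filter.atTop, DecAt k A Λ v n D

/-- Decoupling with exponent `x + ε` for all `ε > 0`. -/
def ExpDec (k : ℕ) (A : ℝ) (x : ℝ) : Prop :=
  ∀ ε > 0, ∃ C : ℝ, 1 ≤ C ∧ ∀ n : ℕ, Dec k A n (C * 2 ^ ((x + ε) * n))

/-! ### The base case -/

lemma dd_one : dd 1 = 1 := by decide

lemma nsq_one {α : Type*} [Fintype α] (f : α → ℂ) : nsq 1 f = ∑ x, ‖f x‖ ^ 2 := by
  simp [nsq, nrm]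

lemma nsq_one_sum_le {ι : Type*} {v l : ℕ} (s : Finset ι) (r : ι → ι → Prop)
    [DecidableRel r] (hr : ∀ a b, r a b → r b a) (f : ι → Gp v l → ℂ) (K : ℝ)
    (hK : ∀ a ∈ s, (((s.filter (r a)).card : ℕ) : ℝ) ≤ K)
    (h : ∀ a ∈ s, ∀ b ∈ s, ¬ r a b → ∑ x, f a x * (starRingEnd ℂ) (f b x) = 0) :
    nsq 1 (∑ b ∈ s, f b) ≤ K * ∑ b ∈ s, nsq 1 (f b) := by
  have h0 : ((nsq 1 (∑ b ∈ s, f b) : ℝ) : ℂ) =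
      ∑ a ∈ s, ∑ b ∈ s, ∑ x, f a x * (starRingEnd ℂ) (f b x) := by
    rw [nsq_one]
    push_cast
    have : ∀ x, ((‖(∑ b ∈ s, f b) x‖ : ℝ) : ℂ) ^ 2 =
        ∑ a ∈ s, ∑ b ∈ s, f a x * (starRingEnd ℂ) (f b x) := by
      intro x
      rw [← Complex.mul_conj', Finset.sum_apply, map_sum, sum_mul_sum]
    simp only [this]
    rw [sum_comm]
    exact sum_congr rfl fun a _ => sum_comm
  have h1 : nsq 1 (∑ b ∈ s, f b) = ‖((nsq 1 (∑ b ∈ s, f b) : ℝ) : ℂ)‖ := by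
    rw [Complex.norm_real, Real.norm_of_nonneg (nsq_nonneg _ _)]
  have h2 : ∀ a b, ‖∑ x, f a x * (starRingEnd ℂ) (f b x)‖ ≤ (nsq 1 (f a) + nsq 1 (f b)) / 2 := by
    intro a b
    rw [nsq_one, nsq_one, ← sum_add_distrib, sum_div]
    refine (norm_sum_le _ _).trans (sum_le_sum fun x _ => ?_)
    rw [norm_mul, RCLike.norm_conj]
    nlinarith [sq_nonneg (‖f a x‖ - ‖f b x‖)]
  have h3 : ∀ a ∈ s, ∀ b ∈ s, ‖∑ x, f a x * (starRingEnd ℂ) (f b x)‖ ≤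
      if r a b then (nsq 1 (f a) + nsq 1 (f b)) / 2 else 0 := by
    intro a ha b hb
    split_ifs with hab
    · exact h2 a b
    · rw [h a ha b hb hab, norm_zero]
  rw [h1, h0]
  have hs : ∀ a b, r a b ↔ r b a := fun a b => ⟨hr a b, hr b a⟩
  calc _ ≤ ∑ a ∈ s, ∑ b ∈ s, if r a b then (nsq 1 (f a) + nsq 1 (f b)) / 2 else 0 := by
        refine (norm_sum_le _ _).trans (sum_le_sum fun a ha => (norm_sum_le _ _).trans
          (sum_le_sum fun b hb => h3 a ha b hb))
    _ = ∑ a ∈ s, ∑ b ∈ s, ((if r a b then nsq 1 (f a) / 2 else 0) +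
          if r a b then nsq 1 (f b) / 2 else 0) := by
        refine sum_congr rfl fun a _ => sum_congr rfl fun b _ => ?_
        split_ifs <;> ring
    _ = ∑ a ∈ s, ∑ b ∈ s, (if r a b then nsq 1 (f a) else 0) := by
        simp only [sum_add_distrib]
        rw [sum_comm (f := fun a b => if r a b then nsq 1 (f b) / 2 else 0), ← sum_add_distrib]
        refine sum_congr rfl fun a _ => ?_
        rw [← sum_add_distrib]
        refine sum_congr rfl fun b _ => ?_
        simp only [hs b a]
        split_ifs <;> ring
    _ = ∑ a ∈ s, ((s.filter (r a)).card : ℝ) * nsq 1 (f a) := by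
        refine sum_congr rfl fun a _ => ?_
        rw [← sum_filter, sum_const, nsmul_eq_mul]
    _ ≤ ∑ a ∈ s, K * nsq 1 (f a) := by
        refine sum_le_sum fun a ha => ?_
        have := nsq_nonneg 1 (f a)
        have := hK a ha
        gcongr
    _ = _ := by rw [mul_sum]

lemma dec_one {A : ℝ} (hA : 1 ≤ A) (n : ℕ) : Dec 1 A n (4 * A + 1) := by
  classical
  intro Λ hΛ
  have hΛ' : (1 : ℝ) ≤ Λ := by exact_mod_cast hΛ
  obtain ⟨v₀, hv₀⟩ := exists_nat_gt ((1 + 2 * A) * Λ)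
  filter_upwards [Filter.eventually_ge_atTop v₀] with v hv f hf
  rw [dd_one]
  refine nsq_one_sum_le (chd n 0) (fun a b : ℤ => |(a : ℝ) - b| ≤ 2 * A)
    (fun a b h => by rwa [abs_sub_comm]) f _ ?_ ?_
  · intro a _
    have : (chd n 0).filter (fun b : ℤ => |(a : ℝ) - b| ≤ 2 * A) ⊆
        Finset.Icc (a - ⌊2 * A⌋) (a + ⌊2 * A⌋) := by
      intro b hb
      have := (mem_filter.1 hb).2
      rw [abs_le] at this
      have h1 : a - b ≤ ⌊2 * A⌋ := Int.le_floor.2 (by push_cast; linarith)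
      have h2 : b - a ≤ ⌊2 * A⌋ := Int.le_floor.2 (by push_cast; linarith)
      rw [Finset.mem_Icc]; constructor <;> linarith
    have hc := card_le_card this
    rw [Int.card_Icc] at hc
    have h0 : 0 ≤ ⌊2 * A⌋ := Int.floor_nonneg.2 (by linarith)
    have hfl := Int.floor_le (2 * A)
    have : (((chd n 0).filter (fun b : ℤ => |(a : ℝ) - b| ≤ 2 * A)).card : ℤ) ≤ 2 * ⌊2 * A⌋ + 1 := by
      have : (((chd n 0).filter (fun b : ℤ => |(a : ℝ) - b| ≤ 2 * A)).card : ℤ) ≤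
        ((a + ⌊2 * A⌋ + 1 - (a - ⌊2 * A⌋)).toNat : ℕ) := by exact_mod_cast hc
      rw [Int.toNat_of_nonneg (by linarith)] at this
      linarith
    have : (((chd n 0).filter (fun b : ℤ => |(a : ℝ) - b| ≤ 2 * A)).card : ℝ) ≤ 2 * ⌊2 * A⌋ + 1 := by
      exact_mod_cast this
    linarith
  · intro a ha b hb hab
    refine inner_eq_zero_of_Sp (S := U 1 A Λ n a) (T := U 1 A Λ n b) ?_ (hf a) (hf b)
    intro ξ hξ η hη
    refine ⟨0, intCast_ne_zero_of_abs_lt ?_ ?_⟩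
    all_goals
      have h1 := hξ 1 le_rfl
      have h2 := hη 1 le_rfl
      simp [ev_apply, coeff_lin_zero, coeff_lin_one] at h1 h2
      have h3 : |(a : ℝ) - b| ≤ 2 ^ n := by
        unfold chd at ha hb
        simp at ha hb
        have : |a - b| ≤ 2 ^ n := by rw [abs_le]; constructor <;> linarith
        exact_mod_cast this
      have key : ((ξ 0 : ℝ) - η 0) * 2 ^ n - (a - b) * Λ =
        (-(Λ * a) + ξ 0 * 2 ^ n) - (-(Λ * b) + η 0 * 2 ^ n) := by ring
      have h4 : |((ξ 0 : ℝ) - η 0) * 2 ^ n - (a - b) * Λ| ≤ 2 * (A * Λ) := by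
        rw [key]; refine (abs_sub _ _).trans (by linarith)
      have h5 : |((a : ℝ) - b) * Λ| = |(a : ℝ) - b| * Λ := by rw [abs_mul, abs_of_pos (by linarith : (0:ℝ) < Λ)]
    · intro h0
      have h0' : (ξ 0 : ℝ) - η 0 = 0 := by exact_mod_cast h0
      rw [h0', zero_mul, zero_sub, abs_neg, h5] at h4
      apply hab
      nlinarith
    · have h6 : |((ξ 0 : ℝ) - η 0)| * 2 ^ n ≤ 2 ^ n * Λ + 2 * (A * Λ) := by
        have : |((ξ 0 : ℝ) - η 0) * 2 ^ n| ≤ |((a : ℝ) - b) * Λ| + 2 * (A * Λ) := by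
          have := abs_sub_abs_le_abs_sub (((ξ 0 : ℝ) - η 0) * 2 ^ n) ((a - b) * Λ)
          linarith
        rw [h5, abs_mul, abs_of_pos (by positivity : (0 : ℝ) < 2 ^ n)] at this
        nlinarith
      have h7 : (1 : ℝ) ≤ 2 ^ n := one_le_pow₀ (by norm_num)
      have h8 : |((ξ 0 : ℝ) - η 0)| ≤ Λ + 2 * (A * Λ) := by
        by_contra hcon
        push Not at hcon
        have h9 : 0 ≤ A * Λ := by positivity
        have : (Λ + 2 * (A * Λ)) * 2 ^ n < |((ξ 0 : ℝ) - η 0)| * 2 ^ n := by gcongr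
        nlinarith
      have h9 : |((ξ 0 : ℝ) - η 0)| < 2 * v + 1 := by
        have : (v₀ : ℝ) ≤ v := by exact_mod_cast hv
        have : (0 : ℝ) ≤ v := by positivity
        linarith
      exact_mod_cast h9

/-! ### Affine changes of frequency -/

/-- The dual of the linear part of the frequency map `ξ ↦ (ev Λ ξ (Q m))_m`. -/
def th {l k : ℕ} (v : ℕ) (Q : Fin l → ℤ[X]) : Gp v l →+ Gp v k where
  toFun y r := ∑ m, ((Q m).coeff (r + 1) : ZMod (2 * v + 1)) * y m
  map_zero' := by funext r; simp
  map_add' y z := by funext r; simp [mul_add, sum_add_distrib]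

lemma th_apply {l k : ℕ} (v : ℕ) (Q : Fin l → ℤ[X]) (y : Gp v l) (r : Fin k) :
    th v Q y r = ∑ m, ((Q m).coeff (r + 1) : ZMod (2 * v + 1)) * y m := rfl

lemma ex_ev {l k v : ℕ} (Λ : ℤ) (Q : Fin l → ℤ[X]) (ξ : Fin k → ℤ) (y : Gp v l) :
    ex (fun m => ev Λ ξ (Q m)) y = ex (fun m => Λ * (Q m).coeff 0) y * ex ξ (th v Q y) := by
  unfold ex
  rw [← AddChar.map_add_eq_mul]
  congr 1
  simp only [ev_apply, th_apply]
  push_cast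
  simp only [add_mul, sum_add_distrib, mul_sum, sum_mul]
  congr 1
  rw [sum_comm]
  exact sum_congr rfl fun r _ => sum_congr rfl fun m _ => by ring

lemma ev_ev {l k : ℕ} (Λ Λ' : ℤ) (Q : Fin l → ℤ[X]) (ξ : Fin k → ℤ) (P : ℝ[X]) :
    ev Λ' (fun m => ev Λ ξ (Q m)) P = Λ' * P.coeff 0 +
      ∑ m : Fin l, P.coeff (m + 1) * ev (R := ℝ) Λ ξ ((Q m).map (Int.castRingHom ℝ)) := by
  rw [ev_apply]
  congr 1
  refine sum_congr rfl fun m _ => ?_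
  rw [ev_map]; simp [mul_comm]

lemma comp_eq_sum_fin {l : ℕ} (P L : ℝ[X]) (h : P.natDegree ≤ l) :
    P.comp L = C (P.coeff 0) + ∑ m : Fin l, P.coeff (m + 1) • L ^ ((m : ℕ) + 1) := by
  rw [comp, eval₂_eq_sum_range' C (Nat.lt_succ_of_le h), Finset.sum_range_succ', add_comm]
  simp only [pow_zero, mul_one]
  rw [Finset.sum_range (n := l)]
  simp [smul_eq_C_mul]

lemma natDegree_lin_pow_le (n : ℕ) (a : ℤ) (r : ℕ) : (lin n a ^ r).natDegree ≤ r := by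
  refine (natDegree_pow_le_of_le r (m := 1) ?_).trans (by simp)
  unfold lin
  compute_degree

/-- The integer version of `lin`. -/
noncomputable def linZ (n : ℕ) (a : ℤ) : ℤ[X] := C ((2 : ℤ) ^ n) * X - C a

lemma map_linZ (n : ℕ) (a : ℤ) : (linZ n a).map (Int.castRingHom ℝ) = lin n a := by
  simp only [linZ, lin, Polynomial.map_sub, Polynomial.map_mul, map_C, map_X]
  simp

lemma lin_comp_lin (i m : ℕ) (a b : ℤ) : (lin m b).comp (lin i a) = lin (i + m) (b + a * 2 ^ m) := by
  simp only [lin, sub_comp, mul_comp, C_comp, X_comp]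
  rw [mul_sub, ← mul_assoc, ← C_mul, ← C_mul, sub_sub, ← C_add]
  congr 2
  · rw [pow_add]; ring_nf
  · push_cast; ring

lemma coeff_linZ_pow (i : ℕ) (a : ℤ) (m : ℕ) : (linZ i a ^ m).coeff m = (2 ^ i) ^ m := by
  have h : (linZ i a).natDegree ≤ 1 := by unfold linZ; compute_degree
  have := coeff_pow_of_natDegree_le h (m := m)
  rw [mul_one] at this
  rw [this]
  congr 1
  simp only [linZ, coeff_sub, coeff_C_mul, coeff_X_one, coeff_C_succ]; ring

lemma coeff_linZ_pow_of_lt (i : ℕ) (a : ℤ) {m r : ℕ} (h : m < r) : (linZ i a ^ m).coeff r = 0 := by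
  have h1 : (linZ i a).natDegree ≤ 1 := by unfold linZ; compute_degree
  have := natDegree_pow_le_of_le m h1
  exact coeff_eq_zero_of_natDegree_lt (by omega)

lemma th_linZ_bijective (k v i : ℕ) (a : ℤ) :
    Function.Bijective (th (k := k) v (fun m : Fin k => linZ i a ^ ((m : ℕ) + 1))) := by
  classical
  set Z : Matrix (Fin k) (Fin k) (ZMod (2 * v + 1)) :=
    Matrix.of fun m r => (((linZ i a ^ ((m : ℕ) + 1)).coeff (r + 1) : ℤ) : ZMod (2 * v + 1)) with hZ
  have h2 : IsUnit (2 : ZMod (2 * v + 1)) := by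
    have : IsUnit ((2 : ℕ) : ZMod (2 * v + 1)) := by
      rw [ZMod.isUnit_iff_coprime]
      simp
    simpa using this
  have hdet : IsUnit Z.det := by
    rw [Matrix.det_of_isLowerTriangular]
    · rw [IsUnit.prod_univ_iff]
      intro m
      simp only [hZ, Matrix.of_apply, coeff_linZ_pow]
      push_cast
      exact (h2.pow _).pow _
    · intro m r hmr
      have : m < r := hmr
      simp only [hZ, Matrix.of_apply]
      rw [coeff_linZ_pow_of_lt]
      · simp
      · simpa using this
  have hinj : Function.Injective (th (k := k) v (fun m : Fin k => linZ i a ^ ((m : ℕ) + 1))) := by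
    have := Matrix.vecMul_injective_of_isUnit ((Matrix.isUnit_iff_isUnit_det _).2 hdet)
    intro x y hxy
    apply this
    funext r
    have := congrFun hxy r
    simp only [th_apply] at this
    simpa [Matrix.vecMul, dotProduct, hZ, mul_comm] using this
  exact Finite.injective_iff_bijective.1 hinj

/-- Rescaling a dyadic interval to the unit interval. -/
lemma exists_rescale (k : ℕ) (A : ℝ) (Λ : ℤ) (v i m : ℕ) (a : ℤ) :
    ∃ (σ : Gp v k ≃ Gp v k) (w : Gp v k → ℂ), (∀ x, ‖w x‖ = 1) ∧
      ∀ f, Fam k A Λ v (i + m) f → Fam k A Λ v m (fun b x => w x * f (b + a * 2 ^ m) (σ x)) := by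
  set Q : Fin k → ℤ[X] := fun m => linZ i a ^ ((m : ℕ) + 1) with hQ
  refine ⟨Equiv.ofBijective _ (th_linZ_bijective k v i a), ex (fun m => Λ * (Q m).coeff 0),
    fun x => norm_ex _ _, fun f hf b => ?_⟩
  let L : (Gp v k → ℂ) →ₗ[ℂ] (Gp v k → ℂ) :=
    { toFun := fun g x => ex (fun m => Λ * (Q m).coeff 0) x * g (th v Q x)
      map_add' := fun g h => by funext x; simp [mul_add]
      map_smul' := fun c g => by funext x; simp; ring }
  refine map_mem_of_Sp L (fun ξ hξ => ?_) (hf (b + a * 2 ^ m))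
  have : L (ex ξ) = ex (fun m => ev Λ ξ (Q m)) := by
    funext x; rw [ex_ev]; rfl
  rw [this]
  refine ex_mem_Sp fun r hr => ?_
  rw [ev_ev]
  simp only [hQ, Polynomial.map_pow, map_linZ]
  have h1 := comp_eq_sum_fin (lin m b ^ r) (lin i a) ((natDegree_lin_pow_le m b r).trans hr)
  have h2 := hξ r hr
  rw [← lin_comp_lin, ← pow_comp, h1, map_add, map_sum] at h2
  convert h2 using 3
  · rw [ev_apply]; simp [coeff_C]
  · simp

lemma DecAt.block {k : ℕ} {A : ℝ} {Λ : ℤ} {v m : ℕ} {D : ℝ} (h : DecAt k A Λ v m D) (i : ℕ)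
    (a : ℤ) {f : ℤ → Gp v k → ℂ} (hf : Fam k A Λ v (i + m) f) :
    nsq (dd k) (∑ b ∈ chd m a, f b) ≤ D * ∑ b ∈ chd m a, nsq (dd k) (f b) := by
  obtain ⟨σ, w, hw, hfam⟩ := exists_rescale k A Λ v i m a
  have := h _ (hfam f hf)
  have e := fun (g : ℤ → Gp v k → ℂ) => sum_chd_shift m 0 a g
  have e' := fun (g : ℤ → ℝ) => sum_chd_shift m 0 a g
  rw [zero_add] at e e'
  rw [e, e']
  convert this using 1
  · refine (nsq_congr σ fun x => ?_).symm
    simp only [Finset.sum_apply]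
    rw [← mul_sum, norm_mul, hw, one_mul]
  · congr 1
    refine sum_congr rfl fun b _ => (nsq_congr σ fun x => ?_).symm
    rw [norm_mul, hw, one_mul]

/-! ### A reproducing kernel for boxes -/

/-- The box of radius `R` in frequency space. -/
noncomputable def box (l R : ℕ) : Finset (Fin l → ℤ) := Fintype.piFinset fun _ => Finset.Icc (-(R : ℤ)) R

lemma mem_box {l R : ℕ} {u : Fin l → ℤ} : u ∈ box l R ↔ ∀ i, |u i| ≤ R := by
  simp [box, Fintype.mem_piFinset, abs_le]

lemma card_box (l R : ℕ) : (box l R).card = (2 * R + 1) ^ l := by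
  unfold box
  rw [Fintype.card_piFinset]
  simp only [Int.card_Icc]
  rw [prod_const, card_univ, Fintype.card_fin]
  congr 1; omega

/-- The Dirichlet kernel of a box. -/
noncomputable def dirichlet {v l : ℕ} (R : ℕ) (y : Gp v l) : ℂ := ∑ u ∈ box l R, ex u y

lemma norm_dirichlet_le {v l : ℕ} (R : ℕ) (y : Gp v l) : ‖dirichlet R y‖ ≤ (2 * R + 1) ^ l := by
  unfold dirichlet
  refine (norm_sum_le _ _).trans (le_of_eq ?_)
  simp only [norm_ex, sum_const, card_box]
  simp

lemma dirichlet_zero {v l : ℕ} (R : ℕ) : dirichlet R (0 : Gp v l) = (2 * R + 1) ^ l := by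
  simp [dirichlet, card_box]

lemma dirichlet_mem {v l : ℕ} (R : ℕ) : (dirichlet R : Gp v l → ℂ) ∈ Sp v (box l R : Set _) := by
  have : (dirichlet R : Gp v l → ℂ) = ∑ u ∈ box l R, ex u := by
    funext y; simp [dirichlet]
  rw [this]
  exact Submodule.sum_mem _ fun u hu => ex_mem_Sp hu

lemma sum_ex_of_small {v l : ℕ} {R : ℕ} (hR : 2 * R < 2 * v + 1) {ξ u : Fin l → ℤ}
    (hξ : ξ ∈ box l R) (hu : u ∈ box l R) :
    ∑ y : Gp v l, ex (ξ + u) y = if u = -ξ then ((2 * v + 1 : ℂ)) ^ l else 0 := by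
  split_ifs with h
  · subst h
    simp [ZMod.card]
  · have : ∃ i, u i ≠ - ξ i := by
      by_contra hcon
      push Not at hcon
      exact h (funext hcon)
    obtain ⟨i, hi⟩ := this
    refine sum_ex_eq_zero (i := i) (intCast_ne_zero_of_abs_lt ?_ ?_)
    · intro h0; apply hi; simp at h0; linarith
    · rw [mem_box] at hξ hu
      have h1 := hξ i
      have h2 := hu i
      rw [Pi.add_apply]
      refine (abs_add_le _ _).trans_lt ?_
      have : (2 * R : ℤ) < 2 * v + 1 := by exact_mod_cast hR
      linarith

lemma reproducing {v l : ℕ} {R : ℕ} (hR : 2 * R < 2 * v + 1) {h : Gp v l → ℂ}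
    (hh : h ∈ Sp v (box l R : Set _)) :
    (2 * v + 1 : ℂ) ^ l * h 0 = ∑ y, h y * dirichlet R y := by
  classical
  let L : (Gp v l → ℂ) →ₗ[ℂ] ℂ :=
    (2 * v + 1 : ℂ) ^ l • LinearMap.proj 0 - ∑ y, dirichlet R y • LinearMap.proj y
  have hL : ∀ h, L h = (2 * v + 1 : ℂ) ^ l * h 0 - ∑ y, h y * dirichlet R y := by
    intro h; simp [L, mul_comm]
  have := map_mem_of_Sp (T := ⊥) L (fun ξ hξ => ?_) hh
  · rw [Submodule.mem_bot, hL, sub_eq_zero] at this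
    exact this
  · rw [Submodule.mem_bot, hL, sub_eq_zero]
    have hξ' : ξ ∈ box l R := hξ
    simp only [dirichlet, mul_sum, ← ex_add]
    rw [sum_comm, sum_congr rfl fun u hu => sum_ex_of_small hR hξ' hu, sum_ite_eq']
    have : -ξ ∈ box l R := by
      rw [mem_box] at *; simpa using hξ'
    simp [this]

lemma sum_norm_dirichlet_sq {v l : ℕ} {R : ℕ} (hR : 2 * R < 2 * v + 1) :
    ∑ y : Gp v l, ‖dirichlet R y‖ ^ 2 = (2 * v + 1) ^ l * (2 * R + 1) ^ l := by
  have h : ∀ y : Gp v l, (starRingEnd ℂ) (dirichlet R y) = dirichlet R y := by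
    intro y
    simp only [dirichlet, map_sum, ← ex_neg]
    refine Finset.sum_nbij' (fun u => -u) (fun u => -u) ?_ ?_ ?_ ?_ ?_ <;>
      simp [mem_box]
  have h2 := reproducing hR (dirichlet_mem (v := v) (l := l) R)
  rw [dirichlet_zero] at h2
  have h3 : (((∑ y : Gp v l, ‖dirichlet R y‖ ^ 2 : ℝ)) : ℂ) =
      (2 * v + 1) ^ l * (2 * R + 1) ^ l := by
    rw [h2]
    push_cast
    refine sum_congr rfl fun y _ => ?_
    rw [← Complex.mul_conj', h]
  exact_mod_cast h3

lemma sum_norm_dirichlet_pow_le {v l p : ℕ} (hp : 2 ≤ p) {R : ℕ} (hR : 2 * R < 2 * v + 1) :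
    ∑ y : Gp v l, ‖dirichlet R y‖ ^ p ≤ (2 * v + 1) ^ l * ((2 * R + 1 : ℝ) ^ l) ^ (p - 1) := by
  obtain ⟨q, rfl⟩ := Nat.exists_eq_add_of_le hp
  calc ∑ y : Gp v l, ‖dirichlet R y‖ ^ (2 + q)
      ≤ ∑ y : Gp v l, ‖dirichlet R y‖ ^ 2 * ((2 * R + 1 : ℝ) ^ l) ^ q := by
        refine sum_le_sum fun y _ => ?_
        rw [pow_add]
        have := norm_dirichlet_le R y
        gcongr
    _ = _ := by
        rw [← sum_mul, sum_norm_dirichlet_sq hR, mul_assoc, ← pow_succ']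
        congr 2; omega

lemma pow_mem_Sp_box {v l : ℕ} {R : ℕ} {g : Gp v l → ℂ} (hg : g ∈ Sp v (box l R : Set _))
    (n : ℕ) : g ^ n ∈ Sp v (box l (n * R) : Set _) := by
  induction n with
  | zero =>
    have : (g ^ 0 : Gp v l → ℂ) = ex 0 := by funext y; simp
    rw [this]
    exact ex_mem_Sp (by simp [mem_box])
  | succ n ih =>
    rw [pow_succ]
    refine mul_mem_Sp (fun ξ hξ η hη => ?_) ih hg
    simp only [mem_coe, mem_box] at *
    intro i
    refine (abs_add_le _ _).trans ?_
    push_cast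
    push_cast at hξ
    linarith [hξ i, hη i]

/-- A function with frequencies in a box is controlled at the origin by an average with weights
which are `p`-th powers of functions with frequencies in a dilate of the box. -/
lemma exists_kernel (l p : ℕ) (hp : 2 ≤ p) : ∃ C : ℝ, 1 ≤ C ∧ ∀ R v : ℕ, 2 * (p * R) < 2 * v + 1 →
    ∃ ψ : Bool → Gp v l → ℂ, (∀ i, ψ i ∈ Sp v (box l (p * R) : Set _)) ∧
      (∀ i, ∑ y, ‖ψ i y‖ ^ p ≤ C) ∧
      ∀ g ∈ Sp v (box l R : Set _), ‖g 0‖ ^ 2 ≤ C * ∑ i, ∑ y, ‖ψ i y‖ ^ p * ‖g y‖ ^ 2 := by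
  have hp0 : (0:ℝ) ≤ ((p : ℝ) ^ l) ^ (p - 1) := by positivity
  refine ⟨1 + ((p : ℝ) ^ l) ^ (p - 1), by linarith, fun R v hv => ?_⟩
  have hpR : R ≤ p * R := Nat.le_mul_of_pos_left _ (by omega)
  set M : ℝ := (2 * v + 1) ^ l with hM
  set N : ℝ := (2 * R + 1) ^ l with hN
  have hM0 : 0 < M := by positivity
  have hN0 : 0 < N := by positivity
  set c : ℝ := ((M * N ^ (p - 1))⁻¹) ^ ((p : ℝ)⁻¹) with hc
  have hc0 : 0 ≤ c := by positivity
  have hcp : c ^ p = (M * N ^ (p - 1))⁻¹ :=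
    Real.rpow_inv_natCast_pow (by positivity) (by omega)
  set rr : Bool → ℕ := fun i => cond i (p * R) R with hrr
  have hrp : ∀ i, rr i ≤ p * R := by intro i; cases i <;> simp [hrr, hpR]
  set ψ : Bool → Gp v l → ℂ := fun i => (c : ℂ) • dirichlet (rr i) with hψ
  have hψn : ∀ i y, ‖ψ i y‖ ^ p = (M * N ^ (p - 1))⁻¹ * ‖dirichlet (rr i) y‖ ^ p := by
    intro i y
    simp only [hψ, Pi.smul_apply, smul_eq_mul, norm_mul, mul_pow, Complex.norm_real,
      Real.norm_of_nonneg hc0, hcp]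
  have hsum : ∀ i, ∑ y, ‖ψ i y‖ ^ p ≤ cond i (((p : ℝ) ^ l) ^ (p - 1)) 1 := by
    intro i
    simp only [hψn, ← mul_sum]
    have h1 := sum_norm_dirichlet_pow_le (v := v) (l := l) hp (R := rr i)
      (by have := hrp i; omega)
    rw [inv_mul_le_iff₀ (by positivity)]
    refine h1.trans ?_
    rw [mul_assoc]
    gcongr
    cases i
    · simp [hrr, hN]
    · simp only [hrr, cond_true, hN]
      rw [← mul_pow, ← mul_pow]
      gcongr
      push_cast
      have : (1 : ℝ) ≤ p := by exact_mod_cast (by omega : 1 ≤ p)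
      nlinarith
  refine ⟨ψ, fun i => ?_, fun i => (hsum i).trans ?_, fun g hg => ?_⟩
  · refine Submodule.smul_mem _ _ (Sp_mono ?_ (dirichlet_mem (rr i)))
    intro u hu
    simp only [mem_coe, mem_box] at *
    intro j
    exact (hu j).trans (by exact_mod_cast hrp i)
  · cases i <;> simp [hp0]
  · -- the kernel
    have hmem : g * (dirichlet R) ^ (p - 1) ∈ Sp v (box l (p * R) : Set _) := by
      refine mul_mem_Sp (fun ξ hξ η hη => ?_) hg (pow_mem_Sp_box (dirichlet_mem R) (p - 1))
      simp only [mem_coe, mem_box] at *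
      intro i
      refine (abs_add_le _ _).trans ?_
      have e : ((p * R : ℕ) : ℤ) = R + ((p - 1) * R : ℕ) := by
        have : p * R = R + (p - 1) * R := by
          conv_lhs => rw [show p = 1 + (p - 1) by omega]
          ring
        exact_mod_cast this
      rw [e]
      exact add_le_add (hξ i) (hη i)
    have h0 := congrArg norm (reproducing hv hmem)
    have e1 : ‖((2 * v + 1 : ℂ)) ^ l‖ = M := by
      have : ((2 * v + 1 : ℂ)) ^ l = ((M : ℝ) : ℂ) := by simp [hM]
      rw [this, Complex.norm_real, Real.norm_of_nonneg hM0.le]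
    have e2 : ‖(dirichlet R (0 : Gp v l))‖ = N := by
      have : (dirichlet R (0 : Gp v l)) = ((N : ℝ) : ℂ) := by rw [dirichlet_zero]; simp [hN]
      rw [this, Complex.norm_real, Real.norm_of_nonneg hN0.le]
    rw [norm_mul, e1, Pi.mul_apply, norm_mul, Pi.pow_apply, norm_pow, e2] at h0
    set W : Gp v l → ℝ := fun y => ∑ i, ‖ψ i y‖ ^ p with hW
    have hW0 : ∀ y, 0 ≤ W y := fun y => by positivity
    have hWsum : ∑ y, W y ≤ 1 + ((p : ℝ) ^ l) ^ (p - 1) := by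
      simp only [hW]
      rw [sum_comm, Fintype.sum_bool]
      have h1 := hsum true
      have h2 := hsum false
      simp only [cond_true, cond_false] at h1 h2
      linarith
    have hg0 : ‖g 0‖ ≤ ∑ y, W y * ‖g y‖ := by
      have h1 : M * N ^ (p - 1) * ‖g 0‖ ≤
          ∑ y, (‖dirichlet (p * R) y‖ ^ p + ‖dirichlet R y‖ ^ p) * ‖g y‖ := by
        calc M * N ^ (p - 1) * ‖g 0‖ = M * (‖g 0‖ * N ^ (p - 1)) := by ring
          _ = _ := h0
          _ ≤ _ := by
            refine (norm_sum_le _ _).trans (sum_le_sum fun y _ => ?_)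
            rw [Pi.mul_apply, Pi.pow_apply, norm_mul, norm_mul, norm_pow]
            set a := ‖dirichlet R y‖
            set b := ‖dirichlet (p * R) y‖
            have ha : 0 ≤ a := norm_nonneg _
            have hb : 0 ≤ b := norm_nonneg _
            have : a ^ (p - 1) * b ≤ b ^ p + a ^ p := by
              have hpp : p = (p - 1) + 1 := by omega
              rcases le_total a b with hab | hab
              · calc a ^ (p - 1) * b ≤ b ^ (p - 1) * b := by gcongr
                  _ = b ^ p := by rw [← pow_succ, ← hpp]
                  _ ≤ _ := by have : 0 ≤ a ^ p := by positivity
                              linarith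
              · calc a ^ (p - 1) * b ≤ a ^ (p - 1) * a := by gcongr
                  _ = a ^ p := by rw [← pow_succ, ← hpp]
                  _ ≤ _ := by have : 0 ≤ b ^ p := by positivity
                              linarith
            have hgy := norm_nonneg (g y)
            nlinarith
      have h2 : ∑ y, W y * ‖g y‖ = (M * N ^ (p - 1))⁻¹ *
          ∑ y, (‖dirichlet (p * R) y‖ ^ p + ‖dirichlet R y‖ ^ p) * ‖g y‖ := by
        rw [mul_sum]
        refine sum_congr rfl fun y _ => ?_
        simp only [hW, Fintype.sum_bool, hψn, hrr, cond_true, cond_false]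
        ring
      rw [h2, le_inv_mul_iff₀ (by positivity)]
      exact h1
    have hcs : (∑ y, W y * ‖g y‖) ^ 2 ≤ (∑ y, W y) * ∑ y, W y * ‖g y‖ ^ 2 := by
      refine Finset.sum_sq_le_sum_mul_sum_of_sq_le_mul _ (fun y _ => hW0 y)
        (fun y _ => mul_nonneg (hW0 y) (by positivity)) (fun y _ => le_of_eq (by ring))
    have hsw : ∑ i, ∑ y, ‖ψ i y‖ ^ p * ‖g y‖ ^ 2 = ∑ y, W y * ‖g y‖ ^ 2 := by
      rw [sum_comm]
      refine sum_congr rfl fun y _ => ?_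
      simp only [hW, sum_mul]
    rw [hsw]
    have h9 : 0 ≤ ∑ y, W y * ‖g y‖ ^ 2 := sum_nonneg fun y _ => mul_nonneg (hW0 y) (by positivity)
    calc ‖g 0‖ ^ 2 ≤ (∑ y, W y * ‖g y‖) ^ 2 := by gcongr
      _ ≤ _ := hcs
      _ ≤ _ := by gcongr

/-! ### Fibrewise decoupling -/

/-- Decoupling on the fibres `x + θ Y`, with a weight `H` that is essentially constant at the
corresponding scale. -/
lemma fibre_decoupling {X Y ι : Type*} [AddCommGroup X] [AddCommGroup Y] [Fintype X] [Fintype Y]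
    (θ : Y →+ X) {q : ℕ} (hq : 1 ≤ q) (s : Finset ι) (F : ι → X → ℂ) (H : X → ℝ)
    (hH : ∀ x, 0 ≤ H x) (ψ : Bool → Y → ℂ) (S : ι → ℝ) (hS : ∀ J, 0 ≤ S J) {C D B : ℝ}
    (hC : 0 ≤ C) (hD : 0 ≤ D) (hB : 0 ≤ B)
    (h1 : ∀ x, H x ≤ C * ∑ i, ∑ y, ‖ψ i y‖ ^ (2 * q) * H (x - θ y))
    (h2 : ∀ x i, nsq q (∑ J ∈ s, fun y => ψ i y * F J (x + θ y)) ≤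
      D * ∑ J ∈ s, nsq q (fun y => ψ i y * F J (x + θ y)))
    (h3 : ∀ i, ∑ y, ‖ψ i y‖ ^ (2 * q) ≤ C)
    (h4 : ∀ J ∈ s, ∀ y, ∑ x, ‖F J x‖ ^ (2 * q) * H (x - θ y) ≤ B * S J ^ q) :
    ∑ x, ‖∑ J ∈ s, F J x‖ ^ (2 * q) * H x ≤ 2 * C ^ 2 * D ^ q * B * (∑ J ∈ s, S J) ^ q := by
  have hshift : ∀ y (Φ : X → ℝ), ∑ x, Φ x * H (x - θ y) = ∑ x, Φ (x + θ y) * H x := by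
    intro y Φ
    rw [← Equiv.sum_comp (Equiv.addRight (θ y))]
    simp
  -- fibrewise
  have hfib : ∀ i, ∑ y, ∑ x, ‖ψ i y‖ ^ (2 * q) * (‖∑ J ∈ s, F J x‖ ^ (2 * q) * H (x - θ y)) ≤
      D ^ q * (C * B * (∑ J ∈ s, S J) ^ q) := by
    intro i
    set a : ι → X → ℝ := fun J x => nsq q (fun y => ψ i y * F J (x + θ y)) with ha
    have ha0 : ∀ J x, 0 ≤ a J x := fun J x => nsq_nonneg _ _
    have e1 : ∑ y, ∑ x, ‖ψ i y‖ ^ (2 * q) * (‖∑ J ∈ s, F J x‖ ^ (2 * q) * H (x - θ y)) =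
        ∑ x, nsq q (∑ J ∈ s, fun y => ψ i y * F J (x + θ y)) ^ q * H x := by
      simp only [nsq_pow hq, sum_mul]
      rw [sum_comm (s := (univ : Finset X))]
      refine sum_congr rfl fun y _ => ?_
      rw [← mul_sum, hshift y (fun x => ‖∑ J ∈ s, F J x‖ ^ (2 * q)), mul_sum]
      refine sum_congr rfl fun x _ => ?_
      rw [Finset.sum_apply, ← mul_sum, norm_mul, mul_pow]
      ring
    have e2 : ∀ J ∈ s, ∑ x, |H x ^ ((q : ℝ)⁻¹) * a J x| ^ q ≤ (C * B) * S J ^ q := by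
      intro J hJ
      have : ∀ x, |H x ^ ((q : ℝ)⁻¹) * a J x| ^ q =
          ∑ y, ‖ψ i y‖ ^ (2 * q) * (‖F J (x + θ y)‖ ^ (2 * q) * H x) := by
        intro x
        have h0 := hH x
        have h0' := ha0 J x
        rw [abs_of_nonneg (by positivity), mul_pow, Real.rpow_inv_natCast_pow h0 (by omega)]
        simp only [ha]
        rw [nsq_pow hq, mul_sum]
        refine sum_congr rfl fun y _ => ?_
        rw [norm_mul, mul_pow]; ring
      simp only [this]
      rw [sum_comm]
      calc ∑ y, ∑ x, ‖ψ i y‖ ^ (2 * q) * (‖F J (x + θ y)‖ ^ (2 * q) * H x)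
          = ∑ y, ‖ψ i y‖ ^ (2 * q) * ∑ x, ‖F J x‖ ^ (2 * q) * H (x - θ y) := by
            refine sum_congr rfl fun y _ => ?_
            rw [← mul_sum, hshift y (fun x => ‖F J x‖ ^ (2 * q))]
        _ ≤ ∑ y, ‖ψ i y‖ ^ (2 * q) * (B * S J ^ q) := by
            refine sum_le_sum fun y _ => ?_
            have := h4 J hJ y
            gcongr
        _ ≤ C * (B * S J ^ q) := by
            rw [← sum_mul]
            have := hS J
            have := h3 i
            gcongr
        _ = _ := by ring
    have e3 : ∑ x, (∑ J ∈ s, a J x) ^ q * H x ≤ C * B * (∑ J ∈ s, S J) ^ q := by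
      have : ∑ x, (∑ J ∈ s, a J x) ^ q * H x =
          nrm q (fun x => ∑ J ∈ s, H x ^ ((q : ℝ)⁻¹) * a J x) ^ q := by
        rw [nrm_pow hq]
        refine sum_congr rfl fun x _ => ?_
        have h0 := hH x
        have h0' : 0 ≤ ∑ J ∈ s, a J x := sum_nonneg fun J _ => ha0 J x
        rw [← mul_sum, abs_of_nonneg (by positivity), mul_pow,
          Real.rpow_inv_natCast_pow h0 (by omega), mul_comm]
      rw [this]
      have h5 : nrm q (fun x => ∑ J ∈ s, H x ^ ((q : ℝ)⁻¹) * a J x) ≤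
          ∑ J ∈ s, (C * B) ^ ((q : ℝ)⁻¹) * S J := by
        refine (nrm_sum_le hq s _).trans (sum_le_sum fun J hJ => ?_)
        have h0 := hS J
        refine nrm_le_of_pow_le hq (by positivity) ((e2 J hJ).trans (le_of_eq ?_))
        rw [mul_pow, Real.rpow_inv_natCast_pow (by positivity) (by omega)]
      calc _ ≤ (∑ J ∈ s, (C * B) ^ ((q : ℝ)⁻¹) * S J) ^ q :=
            pow_le_pow_left₀ (nrm_nonneg _ _) h5 q
        _ = _ := by
            rw [← mul_sum, mul_pow, Real.rpow_inv_natCast_pow (by positivity) (by omega)]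
    rw [e1]
    calc _ ≤ ∑ x, (D * ∑ J ∈ s, a J x) ^ q * H x := by
          refine sum_le_sum fun x _ => ?_
          have h0 := hH x
          have := nsq_nonneg q (∑ J ∈ s, fun y => ψ i y * F J (x + θ y))
          have := h2 x i
          gcongr
      _ = D ^ q * ∑ x, (∑ J ∈ s, a J x) ^ q * H x := by
          rw [mul_sum]
          refine sum_congr rfl fun x _ => by rw [mul_pow]; ring
      _ ≤ _ := by gcongr
  calc ∑ x, ‖∑ J ∈ s, F J x‖ ^ (2 * q) * H x
      ≤ ∑ x, ‖∑ J ∈ s, F J x‖ ^ (2 * q) *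
          (C * ∑ i, ∑ y, ‖ψ i y‖ ^ (2 * q) * H (x - θ y)) := by
        refine sum_le_sum fun x _ => ?_
        have := h1 x
        gcongr
    _ = C * ∑ i, ∑ y, ∑ x, ‖ψ i y‖ ^ (2 * q) * (‖∑ J ∈ s, F J x‖ ^ (2 * q) * H (x - θ y)) := by
        rw [mul_sum]
        simp only [mul_sum]
        rw [sum_comm]
        refine sum_congr rfl fun i _ => ?_
        rw [sum_comm]
        refine sum_congr rfl fun y _ => sum_congr rfl fun x _ => by ring
    _ ≤ C * ∑ i : Bool, D ^ q * (C * B * (∑ J ∈ s, S J) ^ q) := by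
        gcongr with i
        exact hfib i
    _ = _ := by simp; ring

/-! ### Polynomials vanishing to high order at one point and prescribed at another -/

lemma det_choose_ne_zero (s l : ℕ) :
    (Matrix.of fun r q : Fin l => ((s + 1 + r).choose (q + 1) : ℤ)).det ≠ 0 := by
  classical
  intro h
  obtain ⟨v, hv, hv0⟩ := Matrix.exists_vecMul_eq_zero_iff.2 h
  set P : ℤ[X] := ∑ r : Fin l, C (v r) * X ^ (s + 1 + (r : ℕ)) with hP
  set R : ℤ[X] := ∑ r : Fin l, C (v r * (s + 1 + (r : ℕ))) * X ^ (r : ℕ) with hR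
  have hder : derivative P = X ^ s * R := by
    simp only [hP, hR, derivative_sum, mul_sum]
    refine sum_congr rfl fun r _ => ?_
    rw [derivative_C_mul_X_pow, show s + 1 + (r : ℕ) - 1 = s + r by omega, pow_add]
    push_cast
    ring
  have hdvd : (X - C (1 : ℤ)) ^ l ∣ derivative P := by
    rw [X_sub_C_pow_dvd_iff, X_pow_dvd_iff]
    intro q hq
    have e : (derivative P).comp (X + C 1) = derivative (P.comp (X + C 1)) := by
      rw [derivative_comp]; simp
    rw [e, coeff_derivative]
    have := congrFun hv0 ⟨q, hq⟩
    simp only [Matrix.vecMul, dotProduct, Matrix.of_apply, Pi.zero_apply] at this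
    have e2 : (P.comp (X + C 1)).coeff (q + 1) = 0 := by
      rw [← this, hP]
      rw [← coe_compRingHom_apply, map_sum, finsetSum_coeff]
      refine sum_congr rfl fun r _ => ?_
      rw [coe_compRingHom_apply]
      simp only [mul_comp, C_comp, pow_comp, X_comp, coeff_C_mul]
      rw [C_1, coeff_X_add_one_pow]
    rw [e2]; simp
  have hcop : IsCoprime ((X - C (1 : ℤ)) ^ l) (X ^ s) := by
    refine IsCoprime.pow ⟨-1, 1, ?_⟩
    simp
  rw [hder] at hdvd
  have hdvd2 := hcop.dvd_of_dvd_mul_left hdvd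
  have hR0 : R = 0 := by
    by_contra hne
    have h1 : l ≤ R.natDegree := by
      have := natDegree_le_of_dvd hdvd2 hne
      rwa [natDegree_pow, natDegree_X_sub_C, mul_one] at this
    have hl : 0 < l := by
      rcases Nat.eq_zero_or_pos l with rfl | h
      · exact absurd (by simp [hR]) hne
      · exact h
    have h2 : R.natDegree ≤ l - 1 := by
      rw [hR]
      refine natDegree_sum_le_of_forall_le _ _ fun r _ => ?_
      refine (natDegree_C_mul_X_pow_le _ _).trans ?_
      have := r.2; omega
    omega
  apply hv
  funext r
  have h1 : R.coeff r = v r * (s + 1 + (r : ℕ)) := by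
    rw [hR, finsetSum_coeff, Finset.sum_eq_single r]
    · rw [coeff_C_mul_X_pow, if_pos rfl]
    · intro b _ hb
      rw [coeff_C_mul_X_pow, if_neg]
      intro h; exact hb (Fin.ext h.symm)
    · simp
  rw [hR0, coeff_zero] at h1
  rcases mul_eq_zero.1 h1.symm with h | h
  · exact h
  · have : (0 : ℤ) < s + 1 + (r : ℕ) := by positivity
    omega

lemma exists_prescribed (s l : ℕ) : ∃ d₀ : ℤ, 1 ≤ d₀ ∧ ∃ p : Fin l → ℕ → ℤ, ∀ m q : Fin l,
    ∑ r ∈ Finset.Icc (s + 1) (s + l), p m r * (r.choose (q + 1) : ℤ) =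
      if q = m then d₀ else 0 := by
  classical
  set N : Matrix (Fin l) (Fin l) ℤ := Matrix.of fun r q : Fin l => ((s + 1 + r).choose (q + 1) : ℤ)
    with hN
  have hdet : N.det ≠ 0 := det_choose_ne_zero s l
  refine ⟨N.det ^ 2, by have := sq_pos_of_ne_zero hdet; omega, fun m r =>
    if h : r - (s + 1) < l then N.det * N.adjugate m ⟨r - (s + 1), h⟩ else 0, fun m q => ?_⟩
  have h1 : (N.det • N.adjugate) * N = (N.det ^ 2) • (1 : Matrix _ _ ℤ) := by
    rw [Matrix.smul_mul, Matrix.adjugate_mul, smul_smul, sq]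
  have h2 := congrFun (congrFun h1 m) q
  rw [Matrix.mul_apply] at h2
  simp only [Matrix.smul_apply, smul_eq_mul, Matrix.one_apply, mul_ite, mul_one, mul_zero] at h2
  rw [show (if q = m then N.det ^ 2 else 0) = if m = q then N.det ^ 2 else 0 by
    simp [eq_comm], ← h2]
  refine Finset.sum_nbij' (i := fun r => if h : r - (s + 1) < l then (⟨r - (s + 1), h⟩ : Fin l) else m)
    (j := fun r => s + 1 + (r : ℕ)) ?_ ?_ ?_ ?_ ?_
  · intro r _; simp
  · intro r _; have := r.2; simp; omega
  · intro r hr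
    rw [Finset.mem_Icc] at hr
    have : r - (s + 1) < l := by omega
    simp only [this, dite_true]; omega
  · intro r _
    have : s + 1 + (r : ℕ) - (s + 1) < l := by have := r.2; omega
    simp only [this, dite_true]
    ext; simp
  · intro r hr
    rw [Finset.mem_Icc] at hr
    have h3 : r - (s + 1) < l := by omega
    simp only [h3, dite_true, hN, Matrix.of_apply]
    congr 3; omega

/-! ### Separated intervals -/

/-- The intervals `a` of generation `i` and `a'` of generation `j` lie in separated unit intervals
within distance four of the origin. -/
def Sep (i j : ℕ) (a a' : ℤ) : Prop :=
  0 ≤ a / 2 ^ i ∧ a / 2 ^ i ≤ 3 ∧ 0 ≤ a' / 2 ^ j ∧ a' / 2 ^ j ≤ 3 ∧ 2 ≤ |a / 2 ^ i - a' / 2 ^ j|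

lemma Sep.symm {i j : ℕ} {a a' : ℤ} (h : Sep i j a a') : Sep j i a' a := by
  unfold Sep at *
  rw [abs_sub_comm]
  tauto

lemma Sep.child {i j m : ℕ} {a a' b : ℤ} (h : Sep i j a a') (hb : b ∈ chd m a) :
    Sep (i + m) j b a' := by
  rw [mem_chd] at hb
  have : b / 2 ^ (i + m) = a / 2 ^ i := by
    rw [← hb, Int.ediv_ediv_of_nonneg (by positivity), ← pow_add, add_comm i m]
  unfold Sep at *
  rwa [this]

lemma Sep.bounds {i j : ℕ} {a a' : ℤ} (h : Sep i j a a') :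
    2 ^ (i + j) ≤ |a * 2 ^ j - a' * 2 ^ i| ∧ |a * 2 ^ j - a' * 2 ^ i| ≤ 4 * 2 ^ (i + j) := by
  obtain ⟨h1, h2, h3, h4, h5⟩ := h
  have hi : (0 : ℤ) < 2 ^ i := by positivity
  have hj : (0 : ℤ) < 2 ^ j := by positivity
  set u := a / 2 ^ i
  set u' := a' / 2 ^ j
  have a1 : u * 2 ^ i ≤ a := Int.ediv_mul_le _ hi.ne'
  have a2 : a < (u + 1) * 2 ^ i := Int.lt_ediv_add_one_mul_self _ hi
  have a3 : u' * 2 ^ j ≤ a' := Int.ediv_mul_le _ hj.ne'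
  have a4 : a' < (u' + 1) * 2 ^ j := Int.lt_ediv_add_one_mul_self _ hj
  have b1 : u * 2 ^ i * 2 ^ j ≤ a * 2 ^ j := by gcongr
  have b2 : a * 2 ^ j ≤ (u + 1) * 2 ^ i * 2 ^ j := by gcongr
  have b3 : u' * 2 ^ j * 2 ^ i ≤ a' * 2 ^ i := by gcongr
  have b4 : a' * 2 ^ i ≤ (u' + 1) * 2 ^ j * 2 ^ i := by gcongr
  have hw : (0 : ℤ) < 2 ^ i * 2 ^ j := by positivity
  rw [pow_add]
  constructor
  · rcases le_abs.1 h5 with h | h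
    · refine le_trans ?_ (le_abs_self _)
      nlinarith
    · refine le_trans ?_ (neg_le_abs _)
      nlinarith
  · rw [abs_le]
    constructor <;> nlinarith

lemma finite_Sep (i j : ℕ) : {a : ℤ × ℤ | Sep i j a.1 a.2}.Finite := by
  refine Set.Finite.subset (Set.Finite.prod (Set.finite_Ico (0 : ℤ) (4 * 2 ^ i))
    (Set.finite_Ico (0 : ℤ) (4 * 2 ^ j))) ?_
  rintro ⟨a, a'⟩ ⟨h1, h2, h3, h4, _⟩
  have hi : (0 : ℤ) < 2 ^ i := by positivity
  have hj : (0 : ℤ) < 2 ^ j := by positivity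
  have a1 := Int.ediv_mul_le a hi.ne'
  have a2 := Int.lt_ediv_add_one_mul_self a hi
  have a3 := Int.ediv_mul_le a' hj.ne'
  have a4 := Int.lt_ediv_add_one_mul_self a' hj
  simp only at h1 h2 h3 h4
  refine ⟨⟨?_, ?_⟩, ⟨?_, ?_⟩⟩ <;> simp only <;> nlinarith

/-! ### The projection to a lower dimensional moment curve -/

lemma weight_bound {w D : ℝ} (hw : 1 ≤ w) (hwD : w ≤ D) (hD : D ≤ 4 * w) {k l m r : ℕ}
    (hm : m + 1 ≤ l) (hr : r ≤ 2 * k) :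
    w ^ (l - (m + 1)) * D ^ (2 * k + (m + 1) - r) * w ^ r ≤ 4 ^ l * (w ^ l * D ^ (2 * k)) := by
  have hD1 : 1 ≤ D := hw.trans hwD
  have h4 : (1 : ℝ) ≤ 4 ^ l := one_le_pow₀ (by norm_num)
  rcases le_total (m + 1) r with h | h
  · have e1 : w ^ r = w ^ (m + 1) * w ^ (r - (m + 1)) := by rw [← pow_add]; congr 1; omega
    have e2 : w ^ l = w ^ (l - (m + 1)) * w ^ (m + 1) := by rw [← pow_add]; congr 1; omega
    have e3 : D ^ (2 * k) = D ^ (2 * k + (m + 1) - r) * D ^ (r - (m + 1)) := by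
      rw [← pow_add]; congr 1; omega
    rw [e1, e2, e3]
    have : w ^ (r - (m + 1)) ≤ D ^ (r - (m + 1)) := by gcongr
    calc _ = (w ^ (l - (m + 1)) * w ^ (m + 1) * D ^ (2 * k + (m + 1) - r)) * w ^ (r - (m + 1)) := by
          ring
      _ ≤ (w ^ (l - (m + 1)) * w ^ (m + 1) * D ^ (2 * k + (m + 1) - r)) * D ^ (r - (m + 1)) := by
          gcongr
      _ = 1 * (w ^ (l - (m + 1)) * w ^ (m + 1) * (D ^ (2 * k + (m + 1) - r) * D ^ (r - (m + 1)))) := by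
          ring
      _ ≤ _ := by gcongr
  · have e1 : D ^ (2 * k + (m + 1) - r) = D ^ (2 * k) * D ^ (m + 1 - r) := by
      rw [← pow_add]; congr 1; omega
    have e2 : w ^ l = w ^ (l - (m + 1)) * (w ^ (m + 1 - r) * w ^ r) := by
      rw [← pow_add, ← pow_add]; congr 1; omega
    have h3 : D ^ (m + 1 - r) ≤ 4 ^ l * w ^ (m + 1 - r) := by
      calc D ^ (m + 1 - r) ≤ (4 * w) ^ (m + 1 - r) := by gcongr
        _ = 4 ^ (m + 1 - r) * w ^ (m + 1 - r) := by rw [mul_pow]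
        _ ≤ _ := by
          gcongr
          · norm_num
          · omega
    rw [e1, e2]
    calc _ = (w ^ (l - (m + 1)) * D ^ (2 * k) * w ^ r) * D ^ (m + 1 - r) := by ring
      _ ≤ (w ^ (l - (m + 1)) * D ^ (2 * k) * w ^ r) * (4 ^ l * w ^ (m + 1 - r)) := by gcongr
      _ = _ := by ring

/-- Re-expansion of a homogenised polynomial around another point. -/
lemma reexpand (k N : ℕ) (hN : k ≤ N) (I : Finset ℕ) (hI : ∀ r ∈ I, r ≤ k) (p : ℕ → ℤ) (D : ℤ)
    (Y : ℤ[X]) :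
    ∑ r ∈ I, C (p r * D ^ (N - r)) * (Y + C D) ^ r =
      ∑ q ∈ range (k + 1), C ((∑ r ∈ I, p r * (r.choose q : ℤ)) * D ^ (N - q)) * Y ^ q := by
  simp only [sum_mul, map_sum]
  rw [sum_comm]
  refine sum_congr rfl fun r hr => ?_
  have hrk := hI r hr
  rw [add_pow, mul_sum]
  have : range (r + 1) ⊆ range (k + 1) := by intro x; simp; omega
  rw [← sum_subset this]
  · refine sum_congr rfl fun q hq => ?_
    have hq' : q ≤ r := by simpa [Nat.lt_succ_iff] using hq
    have e : D ^ (N - q) = D ^ (N - r) * D ^ (r - q) := by rw [← pow_add]; congr 1; omega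
    rw [e]
    simp only [map_mul, map_pow]
    have : ((r.choose q : ℕ) : ℤ[X]) = C ((r.choose q : ℕ) : ℤ) := by simp
    rw [this]; ring
  · intro q _ hq
    have : r < q := by simpa [Nat.lt_succ_iff] using hq
    rw [Nat.choose_eq_zero_of_lt this]; simp

lemma abs_coeff_lin_pow_le (i : ℕ) (b : ℤ) (hb0 : 0 ≤ b) (hb : b < 2 ^ i) {l r : ℕ} (hr : r ≤ l)
    (m : ℕ) : |(lin i b ^ r).coeff m| ≤ 2 ^ l * (2 : ℝ) ^ (i * l) := by
  have h := abs_map_affine_pow_le (lcoeff ℝ m) X (m := r) (B := 1)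
    (fun s _ => by simp only [lcoeff_apply, coeff_X_pow]; split_ifs <;> simp) ((2 : ℝ) ^ i) (-(b : ℝ))
  rw [lcoeff_apply, C_neg, ← sub_eq_add_neg] at h
  have hb0' : (0 : ℝ) ≤ b := by exact_mod_cast hb0
  have hb' : (b : ℝ) < 2 ^ i := by exact_mod_cast hb
  refine h.trans ?_
  rw [abs_neg, abs_of_nonneg hb0', abs_of_pos (by positivity), mul_one, pow_mul, ← mul_pow]
  have h1 : (1 : ℝ) ≤ 2 ^ i := one_le_pow₀ (by norm_num)
  calc ((2 : ℝ) ^ i + b) ^ r ≤ (2 * 2 ^ i) ^ r := by gcongr; linarith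
    _ ≤ _ := pow_le_pow_right₀ (by linarith) hr

lemma ev_add_left {l : ℕ} (Λ : ℤ) (ζ u : Fin l → ℤ) (P : ℝ[X]) :
    ev Λ (fun m => ζ m + u m) P = ev Λ ζ P + ∑ m : Fin l, (u m : ℝ) * P.coeff (m + 1) := by
  simp only [ev_apply]
  push_cast
  simp only [add_mul, sum_add_distrib]
  ring

lemma freq_setup (k l q : ℕ) (A : ℝ) (hlk : l < k) (hA : 1 ≤ A) :
    ∃ A' : ℝ, 1 ≤ A' ∧ ∀ (i₀ n j : ℕ) (a₀ a' : ℤ), Sep i₀ j a₀ a' →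
      (i₀ + n) * l ≤ i₀ * (l + 1) → (i₀ + n) * l ≤ j * (k - l + 1) → ∀ Λ : ℤ, 1 ≤ Λ →
      ∃ Λ' : ℤ, 1 ≤ Λ' ∧ ∃ (Q : Fin l → ℤ[X]) (κ : Fin l → ℤ) (R : ℕ),
        (∀ b ∈ chd n a₀, ∀ ξ ∈ U k (2 ^ k * A) Λ (i₀ + n) b, ∀ u ∈ box l (q * R),
          (fun m => ev Λ ξ (Q m) + u m) ∈ U l A' Λ' (i₀ + n) (b - a₀ * 2 ^ n)) ∧
        ∀ η ∈ U k (2 ^ k * A) Λ j a', (fun m => -(ev Λ η (Q m) + Λ * κ m)) ∈ box l R := by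
  obtain ⟨d₀, hd₀, p, hp⟩ := exists_prescribed (k - l) l
  rw [show k - l + l = k by omega] at hp
  set I := Finset.Icc (k - l + 1) k with hI
  have hIk : ∀ r ∈ I, r ≤ k := fun r hr => (Finset.mem_Icc.1 hr).2
  set τ : Fin l → ℕ → ℤ := fun m q => ∑ r ∈ I, p m r * (r.choose q : ℤ) with hτ
  -- a common bound for the coefficients
  obtain ⟨E, hE1, hEp, hEτ⟩ : ∃ E : ℝ, 1 ≤ E ∧ (∀ m, ∀ r ∈ I, |(p m r : ℝ)| ≤ E) ∧
      ∀ m, ∀ r ∈ range (k + 1), |(τ m r : ℝ)| ≤ E := by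
    refine ⟨1 + ∑ m, ∑ r ∈ I, |(p m r : ℝ)| + ∑ m, ∑ r ∈ range (k + 1), |(τ m r : ℝ)|, ?_, ?_, ?_⟩
    · have h1 : 0 ≤ ∑ m, ∑ r ∈ I, |(p m r : ℝ)| := by positivity
      have h2 : 0 ≤ ∑ m, ∑ r ∈ range (k + 1), |(τ m r : ℝ)| := by positivity
      linarith
    · intro m r hr
      have h2 : 0 ≤ ∑ m, ∑ r ∈ range (k + 1), |(τ m r : ℝ)| := by positivity
      have h3 := Finset.single_le_sum (f := fun r => |(p m r : ℝ)|) (fun _ _ => abs_nonneg _) hr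
      have h4 := Finset.single_le_sum (f := fun m => ∑ r ∈ I, |(p m r : ℝ)|)
        (fun _ _ => by positivity) (mem_univ m)
      linarith
    · intro m r hr
      have h2 : 0 ≤ ∑ m, ∑ r ∈ I, |(p m r : ℝ)| := by positivity
      have h3 := Finset.single_le_sum (f := fun r => |(τ m r : ℝ)|) (fun _ _ => abs_nonneg _) hr
      have h4 := Finset.single_le_sum (f := fun m => ∑ r ∈ range (k + 1), |(τ m r : ℝ)|)
        (fun _ _ => by positivity) (mem_univ m)
      linarith
  have hE0 : 0 ≤ E := by linarith
  have hA0 : 0 ≤ A := by linarith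
  set K : ℝ := k * (E * 4 ^ l) * (2 ^ k * A) with hK
  have hK0 : 0 ≤ K := by positivity
  set A' : ℝ := 2 ^ k * A + l * (2 ^ l * (k * (E * 4 ^ l) * (2 ^ k * (2 ^ k * A)))) +
    l * (2 ^ l * (q * K)) with hA'
  refine ⟨A', ?_, ?_⟩
  · have h1 : (1 : ℝ) ≤ 2 ^ k := one_le_pow₀ (by norm_num)
    have h2 : 1 ≤ 2 ^ k * A := by nlinarith
    have h3 : 0 ≤ l * (2 ^ l * (k * (E * 4 ^ l) * (2 ^ k * (2 ^ k * A)))) := by positivity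
    have h4 : 0 ≤ l * (2 ^ l * (q * K)) := by positivity
    linarith
  intro i₀ n j a₀ a' hsep hc1 hc2 Λ hΛ
  have hΛ0 : (0 : ℝ) ≤ Λ := by exact_mod_cast (by omega : (0 : ℤ) ≤ Λ)
  obtain ⟨hD1, hD2⟩ := hsep.bounds
  set w : ℤ := 2 ^ (i₀ + j) with hw
  set D : ℤ := a₀ * 2 ^ j - a' * 2 ^ i₀ with hD
  have hw1 : 1 ≤ w := one_le_pow₀ (by norm_num)
  have hDne : D ≠ 0 := by intro h; rw [h] at hD1; simp at hD1; omega
  set d : ℤ := w ^ l * D ^ (2 * k) with hd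
  have hd1 : 1 ≤ d := by
    have : 0 < D ^ (2 * k) := by rw [pow_mul]; positivity
    have : 0 < d := by positivity
    omega
  have hdR : (0 : ℝ) < d := by exact_mod_cast hd1
  set T : Fin l → ℕ → ℤ := fun m r => w ^ (l - (m + 1)) * D ^ (2 * k + (m + 1) - r) with hT
  have hTb : ∀ (m : Fin l) (r : ℕ), r ≤ k → |(T m r : ℝ)| * w ^ r ≤ 4 ^ l * d := by
    intro m r hr
    have hwR : (1 : ℝ) ≤ w := by exact_mod_cast hw1
    have h := weight_bound (w := w) (D := |(D : ℝ)|) (k := k) (l := l) (m := m) (r := r) hwR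
      (by exact_mod_cast hD1) (by exact_mod_cast hD2) (by have := m.2; omega) (by omega)
    have e1 : |(T m r : ℝ)| = (w : ℝ) ^ (l - ((m : ℕ) + 1)) * |(D : ℝ)| ^ (2 * k + ((m : ℕ) + 1) - r) := by
      simp only [hT]; push_cast
      rw [abs_mul, abs_pow, abs_pow, abs_of_pos (by linarith : (0 : ℝ) < w)]
    have e2 : (d : ℝ) = (w : ℝ) ^ l * |(D : ℝ)| ^ (2 * k) := by
      simp only [hd]; push_cast
      rw [pow_mul (|(D : ℝ)|), sq_abs, ← pow_mul]
    rw [e1, e2]; exact h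
  set L₀ := linZ i₀ a₀ with hL₀
  set L₁ := linZ j a' with hL₁
  set tc : Fin l → ℕ → ℤ := fun m q => τ m q * T m q * (2 ^ j) ^ q with htc
  set tp : Fin l → ℕ → ℤ := fun m r => p m r * T m r * (2 ^ i₀) ^ r with htp
  set Q : Fin l → ℤ[X] := fun m => ∑ q ∈ range k, C (tc m (q + 1)) * L₀ ^ (q + 1) with hQ
  set κ : Fin l → ℤ := fun m => tc m 0 with hκ
  have hid : ∀ m, Q m + C (κ m) = ∑ r ∈ I, C (tp m r) * L₁ ^ r := by
    intro m
    have e1 : C ((2 : ℤ) ^ i₀) * L₁ = C ((2 : ℤ) ^ j) * L₀ + C D := by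
      simp only [hL₀, hL₁, linZ, hD, mul_sub, ← mul_assoc, ← C_mul]
      rw [C_sub]
      ring_nf
    have h := reexpand k (2 * k + (m + 1)) (by omega) I hIk (fun r => w ^ (l - ((m : ℕ) + 1)) * p m r)
      D (C ((2 : ℤ) ^ j) * L₀)
    rw [← e1] at h
    have e2 : ∑ r ∈ I, C (tp m r) * L₁ ^ r =
        ∑ r ∈ I, C (w ^ (l - ((m : ℕ) + 1)) * p m r * D ^ (2 * k + ((m : ℕ) + 1) - r)) *
          (C ((2 : ℤ) ^ i₀) * L₁) ^ r := by
      refine sum_congr rfl fun r _ => ?_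
      simp only [htp, hT, mul_pow, C_mul, C_pow]
      ring
    rw [e2, h, Finset.sum_range_succ']
    simp only [hQ, hκ, pow_zero, mul_one]
    congr 1
    · refine sum_congr rfl fun q _ => ?_
      simp only [htc, hτ, hT, mul_pow, C_mul, C_pow, map_sum, sum_mul]
      refine sum_congr rfl fun r _ => ?_
      ring
    · simp only [htc, hτ, hT, C_mul, map_sum, sum_mul, pow_zero, mul_one]
      refine sum_congr rfl fun r _ => ?_
      simp only [C_pow]
      ring
  -- bounds on coefficients
  have hwpow : ∀ r, (w : ℝ) ^ r = ((2 : ℝ) ^ i₀) ^ r * ((2 : ℝ) ^ j) ^ r := by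
    intro r; rw [← mul_pow, ← pow_add]; simp [hw]
  have htcb : ∀ m, ∀ r ≤ k, |(tc m r : ℝ)| * ((2 : ℝ) ^ i₀) ^ r ≤ E * 4 ^ l * d := by
    intro m r hr
    have e : |(tc m r : ℝ)| * ((2 : ℝ) ^ i₀) ^ r = |(τ m r : ℝ)| * (|(T m r : ℝ)| * w ^ r) := by
      simp only [htc]; push_cast
      rw [abs_mul, abs_mul, abs_of_pos (by positivity : (0 : ℝ) < (2 ^ j) ^ r), hwpow]; ring
    rw [e, mul_assoc]
    have h1 := hEτ m r (by simp; omega)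
    have h2 := hTb m r hr
    gcongr
  have htpb : ∀ m, ∀ r ∈ I, |(tp m r : ℝ)| * ((2 : ℝ) ^ j) ^ r ≤ E * 4 ^ l * d := by
    intro m r hr
    have e : |(tp m r : ℝ)| * ((2 : ℝ) ^ j) ^ r = |(p m r : ℝ)| * (|(T m r : ℝ)| * w ^ r) := by
      simp only [htp]; push_cast
      rw [abs_mul, abs_mul, abs_of_pos (by positivity : (0 : ℝ) < (2 ^ i₀) ^ r), hwpow]; ring
    rw [e, mul_assoc]
    have h1 := hEp m r hr
    have h2 := hTb m r (hIk r hr)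
    gcongr
  set Λ' : ℤ := d * d₀ * Λ with hΛ'
  have hΛ'1 : 1 ≤ Λ' := by
    have : 0 < Λ' := by positivity
    omega
  have hdΛ : (d : ℝ) * Λ ≤ Λ' := by
    have : d * Λ ≤ Λ' := by
      rw [hΛ']
      have : d * 1 * Λ ≤ d * d₀ * Λ := by gcongr
      linarith
    exact_mod_cast this
  have hΛ'0 : (0 : ℝ) ≤ Λ' := by exact_mod_cast (by omega : (0 : ℤ) ≤ Λ')
  set δ : ℝ := (2 ^ ((i₀ + n) * l))⁻¹ with hδ
  have hδ0 : 0 < δ := by positivity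
  have hR0 : 0 ≤ δ * (K * Λ') := by positivity
  set R : ℕ := ⌊δ * (K * Λ')⌋₊ with hR
  refine ⟨Λ', hΛ'1, Q, κ, R, ?_, ?_⟩
  · intro b hb ξ hξ u hu r hr
    have hξ0 := U_subset_parent (by positivity) (by omega : 0 ≤ Λ) hb hξ
    have hb' : 0 ≤ b - a₀ * 2 ^ n ∧ b - a₀ * 2 ^ n < 2 ^ n := by
      unfold chd at hb
      rw [Finset.mem_Ico, add_mul] at hb
      constructor <;> linarith [hb.1, hb.2]
    have hbi : b - a₀ * 2 ^ n < 2 ^ (i₀ + n) := by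
      refine hb'.2.trans_le ?_
      exact pow_le_pow_right₀ (by norm_num) (by omega)
    set P := lin (i₀ + n) (b - a₀ * 2 ^ n) ^ r with hP
    have hPc : ∀ m, |P.coeff m| ≤ 2 ^ l * (2 : ℝ) ^ ((i₀ + n) * l) := fun m =>
      abs_coeff_lin_pow_le _ _ hb'.1 hbi hr m
    rw [ev_add_left, ev_ev]
    have hQR : ∀ m, ev (R := ℝ) Λ ξ ((Q m).map (Int.castRingHom ℝ)) =
        ∑ q ∈ range k, (tc m (q + 1) : ℝ) * ev (R := ℝ) Λ ξ (lin i₀ a₀ ^ (q + 1)) := by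
      intro m
      simp only [hQ, Polynomial.map_sum, Polynomial.map_mul, Polynomial.map_pow, hL₀, map_linZ,
        map_C, map_sum]
      refine sum_congr rfl fun q _ => ?_
      rw [← smul_eq_C_mul, map_smul]; simp
    -- split the diagonal term
    set δ₀ : ℝ := ((2 : ℝ) ^ i₀)⁻¹ with hδ₀
    have hdiag : ∀ m : Fin l, ∃ err : ℝ,
        ev (R := ℝ) Λ ξ ((Q m).map (Int.castRingHom ℝ)) =
          d * d₀ * ev (R := ℝ) Λ ξ ((C δ₀ * lin i₀ a₀) ^ ((m : ℕ) + 1)) + err ∧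
        |err| ≤ δ * (k * (E * 4 ^ l) * (2 ^ k * (2 ^ k * A)) * Λ') := by
      intro m
      refine ⟨∑ q ∈ (range k).filter (fun q => l ≤ q),
        (tc m (q + 1) : ℝ) * ev (R := ℝ) Λ ξ (lin i₀ a₀ ^ (q + 1)), ?_, ?_⟩
      · rw [hQR, ← sum_filter_not_add_sum_filter (range k) (fun q => l ≤ q)]
        congr 1
        rw [Finset.sum_eq_single (m : ℕ)]
        · have e1 : tc m (m + 1) = d₀ * w ^ (l - ((m : ℕ) + 1)) * D ^ (2 * k) * (2 ^ j) ^ ((m : ℕ) + 1) := by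
            have := hp m m
            rw [if_pos rfl] at this
            simp only [htc, hτ, hT, this]
            rw [show 2 * k + ((m : ℕ) + 1) - (m + 1) = 2 * k by omega]; ring
          have e2 : (d : ℝ) = (w : ℝ) ^ (l - ((m : ℕ) + 1)) * (((2 : ℝ) ^ i₀) ^ ((m : ℕ) + 1) * ((2 : ℝ) ^ j) ^ ((m : ℕ) + 1)) * D ^ (2 * k) := by
            rw [← hwpow, ← pow_add]
            simp only [hd]; push_cast
            congr 2
            have := m.2; omega
          rw [mul_pow, ← C_pow, ← smul_eq_C_mul, map_smul, smul_eq_mul, e1, e2, hδ₀, inv_pow]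
          push_cast
          field_simp
        · intro q hq hqm
          simp only [mem_filter, mem_range, not_le] at hq
          have := hp m ⟨q, hq.2⟩
          rw [if_neg (by intro h; exact hqm (congrArg Fin.val h))] at this
          have e : τ m (q + 1) = 0 := this
          simp [htc, e]
        · intro h
          exact absurd (by have := m.2; simp; omega) h
      · have hterm : ∀ q ∈ (range k).filter (fun q => l ≤ q),
            |(tc m (q + 1) : ℝ) * ev (R := ℝ) Λ ξ (lin i₀ a₀ ^ (q + 1))| ≤
              δ * ((E * 4 ^ l) * (2 ^ k * (2 ^ k * A)) * Λ') := by
          intro q hq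
          simp only [mem_filter, mem_range] at hq
          rw [abs_mul]
          have h1 := htcb m (q + 1) (by omega)
          have h2 := hξ0 (q + 1) (by omega)
          have h3 : ((2 : ℝ) ^ i₀) ^ (q + 1) = 2 ^ (i₀ * (q + 1)) := by rw [← pow_mul]
          have h4 : (2 : ℝ) ^ ((i₀ + n) * l) ≤ 2 ^ (i₀ * (q + 1)) :=
            pow_le_pow_right₀ (by norm_num) (hc1.trans (by gcongr; omega))
          have h5 : |(tc m (q + 1) : ℝ)| * 2 ^ ((i₀ + n) * l) ≤ E * 4 ^ l * d := by
            refine le_trans ?_ h1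
            rw [h3]; gcongr
          have h6 : |(tc m (q + 1) : ℝ)| ≤ δ * (E * 4 ^ l * d) := by
            rw [hδ, le_inv_mul_iff₀ (by positivity), mul_comm]; exact h5
          calc _ ≤ (δ * (E * 4 ^ l * d)) * (2 ^ k * (2 ^ k * A) * Λ) := by gcongr
            _ = δ * ((E * 4 ^ l) * (2 ^ k * (2 ^ k * A)) * (d * Λ)) := by ring
            _ ≤ _ := by gcongr
        refine (abs_sum_le_sum_abs _ _).trans ((sum_le_sum hterm).trans ?_)
        rw [sum_const, nsmul_eq_mul]
        have hcard : (((range k).filter (fun q => l ≤ q)).card : ℝ) ≤ k := by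
          have := card_filter_le (range k) (fun q => l ≤ q)
          rw [card_range] at this
          exact_mod_cast this
        calc _ ≤ (k : ℝ) * (δ * ((E * 4 ^ l) * (2 ^ k * (2 ^ k * A)) * Λ')) := by gcongr
          _ = _ := by ring
    choose err herr herrb using hdiag
    simp only [herr]
    have hmain : (Λ' : ℝ) * P.coeff 0 + ∑ m : Fin l, P.coeff (m + 1) *
        (d * d₀ * ev (R := ℝ) Λ ξ ((C δ₀ * lin i₀ a₀) ^ ((m : ℕ) + 1)) + err m) =
        d * d₀ * ev (R := ℝ) Λ ξ (lin (i₀ + n) b ^ r) + ∑ m : Fin l, P.coeff (m + 1) * err m := by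
      have hcomp := comp_eq_sum_fin P (C δ₀ * lin i₀ a₀) ((natDegree_lin_pow_le _ _ r).trans hr)
      have e1 : P.comp (C δ₀ * lin i₀ a₀) = lin (i₀ + n) b ^ r := by
        rw [hP, pow_comp]
        congr 1
        have h2 : (2 : ℝ) ^ i₀ ≠ 0 := by positivity
        have e3 : (2 : ℝ) ^ (i₀ + n) * δ₀ = 2 ^ n := by rw [hδ₀, pow_add]; field_simp
        have e4 : (C ((2 : ℝ) ^ (i₀ + n)) * (C δ₀ * lin i₀ a₀) : ℝ[X]) = C ((2 : ℝ) ^ n) * lin i₀ a₀ := by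
          rw [← mul_assoc, ← C_mul, e3]
        conv_lhs => rw [lin, sub_comp, mul_comp, C_comp, X_comp, C_comp, e4]
        simp only [lin, mul_sub, ← mul_assoc, ← C_mul, sub_sub, ← C_add]
        congr 2
        · rw [← pow_add, add_comm]
        · push_cast; ring
      rw [e1] at hcomp
      rw [hcomp, map_add, map_sum]
      simp only [map_smul, smul_eq_mul, mul_add, sum_add_distrib]
      have e5 : ev (R := ℝ) Λ ξ (C (P.coeff 0)) = Λ * P.coeff 0 := by
        rw [ev_apply]; simp [coeff_C]
      rw [e5, mul_sum]
      simp only [hΛ']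
      push_cast
      rw [add_assoc]
      congr 1
      · ring
      · congr 1
        exact sum_congr rfl fun m _ => by ring
    rw [hmain]
    have h2δ : (2 : ℝ) ^ ((i₀ + n) * l) * δ = 1 := by
      rw [hδ]; field_simp
    have b1 : |(d : ℝ) * d₀ * ev (R := ℝ) Λ ξ (lin (i₀ + n) b ^ r)| ≤ 2 ^ k * A * Λ' := by
      have hd₀' : (0 : ℝ) < d₀ := by exact_mod_cast hd₀
      rw [abs_mul, abs_of_pos (by positivity)]
      have := hξ r (by omega)
      calc _ ≤ (d : ℝ) * d₀ * (2 ^ k * A * Λ) := by gcongr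
        _ = _ := by simp only [hΛ']; push_cast; ring
    have b2 : |∑ m : Fin l, P.coeff (m + 1) * err m| ≤
        l * (2 ^ l * (k * (E * 4 ^ l) * (2 ^ k * (2 ^ k * A)))) * Λ' := by
      have : ∀ m ∈ (univ : Finset (Fin l)), |P.coeff (m + 1) * err m| ≤
          2 ^ l * (k * (E * 4 ^ l) * (2 ^ k * (2 ^ k * A))) * Λ' := by
        intro m _
        rw [abs_mul]
        have h1 := hPc (m + 1)
        have h2 := herrb m
        calc _ ≤ (2 ^ l * (2 : ℝ) ^ ((i₀ + n) * l)) *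
              (δ * (k * (E * 4 ^ l) * (2 ^ k * (2 ^ k * A)) * Λ')) := by gcongr
          _ = (2 ^ ((i₀ + n) * l) * δ) * (2 ^ l * (k * (E * 4 ^ l) * (2 ^ k * (2 ^ k * A))) * Λ') := by
            ring
          _ = _ := by rw [h2δ, one_mul]
      refine (abs_sum_le_sum_abs _ _).trans ((sum_le_sum this).trans (le_of_eq ?_))
      simp; ring
    have b3 : |∑ m : Fin l, (u m : ℝ) * P.coeff (m + 1)| ≤ l * (2 ^ l * (q * K)) * Λ' := by
      have : ∀ m ∈ (univ : Finset (Fin l)), |(u m : ℝ) * P.coeff (m + 1)| ≤ 2 ^ l * (q * K) * Λ' := by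
        intro m _
        rw [abs_mul]
        have h1 := hPc (m + 1)
        have h2 : |(u m : ℝ)| ≤ q * R := by
          have := mem_box.1 hu m
          exact_mod_cast this
        have h3 : (R : ℝ) ≤ δ * (K * Λ') := Nat.floor_le hR0
        calc _ ≤ (q * (δ * (K * Λ'))) * (2 ^ l * (2 : ℝ) ^ ((i₀ + n) * l)) := by
              gcongr
              exact h2.trans (by gcongr)
          _ = (2 ^ ((i₀ + n) * l) * δ) * (2 ^ l * (q * K) * Λ') := by ring
          _ = _ := by rw [h2δ, one_mul]
      refine (abs_sum_le_sum_abs _ _).trans ((sum_le_sum this).trans (le_of_eq ?_))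
      simp; ring
    refine (abs_add_le _ _).trans ((add_le_add (abs_add_le _ _) le_rfl).trans ?_)
    rw [hA']
    linarith
  · intro η hη
    rw [mem_box]
    intro m
    have e1 : ((ev Λ η (Q m) + Λ * κ m : ℤ) : ℝ) = ∑ r ∈ I, (tp m r : ℝ) * ev (R := ℝ) Λ η (lin j a' ^ r) := by
      have h1 : ev Λ η (Q m) + Λ * κ m = ev Λ η (Q m + C (κ m)) := by
        rw [map_add]; congr 1; rw [ev_apply]
        simp only [coeff_C_zero, coeff_C_succ, mul_zero, sum_const_zero, add_zero, Int.cast_id]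
      rw [h1, hid]
      have h2 := ev_map (Int.castRingHom ℝ) Λ η (∑ r ∈ I, C (tp m r) * L₁ ^ r)
      rw [eq_intCast] at h2
      rw [← h2]
      simp only [Polynomial.map_sum, Polynomial.map_mul, Polynomial.map_pow, hL₁, map_linZ,
        map_C, map_sum]
      refine sum_congr rfl fun q _ => ?_
      rw [← smul_eq_C_mul, map_smul]; simp
    have hterm : ∀ r ∈ I, |(tp m r : ℝ) * ev (R := ℝ) Λ η (lin j a' ^ r)| ≤
        δ * ((E * 4 ^ l) * (2 ^ k * A) * Λ') := by
      intro r hr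
      have hr' := Finset.mem_Icc.1 hr
      rw [abs_mul]
      have h1 := htpb m r hr
      have h2 := hη r (hIk r hr)
      have h3 : ((2 : ℝ) ^ j) ^ r = 2 ^ (j * r) := by rw [← pow_mul]
      have h4 : (2 : ℝ) ^ ((i₀ + n) * l) ≤ 2 ^ (j * r) :=
        pow_le_pow_right₀ (by norm_num) (hc2.trans (by gcongr; exact hr'.1))
      have h5 : |(tp m r : ℝ)| * 2 ^ ((i₀ + n) * l) ≤ E * 4 ^ l * d := by
        refine le_trans ?_ h1
        rw [h3]; gcongr
      have h6 : |(tp m r : ℝ)| ≤ δ * (E * 4 ^ l * d) := by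
        rw [hδ, le_inv_mul_iff₀ (by positivity), mul_comm]; exact h5
      calc _ ≤ (δ * (E * 4 ^ l * d)) * (2 ^ k * A * Λ) := by gcongr
        _ = δ * ((E * 4 ^ l) * (2 ^ k * A) * (d * Λ)) := by ring
        _ ≤ _ := by gcongr
    have hfin : |((ev Λ η (Q m) + Λ * κ m : ℤ) : ℝ)| ≤ δ * (K * Λ') := by
      rw [e1]
      refine (abs_sum_le_sum_abs _ _).trans ((sum_le_sum hterm).trans ?_)
      rw [sum_const, nsmul_eq_mul]
      have hcard : (I.card : ℝ) ≤ k := by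
        have : I.card ≤ k := by rw [hI, Nat.card_Icc]; omega
        exact_mod_cast this
      calc _ ≤ (k : ℝ) * (δ * ((E * 4 ^ l) * (2 ^ k * A) * Λ')) := by gcongr
        _ = _ := by rw [hK]; ring
    rw [abs_neg, Int.abs_eq_natAbs]
    have : (ev Λ η (Q m) + Λ * κ m).natAbs ≤ R := by
      rw [hR]
      refine Nat.le_floor ?_
      rw [Nat.cast_natAbs]
      push_cast at hfin ⊢
      exact hfin
    exact_mod_cast this

/-! ### Bilinear estimates and lower dimensional decoupling -/

/-- The bilinear estimate between intervals of generations `i` and `j`. -/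
def BLAt (k : ℕ) (A : ℝ) (Λ : ℤ) (v l n i j : ℕ) (B : ℝ) : Prop :=
  ∀ a a' : ℤ, Sep i j a a' → ∀ f g, Fam k A Λ v n f → Fam k A Λ v n g →
    ∑ x, ‖(∑ b ∈ chd (n - i) a, f b) x‖ ^ (2 * dd l) *
        ‖(∑ b ∈ chd (n - j) a', g b) x‖ ^ (2 * (dd k - dd l)) ≤
      B * (∑ b ∈ chd (n - i) a, nsq (dd k) (f b)) ^ dd l *
        (∑ b ∈ chd (n - j) a', nsq (dd k) (g b)) ^ (dd k - dd l)

/-- The bilinear estimate for all scales and all large moduli. -/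
def BL (k : ℕ) (A : ℝ) (l n i j : ℕ) (B : ℝ) : Prop :=
  ∀ Λ : ℤ, 1 ≤ Λ → ∀ᶠ v in Filter.atTop, BLAt k A Λ v l n i j B

lemma translate_mem_Sp {v l : ℕ} {S : Set (Fin l → ℤ)} {f : Gp v l → ℂ} (hf : f ∈ Sp v S)
    (c : Gp v l) : (fun x => f (x + c)) ∈ Sp v S := by
  let L : (Gp v l → ℂ) →ₗ[ℂ] (Gp v l → ℂ) := LinearMap.funLeft ℂ ℂ (fun x => x + c)
  refine map_mem_of_Sp L (fun ξ hξ => ?_) hf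
  have : L (ex ξ) = (ex ξ c : ℂ) • (ex ξ : Gp v l → ℂ) := by
    funext x
    simp [L, LinearMap.funLeft, ex_add_right, mul_comm]
  rw [this]
  exact Submodule.smul_mem _ _ (ex_mem_Sp hξ)

lemma nsq_translate {α : Type*} [Fintype α] [AddGroup α] (d : ℕ) (f : α → ℂ) (c : α) :
    nsq d (fun x => f (x + c)) = nsq d f :=
  nsq_congr (Equiv.addRight c) fun x => by simp

lemma sum_chd_mem_Sp {k : ℕ} {A : ℝ} (hA : 0 ≤ A) {Λ : ℤ} (hΛ : 0 ≤ Λ) {v n i : ℕ} (hi : i ≤ n)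
    {f : ℤ → Gp v k → ℂ} (hf : Fam k A Λ v n f) (a : ℤ) :
    ∑ b ∈ chd (n - i) a, f b ∈ Sp v (U k (2 ^ k * A) Λ i a) := by
  refine Submodule.sum_mem _ fun b hb => Sp_mono ?_ (hf b)
  have := U_subset_parent (k := k) hA hΛ (n := i) hb
  rwa [Nat.add_sub_cancel' hi] at this

lemma fibre_mem_Sp {l k v : ℕ} (Λ : ℤ) (Q : Fin l → ℤ[X]) {S : Set (Fin k → ℤ)}
    {T : Set (Fin l → ℤ)} (h : ∀ ξ ∈ S, (fun m => ev Λ ξ (Q m)) ∈ T) {f : Gp v k → ℂ}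
    (hf : f ∈ Sp v S) (x : Gp v k) :
    (fun y => ex (fun m => Λ * (Q m).coeff 0) y * f (x + th v Q y)) ∈ Sp v T := by
  let L : (Gp v k → ℂ) →ₗ[ℂ] (Gp v l → ℂ) :=
    { toFun := fun g y => ex (fun m => Λ * (Q m).coeff 0) y * g (x + th v Q y)
      map_add' := fun g h => by funext y; simp [mul_add]
      map_smul' := fun c g => by funext y; simp; ring }
  refine map_mem_of_Sp L (fun ξ hξ => ?_) hf
  have : L (ex ξ) = (ex ξ x : ℂ) • (ex (fun m => ev Λ ξ (Q m)) : Gp v l → ℂ) := by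
    funext y
    simp only [L, LinearMap.coe_mk, AddHom.coe_mk, ex_add_right, ex_ev, Pi.smul_apply, smul_eq_mul]
    ring
  rw [this]
  exact Submodule.smul_mem _ _ (ex_mem_Sp (h ξ hξ))

lemma fibre_mem_Sp_neg {l k v : ℕ} (Λ : ℤ) (Q : Fin l → ℤ[X]) (κ : Fin l → ℤ) {S : Set (Fin k → ℤ)}
    {T : Set (Fin l → ℤ)} (h : ∀ ξ ∈ S, (fun m => -(ev Λ ξ (Q m) + Λ * κ m)) ∈ T)
    {f : Gp v k → ℂ} (hf : f ∈ Sp v S) (x : Gp v k) :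
    (fun y => ex (-(fun m => Λ * (Q m).coeff 0 + Λ * κ m)) y * f (x - th v Q y)) ∈ Sp v T := by
  let L : (Gp v k → ℂ) →ₗ[ℂ] (Gp v l → ℂ) :=
    { toFun := fun g y => ex (-(fun m => Λ * (Q m).coeff 0 + Λ * κ m)) y * g (x - th v Q y)
      map_add' := fun g h => by funext y; simp [mul_add]
      map_smul' := fun c g => by funext y; simp; ring }
  refine map_mem_of_Sp L (fun ξ hξ => ?_) hf
  have : L (ex ξ) = (ex ξ x : ℂ) • (ex (fun m => -(ev Λ ξ (Q m) + Λ * κ m)) : Gp v l → ℂ) := by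
    funext y
    have e1 : (fun m => -(ev Λ ξ (Q m) + Λ * κ m)) =
        -((fun m => ev Λ ξ (Q m)) + fun m => Λ * κ m) := rfl
    have e2 : (-(fun m => Λ * (Q m).coeff 0 + Λ * κ m) : Fin l → ℤ) =
        -((fun m => Λ * (Q m).coeff 0) + fun m => Λ * κ m) := rfl
    simp only [L, LinearMap.coe_mk, AddHom.coe_mk, Pi.smul_apply, smul_eq_mul]
    rw [e1, e2, sub_eq_add_neg, ex_add_right, ex_neg_right, ex_neg, ex_neg, ex_neg, ex_add, ex_add,
      ex_ev]
    simp only [map_mul]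
    ring
  rw [this]
  exact Submodule.smul_mem _ _ (ex_mem_Sp (h ξ hξ))

/-- Decoupling in lower dimension refines the first factor of a bilinear estimate. -/
theorem BL_of_refine (k l : ℕ) (A : ℝ) (hl : 1 ≤ l) (hlk : l < k) (hA : 1 ≤ A) :
    ∃ A' : ℝ, 1 ≤ A' ∧ ∃ C : ℝ, 1 ≤ C ∧ ∀ (i₀ n' n j : ℕ) (B D : ℝ), i₀ + n' ≤ n → j ≤ n →
      (i₀ + n') * l ≤ i₀ * (l + 1) → (i₀ + n') * l ≤ j * (k - l + 1) → 0 ≤ B → 0 ≤ D →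
      Dec l A' n' D → BL k A l n (i₀ + n') j B → BL k A l n i₀ j (C * D ^ dd l * B) := by
  set e := dd k - dd l with he
  have hl1 := one_le_dd hl
  obtain ⟨A', hA', hset⟩ := freq_setup k l (2 * dd l * e) A hlk hA
  obtain ⟨C, hC, hker⟩ := exists_kernel l (2 * dd l) (by omega)
  refine ⟨A', hA', 2 * C ^ 2, by nlinarith, ?_⟩
  intro i₀ n' n j B D hin hjn hc1 hc2 hB hD hdec hBL Λ hΛ
  have hA0 : 0 ≤ A := by linarith
  have hΛ0 : 0 ≤ Λ := by omega
  have key : ∀ᶠ v in Filter.atTop, ∀ p ∈ {a : ℤ × ℤ | Sep i₀ j a.1 a.2},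
      ∃ (Λ' : ℤ) (Q : Fin l → ℤ[X]) (κ : Fin l → ℤ) (R : ℕ), DecAt l A' Λ' v n' D ∧
        2 * (2 * dd l * (e * R)) < 2 * v + 1 ∧
        (∀ b ∈ chd n' p.1, ∀ ξ ∈ U k (2 ^ k * A) Λ (i₀ + n') b, ∀ u ∈ box l (2 * dd l * e * R),
          (fun m => ev Λ ξ (Q m) + u m) ∈ U l A' Λ' (i₀ + n') (b - p.1 * 2 ^ n')) ∧
        ∀ η ∈ U k (2 ^ k * A) Λ j p.2, (fun m => -(ev Λ η (Q m) + Λ * κ m)) ∈ box l R := by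
    rw [Filter.eventually_all_finite (finite_Sep i₀ j)]
    rintro ⟨a, a'⟩ hs
    obtain ⟨Λ', hΛ', Q, κ, R, h1, h2⟩ := hset i₀ n' j a a' hs hc1 hc2 Λ hΛ
    filter_upwards [hdec Λ' hΛ', Filter.eventually_gt_atTop (2 * dd l * (e * R))] with v hv hv'
    exact ⟨Λ', Q, κ, R, hv, by omega, h1, h2⟩
  filter_upwards [key, hBL Λ hΛ] with v hv hbl a a' hs f g hf hg
  obtain ⟨Λ', Q, κ, R, hdecv, hvR, hU, hbox⟩ := hv (a, a') hs
  simp only at hU hbox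
  obtain ⟨ψ, hψ, hψC, hψk⟩ := hker (e * R) v hvR
  set θ := th v Q
  set G : Gp v k → ℂ := ∑ b ∈ chd (n - j) a', g b with hG
  set F : ℤ → Gp v k → ℂ := fun J => ∑ b ∈ chd (n - (i₀ + n')) J, f b with hF
  have hGm : G ∈ Sp v (U k (2 ^ k * A) Λ j a') := sum_chd_mem_Sp hA0 hΛ0 hjn hg a'
  have hFm : ∀ J, F J ∈ Sp v (U k (2 ^ k * A) Λ (i₀ + n') J) :=
    fun J => sum_chd_mem_Sp hA0 hΛ0 hin hf J
  have hnn : n - i₀ = n' + (n - (i₀ + n')) := by omega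
  have main := fibre_decoupling θ hl1 (chd n' a) F (fun x => ‖G x‖ ^ (2 * e))
    (fun x => by positivity) ψ (fun J => ∑ b ∈ chd (n - (i₀ + n')) J, nsq (dd k) (f b))
    (fun J => sum_nonneg fun b _ => nsq_nonneg _ _) (C := C) (D := D)
    (B := B * (∑ b ∈ chd (n - j) a', nsq (dd k) (g b)) ^ e) (by linarith) hD
    (mul_nonneg hB (pow_nonneg (sum_nonneg fun b _ => nsq_nonneg _ _) _)) ?_ ?_ hψC ?_
  · rw [hnn, sum_chd_add, sum_chd_add]
    refine le_trans (le_of_eq ?_) (main.trans (le_of_eq ?_))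
    · refine sum_congr rfl fun x _ => ?_
      rw [Finset.sum_apply]
    · ring
  · intro x
    have hφ := fibre_mem_Sp_neg Λ Q κ hbox hGm x
    have h := hψk _ (pow_mem_Sp_box hφ e)
    simp only [Pi.pow_apply, ex_zero_right, norm_pow, norm_mul, norm_ex, one_mul, map_zero,
      sub_zero, ← pow_mul, mul_comm e 2] at h
    exact h
  · intro x i
    have hfam : Fam l A' Λ' v (i₀ + n') (fun b => if b ∈ chd n' 0 then
        (fun y => ex (fun m => Λ * (Q m).coeff 0) y * (ψ i y * F (b + a * 2 ^ n') (x + θ y)))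
        else 0) := by
      intro b
      dsimp only
      split_ifs with hb
      · have hb' : b + a * 2 ^ n' ∈ chd n' a := by
          rw [mem_chd] at hb ⊢
          rw [Int.add_mul_ediv_right _ _ (by positivity), hb, zero_add]
        have h1 := fibre_mem_Sp (v := v) Λ Q (S := U k (2 ^ k * A) Λ (i₀ + n') (b + a * 2 ^ n'))
          (T := (fun ξ m => ev Λ ξ (Q m)) '' U k (2 ^ k * A) Λ (i₀ + n') (b + a * 2 ^ n'))
          (fun ξ hξ => ⟨ξ, hξ, rfl⟩) (hFm _) x
        have h2 := mul_mem_Sp (R := U l A' Λ' (i₀ + n') b) ?_ h1 (hψ i)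
        · convert h2 using 1
          funext y
          simp only [Pi.mul_apply]
          ring
        · rintro _ ⟨ξ, hξ, rfl⟩ u hu
          have := hU _ hb' ξ hξ u (by rw [mul_assoc]; exact_mod_cast hu)
          rw [add_sub_cancel_right] at this
          exact this
      · exact Submodule.zero_mem _
    have h := hdecv.block i₀ 0 hfam
    have e0 := fun (g : ℤ → Gp v l → ℂ) => sum_chd_shift n' 0 a g
    have e0' := fun (g : ℤ → ℝ) => sum_chd_shift n' 0 a g
    rw [zero_add] at e0 e0'
    rw [e0, e0']
    have hn : ∀ φ : Gp v l → ℂ, nsq (dd l) (fun y => ex (fun m => Λ * (Q m).coeff 0) y * φ y) =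
        nsq (dd l) φ := fun φ => nsq_congr (Equiv.refl _) fun y => by simp [norm_ex]
    have hs1 : (∑ b ∈ chd n' 0, if b ∈ chd n' 0 then
        (fun y => ex (fun m => Λ * (Q m).coeff 0) y * (ψ i y * F (b + a * 2 ^ n') (x + θ y)))
        else 0) = fun y => ex (fun m => Λ * (Q m).coeff 0) y *
          (∑ b ∈ chd n' 0, fun y => ψ i y * F (b + a * 2 ^ n') (x + θ y)) y := by
      rw [sum_congr rfl fun b hb => if_pos hb]
      funext y
      simp only [Finset.sum_apply, mul_sum]
    rw [hs1, hn] at h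
    refine h.trans (le_of_eq ?_)
    congr 1
    refine sum_congr rfl fun b hb => ?_
    rw [if_pos hb, hn]
  · intro J hJ y
    have h := hbl J a' (hs.child hJ) f (fun b x => g b (x - θ y)) hf (fun b => by
      simpa only [sub_eq_add_neg] using translate_mem_Sp (hg b) (-θ y))
    have e1 : ∀ b, nsq (dd k) (fun x => g b (x - θ y)) = nsq (dd k) (g b) := fun b => by
      simpa only [sub_eq_add_neg] using nsq_translate (dd k) (g b) (-θ y)
    simp only [e1] at h
    refine le_trans (le_of_eq ?_) (h.trans (le_of_eq ?_))
    · refine sum_congr rfl fun x _ => ?_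
      simp only [hF, hG, he, Finset.sum_apply]
    · ring

lemma sum_nsq_nonneg {ι α : Type*} [Fintype α] (d : ℕ) (s : Finset ι) (f : ι → α → ℂ) :
    0 ≤ ∑ b ∈ s, nsq d (f b) :=
  sum_nonneg fun _ _ => nsq_nonneg _ _

lemma BL.mono {k : ℕ} {A : ℝ} {l n i j : ℕ} {B B' : ℝ} (h : BL k A l n i j B) (hB : B ≤ B') :
    BL k A l n i j B' := by
  intro Λ hΛ
  filter_upwards [h Λ hΛ] with v hv a a' hs f g hf hg
  refine (hv a a' hs f g hf hg).trans ?_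
  have h1 := sum_nsq_nonneg (dd k) (chd (n - i) a) f
  have h2 := sum_nsq_nonneg (dd k) (chd (n - j) a') g
  gcongr

/-- Iterating `BL_of_refine`. -/
theorem BL_of_refine_iterate (k l : ℕ) (A : ℝ) (hl : 1 ≤ l) (hlk : l < k) (hA : 1 ≤ A)
    (hdec : ∀ A, 1 ≤ A → ExpDec l A 0) (t : ℕ) : ∀ ε : ℝ, 0 < ε → ∃ C : ℝ, 1 ≤ C ∧
    ∀ (i₀ i n j : ℕ) (B : ℝ), l ∣ i₀ → i₀ ≤ i → l * i ≤ i₀ * (l + t) → i * l ≤ j * (k - l + 1) →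
      i ≤ n → j ≤ n → 0 ≤ B → BL k A l n i j B → BL k A l n i₀ j (C * 2 ^ (ε * n) * B) := by
  have hl0 := one_le_dd hl
  induction t with
  | zero =>
    intro ε hε
    refine ⟨1, le_rfl, fun i₀ i n j B hd h0 h1 _ _ _ hB h => ?_⟩
    have : i = i₀ := by
      have : i ≤ i₀ := Nat.le_of_mul_le_mul_left (by linarith) hl
      omega
    subst this
    refine h.mono ?_
    have : (1 : ℝ) ≤ 2 ^ (ε * n) := Real.one_le_rpow (by norm_num) (by positivity)
    nlinarith
  | succ t ih =>
    intro ε hε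
    obtain ⟨C₁, hC₁, h₁⟩ := ih (ε / 2) (by positivity)
    obtain ⟨A', hA', C₀, hC₀, h₀⟩ := BL_of_refine k l A hl hlk hA
    obtain ⟨C₂, hC₂, h₂⟩ := hdec A' hA' (ε / 2 / dd l) (by positivity)
    refine ⟨C₁ * (C₀ * C₂ ^ dd l), one_le_mul_of_one_le_of_one_le hC₁
      (one_le_mul_of_one_le_of_one_le hC₀ (one_le_pow₀ hC₂)), ?_⟩
    intro i₀ i n j B hd h0 h1 h2 hin hjn hB h
    have hpos : (0 : ℝ) ≤ C₁ * 2 ^ (ε / 2 * n) := by positivity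
    have hsplit : (2 : ℝ) ^ (ε * n) = 2 ^ (ε / 2 * n) * 2 ^ (ε / 2 * n) := by
      rw [← Real.rpow_add (by norm_num)]; congr 1; ring
    have hge : (1 : ℝ) ≤ 2 ^ (ε / 2 * n) := Real.one_le_rpow (by norm_num) (by positivity)
    have hCge : (1 : ℝ) ≤ C₀ * C₂ ^ dd l := one_le_mul_of_one_le_of_one_le hC₀ (one_le_pow₀ hC₂)
    by_cases hc : l * i ≤ i₀ * (l + t)
    · refine (h₁ i₀ i n j B hd h0 hc h2 hin hjn hB h).mono ?_
      rw [hsplit]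
      calc C₁ * 2 ^ (ε / 2 * n) * B = (C₁ * 2 ^ (ε / 2 * n) * B) * (1 * 1) := by ring
        _ ≤ (C₁ * 2 ^ (ε / 2 * n) * B) * ((C₀ * C₂ ^ dd l) * 2 ^ (ε / 2 * n)) := by gcongr
        _ = _ := by ring
    · push Not at hc
      obtain ⟨w, rfl⟩ := hd
      set m := w * (l + t) with hm
      have hmi : m ≤ i := by
        have : l * m < l * i := by rw [hm, ← mul_assoc]; exact hc
        exact (Nat.lt_of_mul_lt_mul_left this).le
      have h0m : l * w ≤ m := by rw [hm]; nlinarith [Nat.zero_le (w * t)]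
      obtain ⟨n', rfl⟩ := Nat.exists_eq_add_of_le hmi
      have hD0 : (0 : ℝ) ≤ C₂ * 2 ^ ((0 + ε / 2 / dd l) * n') := by positivity
      have hstep := h₀ m n' n j B _ hin hjn (by nlinarith) h2 hB hD0 (h₂ n') h
      have hml : m * l ≤ j * (k - l + 1) := by nlinarith
      have := h₁ (l * w) m n j _ ⟨w, rfl⟩ h0m (by rw [hm]; nlinarith) hml (by omega) hjn
        (by positivity) hstep
      refine this.mono ?_
      have hb : (C₂ * 2 ^ ((0 + ε / 2 / dd l) * n')) ^ dd l ≤ C₂ ^ dd l * 2 ^ (ε / 2 * n) := by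
        rw [mul_pow, ← Real.rpow_natCast (2 ^ _), ← Real.rpow_mul (by norm_num)]
        have h3 : (n' : ℝ) ≤ n := by exact_mod_cast (by omega : n' ≤ n)
        have h4 : (0 + ε / 2 / dd l) * n' * (dd l : ℕ) = ε / 2 * n' := by
          field_simp; ring
        rw [h4]
        gcongr
        norm_num
      rw [hsplit]
      calc _ ≤ C₁ * 2 ^ (ε / 2 * n) * (C₀ * (C₂ ^ dd l * 2 ^ (ε / 2 * n)) * B) := by gcongr
        _ = _ := by ring

lemma interp_exponents {k l : ℕ} (hl : 1 ≤ l) (hlk : l ≤ k) :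
    (dd k - dd (k - l)) + (k - l) * dd (l - 1) = (k - l + 1) * dd l ∧
      dd (k - l) + (k - l) * (dd k - dd (l - 1)) = (k - l + 1) * (dd k - dd l) := by
  obtain ⟨c, rfl⟩ := Nat.exists_eq_add_of_le hlk
  obtain ⟨l, rfl⟩ := Nat.exists_eq_add_of_le' hl
  have h1 := two_mul_dd (l + 1 + c)
  have h2 := two_mul_dd (l + 1)
  have h3 := two_mul_dd l
  have h4 := two_mul_dd c
  have m1 : dd (l + 1) ≤ dd (l + 1 + c) := dd_mono (by omega)
  have m2 : dd l ≤ dd (l + 1 + c) := dd_mono (by omega)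
  have m3 : dd c ≤ dd (l + 1 + c) := dd_mono (by omega)
  rw [show l + 1 + c - (l + 1) = c by omega, show l + 1 - 1 = l by omega]
  zify [m1, m2, m3] at *
  constructor <;> nlinarith

lemma sum_holder_pow {α : Type*} [Fintype α] (c : ℕ) (W P Q : α → ℝ) (hW : ∀ x, 0 ≤ W x)
    (hP : ∀ x, 0 ≤ P x) (hQ : ∀ x, 0 ≤ Q x) (h : ∀ x, W x ^ (c + 1) = P x * Q x ^ c) :
    (∑ x, W x) ^ (c + 1) ≤ (∑ x, P x) * (∑ x, Q x) ^ c := by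
  have hc : 1 ≤ c + 1 := by omega
  set F : α → ℝ := fun x => P x ^ (((c + 1 : ℕ) : ℝ)⁻¹)
  set G : α → ℝ := fun x => Q x ^ (((c + 1 : ℕ) : ℝ)⁻¹)
  have hF : ∀ x, F x ^ (c + 1) = P x := fun x => Real.rpow_inv_natCast_pow (hP x) (by omega)
  have hG : ∀ x, G x ^ (c + 1) = Q x := fun x => Real.rpow_inv_natCast_pow (hQ x) (by omega)
  have hF0 : ∀ x, 0 ≤ F x := fun x => Real.rpow_nonneg (hP x) _
  have hG0 : ∀ x, 0 ≤ G x := fun x => Real.rpow_nonneg (hQ x) _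
  have hWx : ∀ x, W x = F x ^ 1 * G x ^ c := by
    intro x
    refine (pow_left_inj₀ (hW x) (mul_nonneg (pow_nonneg (hF0 x) _) (pow_nonneg (hG0 x) _))
      (Nat.succ_ne_zero c)).1 ?_
    rw [h, mul_pow, ← pow_mul, ← pow_mul, one_mul, mul_comm c, pow_mul, hF, hG]
  have := sum_mul_pow_le hc (by ring : 1 + c = c + 1) F G hF0 hG0
  simp only [← hWx] at this
  calc _ ≤ (nrm (c + 1) F ^ 1 * nrm (c + 1) G ^ c) ^ (c + 1) :=
        pow_le_pow_left₀ (sum_nonneg fun x _ => hW x) this _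
    _ = nrm (c + 1) F ^ (c + 1) * (nrm (c + 1) G ^ (c + 1)) ^ c := by ring
    _ = _ := by
      rw [nrm_pow hc, nrm_pow hc]
      simp only [abs_of_nonneg (hF0 _), abs_of_nonneg (hG0 _), hF, hG]

/-- Interpolation between bilinear estimates. -/
theorem BL.interp {k : ℕ} {A : ℝ} {l n i j : ℕ} {B₁ B₂ B : ℝ} (hl : 1 ≤ l) (hlk : l ≤ k)
    (h₁ : BL k A (k - l) n j i B₁) (h₂ : BL k A (l - 1) n i j B₂) (hB₁ : 0 ≤ B₁) (hB : 0 ≤ B) (h : B₁ * B₂ ^ (k - l) ≤ B ^ (k - l + 1)) : BL k A l n i j B := by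
  intro Λ hΛ
  filter_upwards [h₁ Λ hΛ, h₂ Λ hΛ] with v hv₁ hv₂ a a' hs f g hf hg
  obtain ⟨e1, e2⟩ := interp_exponents hl hlk
  have H₁ := hv₁ a' a hs.symm g f hg hf
  have H₂ := hv₂ a a' hs f g hf hg
  set F := ∑ b ∈ chd (n - i) a, f b
  set G := ∑ b ∈ chd (n - j) a', g b
  set S := ∑ b ∈ chd (n - i) a, nsq (dd k) (f b)
  set S' := ∑ b ∈ chd (n - j) a', nsq (dd k) (g b)
  have hS : 0 ≤ S := sum_nsq_nonneg _ _ _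
  have hS' : 0 ≤ S' := sum_nsq_nonneg _ _ _
  set c := k - l with hc
  have key := sum_holder_pow c
    (fun x => ‖F x‖ ^ (2 * dd l) * ‖G x‖ ^ (2 * (dd k - dd l)))
    (fun x => ‖G x‖ ^ (2 * dd c) * ‖F x‖ ^ (2 * (dd k - dd c)))
    (fun x => ‖F x‖ ^ (2 * dd (l - 1)) * ‖G x‖ ^ (2 * (dd k - dd (l - 1))))
    (fun x => by positivity) (fun x => by positivity) (fun x => by positivity) ?_
  · refine le_of_pow_le_pow_left₀ (n := c + 1) (by omega) (by positivity) (key.trans ?_)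
    have hQ0 : 0 ≤ ∑ x, ‖F x‖ ^ (2 * dd (l - 1)) * ‖G x‖ ^ (2 * (dd k - dd (l - 1))) :=
      sum_nonneg fun x _ => by positivity
    calc _ ≤ (B₁ * S' ^ dd c * S ^ (dd k - dd c)) *
          (B₂ * S ^ dd (l - 1) * S' ^ (dd k - dd (l - 1))) ^ c := by gcongr
      _ = (B₁ * B₂ ^ c) * S ^ ((dd k - dd c) + c * dd (l - 1)) *
          S' ^ (dd c + c * (dd k - dd (l - 1))) := by ring
      _ ≤ B ^ (c + 1) * S ^ ((dd k - dd c) + c * dd (l - 1)) *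
          S' ^ (dd c + c * (dd k - dd (l - 1))) := by gcongr
      _ = _ := by rw [e1, e2]; ring
  · intro x
    have r1 : (‖F x‖ ^ (2 * dd l) * ‖G x‖ ^ (2 * (dd k - dd l))) ^ (c + 1) =
        ‖F x‖ ^ (2 * ((c + 1) * dd l)) * ‖G x‖ ^ (2 * ((c + 1) * (dd k - dd l))) := by ring
    rw [r1, ← e1, ← e2]
    ring

/-- The estimate for the trivial index, which has no first factor. -/
lemma BL_zero {k : ℕ} (hk : 1 ≤ k) {A : ℝ} {n i j : ℕ} {D : ℝ} (hj : j ≤ n)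
    (h : Dec k A (n - j) D) : BL k A 0 n i j (D ^ dd k) := by
  intro Λ hΛ
  filter_upwards [h Λ hΛ] with v hv a a' hs f g hf hg
  have h0 : dd 0 = 0 := by decide
  have hb := hv.block j a' (f := g) (by rwa [Nat.add_sub_cancel' hj])
  simp only [h0, mul_zero, pow_zero, one_mul, mul_one, Nat.sub_zero]
  rw [← nsq_pow (one_le_dd hk), ← mul_pow]
  exact pow_le_pow_left₀ (nsq_nonneg _ _) hb _

lemma BL_trivial {k : ℕ} (hk : 1 ≤ k) {A : ℝ} {l n i j : ℕ} (hlk : l ≤ k) {D : ℝ}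
    (hi : i ≤ n) (hj : j ≤ n) (h₁ : Dec k A (n - i) D) (h₂ : Dec k A (n - j) D) :
    BL k A l n i j (D ^ dd k) := by
  intro Λ hΛ
  filter_upwards [h₁ Λ hΛ, h₂ Λ hΛ] with v hv₁ hv₂ a a' hs f g hf hg
  have hm := dd_mono hlk
  have hb₁ := hv₁.block i a (f := f) (by rwa [Nat.add_sub_cancel' hi])
  have hb₂ := hv₂.block j a' (f := g) (by rwa [Nat.add_sub_cancel' hj])
  have := sum_mul_pow_le (one_le_dd hk) (Nat.add_sub_cancel' hm)
    (fun x => ‖(∑ b ∈ chd (n - i) a, f b) x‖ ^ 2) (fun x => ‖(∑ b ∈ chd (n - j) a', g b) x‖ ^ 2)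
    (fun x => by positivity) (fun x => by positivity)
  simp only [← pow_mul] at this
  refine this.trans ?_
  calc _ ≤ (D * ∑ b ∈ chd (n - i) a, nsq (dd k) (f b)) ^ dd l *
        (D * ∑ b ∈ chd (n - j) a', nsq (dd k) (g b)) ^ (dd k - dd l) := by
        have h1 := nsq_nonneg (dd k) (∑ b ∈ chd (n - i) a, f b)
        have h2 := nsq_nonneg (dd k) (∑ b ∈ chd (n - j) a', g b)
        exact mul_le_mul (pow_le_pow_left₀ h1 hb₁ _) (pow_le_pow_left₀ h2 hb₂ _)
          (pow_nonneg h2 _) (pow_nonneg (h1.trans hb₁) _)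
    _ = D ^ (dd l + (dd k - dd l)) * (∑ b ∈ chd (n - i) a, nsq (dd k) (f b)) ^ dd l *
        (∑ b ∈ chd (n - j) a', nsq (dd k) (g b)) ^ (dd k - dd l) := by ring
    _ = _ := by rw [Nat.add_sub_cancel' hm]

lemma Dec.mono {k : ℕ} {A : ℝ} {n : ℕ} {D D' : ℝ} (h : Dec k A n D) (hD : D ≤ D') :
    Dec k A n D' := by
  intro Λ hΛ
  filter_upwards [h Λ hΛ] with v hv f hf
  refine (hv f hf).trans ?_
  have := sum_nsq_nonneg (dd k) (chd n 0) f
  gcongr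

/-- The gains obtained by iterating the interpolation step. -/
noncomputable def gain (k : ℕ) : ℕ → ℕ → ℝ
  | 0, l => if l = 0 then 1 else 0
  | T + 1, l => if l = 0 then 1 else
      gain k T (k - l) / l + ((k - l : ℕ) : ℝ) / ((k - l : ℕ) + 1) * gain k T (l - 1)

lemma gain_zero (k T : ℕ) : gain k T 0 = 1 := by cases T <;> simp [gain]

lemma refined_bound {C C₁ x y : ℝ} {d : ℕ} (hd : 1 ≤ d) (hC : 1 ≤ C) (hC₁ : 1 ≤ C₁) (hx : 0 ≤ x) :
    C * 2 ^ x * (C₁ * 2 ^ y) ^ d ≤ (C * C₁ * 2 ^ (x + y)) ^ d := by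
  have h1 : (1 : ℝ) ≤ C * 2 ^ x :=
    one_le_mul_of_one_le_of_one_le hC (Real.one_le_rpow (by norm_num) hx)
  have h2 : C * C₁ * 2 ^ (x + y) = (C * 2 ^ x) * (C₁ * 2 ^ y) := by
    rw [Real.rpow_add (by norm_num)]; ring
  rw [h2, mul_pow (C * 2 ^ x)]
  gcongr
  exact le_self_pow₀ h1 (by omega)

lemma interp_bound {C₁ C₂ x y z : ℝ} {d c : ℕ} (hC₁ : 1 ≤ C₁) (hC₂ : 1 ≤ C₂)
    (h : x + c * y = (c + 1) * z) :
    (C₁ * 2 ^ x) ^ d * ((C₂ * 2 ^ y) ^ d) ^ c ≤ ((C₁ * C₂ * 2 ^ z) ^ d) ^ (c + 1) := by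
  have h1 : (2 : ℝ) ^ x * (2 ^ y) ^ c = (2 ^ z) ^ (c + 1) := by
    rw [← Real.rpow_natCast (2 ^ y), ← Real.rpow_natCast (2 ^ z), ← Real.rpow_mul (by norm_num),
      ← Real.rpow_mul (by norm_num), ← Real.rpow_add (by norm_num)]
    congr 1; push_cast; linarith
  have h2 : C₁ * C₂ ^ c ≤ (C₁ * C₂) ^ (c + 1) := by
    rw [mul_pow]
    gcongr
    · exact le_self_pow₀ hC₁ (by omega)
    · omega
  calc _ = (C₁ * C₂ ^ c * (2 ^ x * (2 ^ y) ^ c)) ^ d := by ring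
    _ ≤ ((C₁ * C₂) ^ (c + 1) * (2 ^ z) ^ (c + 1)) ^ d := by rw [h1]; gcongr
    _ = _ := by ring

lemma ExpDec.exists_uniform {k : ℕ} {A η : ℝ} (h : ExpDec k A η) {ε : ℝ} (hε : 0 < ε) :
    ∃ C : ℝ, 1 ≤ C ∧ ∀ n j : ℕ, j ≤ n → Dec k A (n - j) (C * 2 ^ ((η + ε) * n - η * j)) := by
  obtain ⟨C, hC, h⟩ := h ε hε
  refine ⟨C, hC, fun n j hj => (h (n - j)).mono ?_⟩
  rw [Nat.cast_sub hj]
  have : (0 : ℝ) ≤ ε * j := by positivity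
  gcongr
  · norm_num
  · nlinarith

theorem BL_bootstrap (k : ℕ) (hk : 2 ≤ k) (A : ℝ) (hA : 1 ≤ A) (η : ℝ) (hη0 : 0 ≤ η)
    (hdec : ∀ l, 1 ≤ l → l < k → ∀ A, 1 ≤ A → ExpDec l A 0) (hη : ExpDec k A η) (T : ℕ) :
    ∀ l, 1 ≤ l → l < k → ∀ ε : ℝ, 0 < ε → ∃ C : ℝ, 1 ≤ C ∧ ∀ n j : ℕ,
      k.factorial ^ (T + 1) ∣ j → j * k ^ (T + 1) ≤ n →
      BL k A l n (j * (k - l + 1) / l) j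
        ((C * 2 ^ ((η + ε) * n - η * gain k T l * j)) ^ dd k) := by
  have hd : 1 ≤ dd k := one_le_dd (by omega)
  induction T with
  | zero =>
    intro l hl hlk ε hε
    obtain ⟨C, hC, h⟩ := hη.exists_uniform hε
    refine ⟨C, hC, fun n j hdvd hj => ?_⟩
    have hi : j * (k - l + 1) / l ≤ n := by
      refine (Nat.div_le_self _ _).trans (le_trans ?_ hj)
      rw [zero_add, pow_one]
      exact Nat.mul_le_mul_left _ (by omega)
    have hj' : j ≤ n := le_trans (Nat.le_mul_of_pos_right _ (by positivity)) hj
    have hg : gain k 0 l = 0 := by simp [gain]; omega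
    refine BL_trivial (by omega) hlk.le hi hj' ((h n _ hi).mono ?_) ((h n _ hj').mono ?_)
    all_goals
      refine mul_le_mul_of_nonneg_left (Real.rpow_le_rpow_of_exponent_le (by norm_num) ?_)
        (by positivity)
      rw [hg]
      simp only [mul_zero, zero_mul, sub_zero, tsub_le_iff_right, le_add_iff_nonneg_right]
      positivity
  | succ T ih =>
    intro l hl hlk ε hε
    set L := k.factorial with hL
    have hLdvd : ∀ m, 1 ≤ m → m ≤ k → m ∣ L := fun m h1 h2 => Nat.dvd_factorial (by omega) h2
    have hkl : k - (k - l) = l := by omega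
    -- the two estimates to be interpolated
    have first : ∃ C : ℝ, 1 ≤ C ∧ ∀ n j i' : ℕ, L ^ (T + 2) ∣ j → j * k ^ (T + 2) ≤ n →
        i' * l = j * (k - l + 1) → L ^ (T + 1) ∣ i' → BL k A (k - l) n j i'
          ((C * 2 ^ ((η + ε) * n - η * gain k T (k - l) * i')) ^ dd k) := by
      obtain ⟨C₁, hC₁, h₁⟩ := ih (k - l) (by omega) (by omega) (ε / 2) (by positivity)
      obtain ⟨C₂, hC₂, h₂⟩ := BL_of_refine_iterate k (k - l) A (by omega) (by omega) hA
        (hdec (k - l) (by omega) (by omega)) (3 * (k - l)) (ε / 2) (by positivity)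
      refine ⟨C₂ * C₁, one_le_mul_of_one_le_of_one_le hC₂ hC₁, fun n j i' hdvd hj hi' hdvd' => ?_⟩
      have hi'j : i' ≤ j * k := by
        refine Nat.le_of_mul_le_mul_right (c := l) ?_ hl
        rw [hi', mul_assoc]
        exact Nat.mul_le_mul_left _ (by nlinarith [Nat.sub_le k l, Nat.sub_lt (by omega : 0 < k) hl])
      have hi'n : i' * k ^ (T + 1) ≤ n := by
        refine le_trans (Nat.mul_le_mul_right _ hi'j) (le_trans (le_of_eq ?_) hj)
        ring
      have hb := h₁ n i' hdvd' hi'n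
      rw [hkl] at hb
      have hdl : (k - l) ∣ i' * (l + 1) :=
        ((hLdvd (k - l) (by omega) (by omega)).trans (dvd_pow_self L (by omega))).trans
          (hdvd'.trans (dvd_mul_right _ _))
      obtain ⟨i₁, hi₁⟩ := hdl
      rw [hi₁, Nat.mul_div_cancel_left _ (by omega)] at hb
      obtain ⟨c, hc⟩ := Nat.exists_eq_add_of_le hlk.le
      have hc' : k - l = c := by omega
      rw [hc'] at hi₁ hi'
      have hc1 : 1 ≤ c := by omega
      have hprod : (c * l) * i₁ = j * ((c + 1) * (l + 1)) := by
        calc c * l * i₁ = l * (c * i₁) := by ring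
          _ = (i' * l) * (l + 1) := by rw [← hi₁]; ring
          _ = _ := by rw [hi']; ring
      have hcl : 0 < c * l := by positivity
      have hle : j ≤ i₁ := by
        refine Nat.le_of_mul_le_mul_left (c := c * l) ?_ hcl
        rw [hprod, mul_comm]
        exact Nat.mul_le_mul_left _ (by nlinarith)
      have hge : i₁ ≤ 4 * j := by
        refine Nat.le_of_mul_le_mul_left (c := c * l) ?_ hcl
        rw [hprod, show c * l * (4 * j) = j * (4 * (c * l)) by ring]
        exact Nat.mul_le_mul_left _ (by nlinarith [Nat.mul_le_mul hc1 hl])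
      have hk2 : 4 ≤ k ^ (T + 2) := by
        calc 4 = 2 ^ 2 := rfl
          _ ≤ k ^ 2 := Nat.pow_le_pow_left hk 2
          _ ≤ _ := Nat.pow_le_pow_right (by omega) (by omega)
      have hn : i₁ ≤ n := by nlinarith
      have hn' : i' ≤ n := le_trans (Nat.le_mul_of_pos_right _ (by positivity)) hi'n
      have hdj : (k - l) ∣ j :=
        ((hLdvd (k - l) (by omega) (by omega)).trans (dvd_pow_self L (by omega))).trans hdvd
      refine (h₂ j i₁ n i' _ hdj hle ?_ ?_ hn hn' (by positivity) hb).mono ?_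
      · rw [hc']
        calc c * i₁ ≤ c * (4 * j) := Nat.mul_le_mul_left _ hge
          _ = _ := by ring
      · rw [hkl, hc', mul_comm, ← hi₁]
      · refine (refined_bound hd hC₂ hC₁ (by positivity)).trans (le_of_eq ?_)
        congr 3; ring
    have second : ∃ C : ℝ, 1 ≤ C ∧ ∀ n j i' : ℕ, L ^ (T + 2) ∣ j → j * k ^ (T + 2) ≤ n →
        i' * l = j * (k - l + 1) → L ^ (T + 1) ∣ i' → BL k A (l - 1) n i' j
          ((C * 2 ^ ((η + ε) * n - η * gain k T (l - 1) * j)) ^ dd k) := by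
      rcases Nat.lt_or_ge 1 l with hl2 | hl2
      · obtain ⟨C₁, hC₁, h₁⟩ := ih (l - 1) (by omega) (by omega) (ε / 2) (by positivity)
        obtain ⟨C₂, hC₂, h₂⟩ := BL_of_refine_iterate k (l - 1) A (by omega) (by omega) hA
          (hdec (l - 1) (by omega) (by omega)) (3 * (l - 1)) (ε / 2) (by positivity)
        refine ⟨C₂ * C₁, one_le_mul_of_one_le_of_one_le hC₂ hC₁, fun n j i' hdvd hj hi' hdvd' => ?_⟩
        obtain ⟨m, rfl⟩ := Nat.exists_eq_add_of_le' hl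
        obtain ⟨c, hc⟩ := Nat.exists_eq_add_of_le hlk.le
        have hc' : k - (m + 1) = c := by omega
        have hc'' : k - m = c + 1 := by omega
        have hm1 : 1 ≤ m := by omega
        have hc1 : 1 ≤ c := by omega
        rw [Nat.add_sub_cancel] at *
        have hjn : j * k ^ (T + 1) ≤ n := le_trans
          (Nat.mul_le_mul_left _ (Nat.pow_le_pow_right (by omega) (by omega))) hj
        have hb := h₁ n j ((pow_dvd_pow L (by omega)).trans hdvd) hjn
        have hdm : m ∣ j * (k - m + 1) :=
          ((hLdvd m (by omega) (by omega)).trans (dvd_pow_self L (by omega))).trans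
            (hdvd.trans (dvd_mul_right _ _))
        obtain ⟨i₂, hi₂⟩ := hdm
        rw [hi₂, Nat.mul_div_cancel_left _ (by omega)] at hb
        have hdi : m ∣ i' :=
          ((hLdvd m (by omega) (by omega)).trans (dvd_pow_self L (by omega))).trans hdvd'
        have hi₂' := hi₂
        rw [hc''] at hi₂'
        rw [hc'] at hi'
        have hpos : 0 < m * (m + 1) := by positivity
        have e1 : m * (m + 1) * i' = j * ((c + 1) * m) := by
          calc _ = m * (i' * (m + 1)) := by ring
            _ = _ := by rw [hi']; ring
        have e2 : m * (m + 1) * i₂ = j * ((c + 2) * (m + 1)) := by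
          calc _ = (m + 1) * (m * i₂) := by ring
            _ = _ := by rw [← hi₂']; ring
        have hle : i' ≤ i₂ := by
          refine Nat.le_of_mul_le_mul_left (c := m * (m + 1)) ?_ hpos
          rw [e1, e2]
          exact Nat.mul_le_mul_left _ (by nlinarith)
        have hge : i₂ ≤ 4 * i' := by
          refine Nat.le_of_mul_le_mul_left (c := m * (m + 1)) ?_ hpos
          rw [e2, show m * (m + 1) * (4 * i') = 4 * (m * (m + 1) * i') by ring, e1,
            show 4 * (j * ((c + 1) * m)) = j * (4 * ((c + 1) * m)) by ring]
          exact Nat.mul_le_mul_left _ (by nlinarith [Nat.mul_le_mul hc1 hm1])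
        have hn2 : i₂ ≤ n := by
          calc i₂ ≤ m * i₂ := Nat.le_mul_of_pos_left _ hm1
            _ = j * (c + 2) := by rw [← hi₂']
            _ ≤ j * k ^ (T + 1) := Nat.mul_le_mul_left _ (le_trans (by omega : c + 2 ≤ k)
                (Nat.le_self_pow (by omega) k))
            _ ≤ n := hjn
        have hjn' : j ≤ n := le_trans (Nat.le_mul_of_pos_right _ (by positivity)) hjn
        refine (h₂ i' i₂ n j _ hdi hle ?_ ?_ hn2 hjn' (by positivity) hb).mono ?_
        · calc m * i₂ ≤ m * (4 * i') := Nat.mul_le_mul_left _ hge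
            _ = _ := by ring
        · rw [mul_comm, ← hi₂]
        · refine (refined_bound hd hC₂ hC₁ (by positivity)).trans (le_of_eq ?_)
          congr 3; ring
      · obtain rfl : l = 1 := by omega
        obtain ⟨C, hC, h⟩ := hη.exists_uniform hε
        refine ⟨C, hC, fun n j i' _ hj _ _ => ?_⟩
        have hj' : j ≤ n := le_trans (Nat.le_mul_of_pos_right _ (by positivity)) hj
        have := BL_zero (by omega) (i := i') hj' (h n j hj')
        rw [Nat.sub_self, gain_zero, mul_one]
        exact this
    obtain ⟨C₁, hC₁, h₁⟩ := first
    obtain ⟨C₂, hC₂, h₂⟩ := second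
    refine ⟨C₁ * C₂, one_le_mul_of_one_le_of_one_le hC₁ hC₂, fun n j hdvd hj => ?_⟩
    obtain ⟨w, hw⟩ := hdvd
    obtain ⟨q, hq⟩ := hLdvd l hl hlk.le
    have hji : j * (k - l + 1) = L ^ (T + 1) * (q * w * (k - l + 1)) * l := by
      calc j * (k - l + 1) = L ^ (T + 1) * L * w * (k - l + 1) := by rw [hw, pow_succ L (T + 1)]
        _ = L ^ (T + 1) * (l * q) * w * (k - l + 1) := by rw [← hq]
        _ = _ := by ring
    set i' := L ^ (T + 1) * (q * w * (k - l + 1)) with hi'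
    rw [hji, Nat.mul_div_cancel _ (by omega)]
    have hB₁ := h₁ n j i' ⟨w, hw⟩ hj hji.symm (dvd_mul_right _ _)
    have hB₂ := h₂ n j i' ⟨w, hw⟩ hj hji.symm (dvd_mul_right _ _)
    refine BL.interp hl hlk.le hB₁ hB₂ (by positivity) (by positivity)
      (interp_bound hC₁ hC₂ ?_)
    have hg : gain k (T + 1) l = gain k T (k - l) / l +
        ((k - l : ℕ) : ℝ) / ((k - l : ℕ) + 1) * gain k T (l - 1) := by
      simp only [gain]
      rw [if_neg (by omega)]
    have hiR : (i' : ℝ) = j * ((k - l : ℕ) + 1) / l := by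
      rw [eq_div_iff (by positivity)]
      exact_mod_cast hji.symm
    rw [hg, hiR]
    have hl0 : (l : ℝ) ≠ 0 := by positivity
    field_simp
    ring

/-! ### A linear gain -/

lemma sum_gain (m T : ℕ) :
    ∑ l ∈ range (m + 1), gain (m + 2) T (l + 1) = T * ((m + 1) / (m + 2)) := by
  induction T with
  | zero => simp [gain]
  | succ T ih =>
    have h1 : ∀ l ∈ range (m + 1), gain (m + 2) (T + 1) (l + 1) =
        gain (m + 2) T (m + 1 - l) / (l + 1) +
          ((m + 1 - l : ℕ) : ℝ) / ((m + 1 - l : ℕ) + 1) * gain (m + 2) T l := by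
      intro l _
      simp only [gain]
      rw [if_neg (by omega), show m + 2 - (l + 1) = m + 1 - l by omega, Nat.add_sub_cancel]
      push_cast; rfl
    rw [sum_congr rfl h1, sum_add_distrib]
    have h2 : ∑ l ∈ range (m + 1), gain (m + 2) T (m + 1 - l) / ((l : ℝ) + 1) =
        ∑ l ∈ range (m + 1), gain (m + 2) T (l + 1) / ((m - l : ℕ) + 1) := by
      rw [← Finset.sum_range_reflect]
      refine sum_congr rfl fun l hl => ?_
      have := mem_range.1 hl
      rw [show m + 1 - (m + 1 - 1 - l) = l + 1 by omega, show m + 1 - 1 - l = m - l by omega]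
    have h3 : ∑ l ∈ range (m + 1), ((m + 1 - l : ℕ) : ℝ) / ((m + 1 - l : ℕ) + 1) *
        gain (m + 2) T l = (∑ l ∈ range (m + 1), ((m - l : ℕ) : ℝ) / ((m - l : ℕ) + 1) *
          gain (m + 2) T (l + 1)) + (m + 1) / (m + 2) := by
      rw [Finset.sum_range_succ', Finset.sum_range_succ, Nat.sub_self, gain_zero]
      push_cast
      simp only [zero_div, zero_mul, add_zero, mul_one]
      congr 1
      ring
    rw [h2, h3, ← add_assoc, ← sum_add_distrib]
    have h4 : ∀ l ∈ range (m + 1), gain (m + 2) T (l + 1) / ((m - l : ℕ) + 1) +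
        ((m - l : ℕ) : ℝ) / ((m - l : ℕ) + 1) * gain (m + 2) T (l + 1) =
          gain (m + 2) T (l + 1) := by
      intro l _
      have : ((m - l : ℕ) : ℝ) + 1 ≠ 0 := by positivity
      field_simp
      ring
    rw [sum_congr rfl h4, ih]
    push_cast; ring

lemma exists_gain_ge (k T : ℕ) (hk : 2 ≤ k) : ∃ l, 1 ≤ l ∧ l < k ∧ (T : ℝ) / k ≤ gain k T l := by
  obtain ⟨m, rfl⟩ := Nat.exists_eq_add_of_le' hk
  have h : ∑ l ∈ range (m + 1), (T : ℝ) / (m + 2) ≤ ∑ l ∈ range (m + 1), gain (m + 2) T (l + 1) := by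
    rw [sum_gain]
    simp only [sum_const, card_range, nsmul_eq_mul]
    push_cast
    exact le_of_eq (by ring)
  obtain ⟨l, hl, h⟩ := Finset.exists_le_of_sum_le (by simp) h
  refine ⟨l + 1, by omega, by have := mem_range.1 hl; omega, ?_⟩
  push_cast
  exact h

lemma norm_sum_pow_le {ι : Type*} (s : Finset ι) (hs : s.Nonempty) (c : ι → ℂ) (p : ℕ) :
    ‖∑ i ∈ s, c i‖ ^ p ≤ (s.card : ℝ) ^ p * ∑ i ∈ s, ‖c i‖ ^ p := by
  obtain ⟨i, hi, hmax⟩ := s.exists_max_image (fun i => ‖c i‖) hs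
  have h1 : ‖∑ i ∈ s, c i‖ ≤ s.card * ‖c i‖ := by
    refine (norm_sum_le _ _).trans ((sum_le_card_nsmul s _ _ hmax).trans (by simp))
  refine (pow_le_pow_left₀ (norm_nonneg _) h1 p).trans ?_
  rw [mul_pow]
  gcongr
  exact single_le_sum (f := fun i => ‖c i‖ ^ p) (fun i _ => by positivity) hi

lemma chd_nonempty (m : ℕ) (a : ℤ) : (chd m a).Nonempty := by
  rw [← card_pos, card_chd]; positivity

lemma BL.descend {k : ℕ} (hk : 1 ≤ k) {A : ℝ} {l n i j : ℕ} (hlk : l ≤ k) (hi : i ≤ n) (hj : j ≤ n)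
    {B : ℝ} (hB : 0 ≤ B) (h : BL k A l n i j B) :
    BL k A l n 0 0 (((2 : ℝ) ^ (3 * (i + j))) ^ dd k * B) := by
  intro Λ hΛ
  filter_upwards [h Λ hΛ] with v hv a a' hs f g hf hg
  have hd := one_le_dd hk
  have hm := dd_mono hlk
  set d := dd l
  set e := dd k - dd l with he
  set F : ℤ → Gp v k → ℂ := fun J => ∑ b ∈ chd (n - i) J, f b
  set G : ℤ → Gp v k → ℂ := fun J => ∑ b ∈ chd (n - j) J, g b
  set S : ℤ → ℝ := fun J => ∑ b ∈ chd (n - i) J, nsq (dd k) (f b)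
  set S' : ℤ → ℝ := fun J => ∑ b ∈ chd (n - j) J, nsq (dd k) (g b)
  have hS0 : ∀ J, 0 ≤ S J := fun J => sum_nsq_nonneg _ _ _
  have hS0' : ∀ J, 0 ≤ S' J := fun J => sum_nsq_nonneg _ _ _
  have eni : n - 0 = i + (n - i) := by omega
  have enj : n - 0 = j + (n - j) := by omega
  have e1 : ∑ b ∈ chd (n - 0) a, f b = ∑ J ∈ chd i a, F J := by rw [eni, sum_chd_add]
  have e2 : ∑ b ∈ chd (n - 0) a', g b = ∑ J ∈ chd j a', G J := by rw [enj, sum_chd_add]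
  have e3 : ∑ b ∈ chd (n - 0) a, nsq (dd k) (f b) = ∑ J ∈ chd i a, S J := by rw [eni, sum_chd_add]
  have e4 : ∑ b ∈ chd (n - 0) a', nsq (dd k) (g b) = ∑ J ∈ chd j a', S' J := by
    rw [enj, sum_chd_add]
  rw [e1, e2, e3, e4]
  have hh : ∀ J J', Sep i j J J' →
      ∑ x, ‖F J x‖ ^ (2 * d) * ‖G J' x‖ ^ (2 * e) ≤ B * S J ^ d * S' J' ^ e :=
    fun J J' hsep => hv J J' hsep f g hf hg
  clear_value F G S S'
  set Z₁ := ∑ J ∈ chd i a, S J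
  set Z₂ := ∑ J ∈ chd j a', S' J
  have hZ₁ : 0 ≤ Z₁ := sum_nonneg fun J _ => hS0 J
  have hZ₂ : 0 ≤ Z₂ := sum_nonneg fun J _ => hS0' J
  have hpair : ∀ J ∈ chd i a, ∀ J' ∈ chd j a', ∑ x, ‖F J x‖ ^ (2 * d) * ‖G J' x‖ ^ (2 * e) ≤
      B * Z₁ ^ d * Z₂ ^ e := by
    intro J hJ J' hJ'
    have hsep : Sep i j J J' := by
      have := ((hs.child hJ).symm.child hJ').symm
      rwa [zero_add, zero_add] at this
    refine (hh J J' hsep).trans ?_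
    have h1 : S J ≤ Z₁ := single_le_sum (f := S) (fun J _ => hS0 J) hJ
    have h2 : S' J' ≤ Z₂ := single_le_sum (f := S') (fun J _ => hS0' J) hJ'
    have := hS0 J
    have := hS0' J'
    gcongr
  have hc1 : ((chd i a).card : ℝ) = 2 ^ i := by rw [card_chd]; push_cast; rfl
  have hc2 : ((chd j a').card : ℝ) = 2 ^ j := by rw [card_chd]; push_cast; rfl
  calc _ ≤ ∑ x, ((2 ^ i) ^ (2 * d) * ∑ J ∈ chd i a, ‖F J x‖ ^ (2 * d)) *
        ((2 ^ j) ^ (2 * e) * ∑ J ∈ chd j a', ‖G J x‖ ^ (2 * e)) := by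
        refine sum_le_sum fun x _ => ?_
        rw [Finset.sum_apply, Finset.sum_apply, ← hc1, ← hc2]
        have h1 := norm_sum_pow_le _ (chd_nonempty i a) (fun J => F J x) (2 * d)
        have h2 := norm_sum_pow_le _ (chd_nonempty j a') (fun J => G J x) (2 * e)
        gcongr
    _ = ((2 : ℝ) ^ i) ^ (2 * d) * (2 ^ j) ^ (2 * e) * ∑ J ∈ chd i a, ∑ J' ∈ chd j a',
        ∑ x, ‖F J x‖ ^ (2 * d) * ‖G J' x‖ ^ (2 * e) := by
        have : ∀ x, ((2 ^ i) ^ (2 * d) * ∑ J ∈ chd i a, ‖F J x‖ ^ (2 * d)) *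
            ((2 ^ j) ^ (2 * e) * ∑ J ∈ chd j a', ‖G J x‖ ^ (2 * e)) =
            ((2 : ℝ) ^ i) ^ (2 * d) * (2 ^ j) ^ (2 * e) * ∑ J ∈ chd i a, ∑ J' ∈ chd j a',
              ‖F J x‖ ^ (2 * d) * ‖G J' x‖ ^ (2 * e) := by
          intro x
          rw [← sum_mul_sum]; ring
        rw [sum_congr rfl fun x _ => this x, ← mul_sum, sum_comm]
        congr 1
        refine sum_congr rfl fun J _ => sum_comm
    _ ≤ ((2 : ℝ) ^ i) ^ (2 * d) * (2 ^ j) ^ (2 * e) * ∑ J ∈ chd i a, ∑ J' ∈ chd j a',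
        B * Z₁ ^ d * Z₂ ^ e := by
        gcongr with J hJ J' hJ'
        exact hpair J hJ J' hJ'
    _ = ((2 : ℝ) ^ (i * (2 * d + 1) + j * (2 * e + 1))) * B * Z₁ ^ d * Z₂ ^ e := by
        simp only [sum_const, nsmul_eq_mul, hc1, hc2]
        ring
    _ ≤ _ := by
        rw [← pow_mul]
        gcongr
        · norm_num
        · have h1 : 2 * d + 1 ≤ 3 * dd k := by omega
          have h2 : 2 * e + 1 ≤ 3 * dd k := by omega
          calc _ ≤ i * (3 * dd k) + j * (3 * dd k) := by gcongr
            _ = _ := by ring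

theorem exists_linear_gain (k : ℕ) (hk : 2 ≤ k) (A : ℝ) (hA : 1 ≤ A) (η : ℝ) (hη0 : 0 < η)
    (hdec : ∀ l, 1 ≤ l → l < k → ∀ A, 1 ≤ A → ExpDec l A 0) (hη : ExpDec k A η) :
    ∃ δ : ℝ, 0 < δ ∧ ∃ C : ℝ, 1 ≤ C ∧ ∃ l, 1 ≤ l ∧ l < k ∧ ∀ n : ℕ,
      BL k A l n 0 0 ((C * 2 ^ ((η - δ) * n)) ^ dd k) := by
  have hk0 : (0 : ℝ) < k := by positivity
  obtain ⟨T, hT⟩ := exists_nat_ge ((3 * (k + 1) + 1) * k / η)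
  obtain ⟨l, hl, hlk, hg⟩ := exists_gain_ge k T hk
  have hg' : 3 * (k + 1) + 1 ≤ η * gain k T l := by
    rw [div_le_iff₀ hη0] at hT
    calc (3 * ((k : ℝ) + 1) + 1) = ((3 * (k + 1) + 1) * k) / k := by field_simp
      _ ≤ (T * η) / k := by gcongr
      _ = η * (T / k) := by ring
      _ ≤ _ := by gcongr
  set K := k ^ (T + 1) with hK
  set M := k.factorial ^ (T + 1) with hM
  have hK1 : 1 ≤ K := Nat.one_le_pow _ _ (by omega)
  have hM1 : 1 ≤ M := Nat.one_le_pow _ _ (Nat.factorial_pos k)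
  have hKR : (0 : ℝ) < K := by exact_mod_cast hK1
  obtain ⟨C, hC, h⟩ := BL_bootstrap k hk A hA η hη0.le hdec hη T l hl hlk (1 / (2 * K))
    (by positivity)
  refine ⟨1 / (2 * K), by positivity, C * 2 ^ (M : ℝ), one_le_mul_of_one_le_of_one_le hC
    (Real.one_le_rpow (by norm_num) (by positivity)), l, hl, hlk, fun n => ?_⟩
  set w := n / (M * K) with hw
  set j := M * w with hj
  have hMK : 0 < M * K := by positivity
  have hjn : j * K ≤ n := by
    calc j * K = M * K * (n / (M * K)) := by rw [hj, hw]; ring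
      _ ≤ n := Nat.mul_div_le _ _
  have hnj : n ≤ K * (j + M) := by
    have := Nat.lt_mul_div_succ n hMK
    calc n ≤ M * K * (n / (M * K) + 1) := this.le
      _ = _ := by rw [hj, hw]; ring
  have hkK : k ≤ K := Nat.le_self_pow (by omega) k
  set i := j * (k - l + 1) / l with hi
  have hijk : i ≤ j * k := (Nat.div_le_self _ _).trans (Nat.mul_le_mul_left _ (by omega))
  have hin : i ≤ n := hijk.trans ((Nat.mul_le_mul_left _ hkK).trans hjn)
  have hjn' : j ≤ n := le_trans (Nat.le_mul_of_pos_right _ hK1) hjn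
  have hb := (h n j (dvd_mul_right _ _) hjn).descend (by omega) hlk.le hin hjn' (by positivity)
  refine hb.mono ?_
  rw [← mul_pow]
  have hE : (2 : ℝ) ^ (3 * (i + j)) * (C * 2 ^ ((η + 1 / (2 * K)) * n - η * gain k T l * j)) =
      C * 2 ^ ((3 * (i + j) : ℝ) + ((η + 1 / (2 * K)) * n - η * gain k T l * j)) := by
    rw [Real.rpow_add (by norm_num)]
    have : (2 : ℝ) ^ (3 * (i + j)) = 2 ^ ((3 * (i + j) : ℝ)) := by
      rw [← Real.rpow_natCast]; push_cast; rfl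
    rw [this]; ring
  have hE2 : C * 2 ^ (M : ℝ) * 2 ^ ((η - 1 / (2 * K)) * n) =
      C * 2 ^ ((M : ℝ) + (η - 1 / (2 * K)) * n) := by
    rw [Real.rpow_add (by norm_num)]; ring
  rw [hE, hE2]
  refine pow_le_pow_left₀ (by positivity) (mul_le_mul_of_nonneg_left
    (Real.rpow_le_rpow_of_exponent_le (by norm_num) ?_) (by positivity)) _
  have h1 : (i : ℝ) ≤ j * k := by exact_mod_cast hijk
  have h2 : (n : ℝ) / K ≤ j + M := by
    rw [div_le_iff₀ hKR, mul_comm]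
    exact_mod_cast hnj
  have h3 : (3 * (k + 1) + 1) * (j : ℝ) ≤ η * gain k T l * j := by gcongr
  have h4 : (n : ℝ) / K = 1 / (2 * K) * n + 1 / (2 * K) * n := by field_simp; ring
  nlinarith

/-! ### From bilinear to linear estimates -/

lemma BLAt.block {k : ℕ} {A : ℝ} {Λ : ℤ} {v l m : ℕ} {B : ℝ} (h : BLAt k A Λ v l m 0 0 B) (r : ℕ)
    {u u' : ℤ} (h2 : 2 ≤ |u - u'|) (h3 : |u - u'| ≤ 3) {f : ℤ → Gp v k → ℂ}
    (hf : Fam k A Λ v (r + m) f) :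
    ∑ x, ‖(∑ b ∈ chd m u, f b) x‖ ^ (2 * dd l) *
        ‖(∑ b ∈ chd m u', f b) x‖ ^ (2 * (dd k - dd l)) ≤
      B * (∑ b ∈ chd m u, nsq (dd k) (f b)) ^ dd l *
        (∑ b ∈ chd m u', nsq (dd k) (f b)) ^ (dd k - dd l) := by
  set a := min u u' with ha
  obtain ⟨σ, w, hw, hfam⟩ := exists_rescale k A Λ v r m a
  set g : ℤ → Gp v k → ℂ := fun b x => w x * f (b + a * 2 ^ m) (σ x) with hg
  have hgF : Fam k A Λ v m g := hfam f hf
  have hs : Sep 0 0 (u - a) (u' - a) := by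
    unfold Sep
    simp only [pow_zero, Int.ediv_one]
    rw [show u - a - (u' - a) = u - u' by ring]
    rcases le_total u u' with hu | hu
    · rw [min_eq_left hu] at ha
      rw [abs_of_nonpos (by omega)] at h2 h3 ⊢
      omega
    · rw [min_eq_right hu] at ha
      rw [abs_of_nonneg (by omega)] at h2 h3 ⊢
      omega
  have := h _ _ hs g g hgF hgF
  have e1 : ∀ c x, ‖(∑ b ∈ chd m (c - a), g b) x‖ = ‖(∑ b ∈ chd m c, f b) (σ x)‖ := by
    intro c x
    conv_rhs => rw [← sub_add_cancel c a, sum_chd_shift]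
    rw [Finset.sum_apply, Finset.sum_apply]
    simp only [hg]
    rw [← mul_sum, norm_mul, hw, one_mul]
  have e2 : ∀ c, ∑ b ∈ chd m (c - a), nsq (dd k) (g b) = ∑ b ∈ chd m c, nsq (dd k) (f b) := by
    intro c
    conv_rhs => rw [← sub_add_cancel c a, sum_chd_shift]
    refine sum_congr rfl fun b _ => nsq_congr σ fun x => ?_
    simp only [hg]
    rw [norm_mul, hw, one_mul]
  simp only [Nat.sub_zero, e1, e2] at this
  rwa [Equiv.sum_comp σ (fun x => ‖(∑ b ∈ chd m u, f b) x‖ ^ (2 * dd l) *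
        ‖(∑ b ∈ chd m u', f b) x‖ ^ (2 * (dd k - dd l)))] at this

lemma nrm_mul_le_of_bilinear {α : Type*} [Fintype α] {d p q : ℕ} (hd : 1 ≤ d) (hpq : p + q = d)
    (F G : α → ℂ) {β S S' : ℝ} (hβ : 0 ≤ β) (hS : 0 ≤ S) (hS' : 0 ≤ S')
    (h1 : ∑ x, ‖F x‖ ^ (2 * p) * ‖G x‖ ^ (2 * q) ≤ β ^ d * S ^ p * S' ^ q)
    (h2 : ∑ x, ‖G x‖ ^ (2 * p) * ‖F x‖ ^ (2 * q) ≤ β ^ d * S' ^ p * S ^ q) :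
    nrm d (fun x => ‖F x‖ * ‖G x‖) ≤ β * ((S + S') / 2) := by
  refine nrm_le_of_pow_le hd (by positivity) ?_
  refine le_of_pow_le_pow_left₀ two_ne_zero (by positivity) ?_
  calc (∑ x, |‖F x‖ * ‖G x‖| ^ d) ^ 2
      = (∑ x, (‖F x‖ ^ p * ‖G x‖ ^ q) * (‖G x‖ ^ p * ‖F x‖ ^ q)) ^ 2 := by
        congr 1
        refine sum_congr rfl fun x _ => ?_
        rw [abs_of_nonneg (by positivity), ← hpq]; ring
    _ ≤ (∑ x, (‖F x‖ ^ p * ‖G x‖ ^ q) ^ 2) * ∑ x, (‖G x‖ ^ p * ‖F x‖ ^ q) ^ 2 :=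
        sum_mul_sq_le_sq_mul_sq _ _ _
    _ = (∑ x, ‖F x‖ ^ (2 * p) * ‖G x‖ ^ (2 * q)) * ∑ x, ‖G x‖ ^ (2 * p) * ‖F x‖ ^ (2 * q) := by
        congr 1 <;> exact sum_congr rfl fun x _ => by ring
    _ ≤ (β ^ d * S ^ p * S' ^ q) * (β ^ d * S' ^ p * S ^ q) := by gcongr
    _ = (β ^ 2 * (S * S')) ^ d := by rw [← hpq]; ring
    _ ≤ (β ^ 2 * ((S + S') / 2) ^ 2) ^ d := by
        gcongr
        nlinarith [sq_nonneg (S - S')]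
    _ = _ := by rw [← mul_pow, ← pow_mul, ← pow_mul, mul_comm 2 d]

lemma sum_close_pairs_le (s : Finset ℤ) (S : ℤ → ℝ) (hS : ∀ u, 0 ≤ S u) (K : ℕ) :
    ∑ u ∈ s, ∑ u' ∈ s, (if |u - u'| ≤ K then (S u + S u') / 2 else 0) ≤
      (2 * K + 1) * ∑ u ∈ s, S u := by
  have h1 : ∀ u ∈ s, ∑ u' ∈ s, (if |u - u'| ≤ K then S u / 2 else 0) ≤
      (2 * K + 1) * (S u / 2) := by
    intro u _
    rw [← sum_filter, sum_const, nsmul_eq_mul]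
    have : (s.filter (fun u' => |u - u'| ≤ K)).card ≤ 2 * K + 1 := by
      refine (card_le_card (t := Finset.Icc (u - K) (u + K)) ?_).trans ?_
      · intro u' hu'
        rw [mem_filter, abs_le] at hu'
        rw [Finset.mem_Icc]; omega
      · rw [Int.card_Icc]; omega
    have : ((s.filter (fun u' => |u - u'| ≤ K)).card : ℝ) ≤ 2 * K + 1 := by exact_mod_cast this
    have := hS u
    gcongr
  have h2 : ∑ u ∈ s, ∑ u' ∈ s, (if |u - u'| ≤ K then (S u + S u') / 2 else 0) =
      ∑ u ∈ s, ∑ u' ∈ s, (if |u - u'| ≤ K then S u / 2 else 0) +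
      ∑ u ∈ s, ∑ u' ∈ s, (if |u - u'| ≤ K then S u / 2 else 0) := by
    have : ∑ u ∈ s, ∑ u' ∈ s, (if |u - u'| ≤ (K : ℤ) then S u / 2 else 0) =
        ∑ u ∈ s, ∑ u' ∈ s, (if |u - u'| ≤ (K : ℤ) then S u' / 2 else 0) := by
      rw [sum_comm]
      exact sum_congr rfl fun u _ => sum_congr rfl fun u' _ => by rw [abs_sub_comm]
    nth_rewrite 2 [this]
    rw [← sum_add_distrib]
    refine sum_congr rfl fun u _ => ?_
    rw [← sum_add_distrib]
    refine sum_congr rfl fun u' _ => ?_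
    split_ifs <;> ring
  rw [h2]
  calc _ ≤ ∑ u ∈ s, (2 * K + 1) * (S u / 2) + ∑ u ∈ s, (2 * K + 1) * (S u / 2) :=
        add_le_add (sum_le_sum h1) (sum_le_sum h1)
    _ = _ := by rw [← mul_sum, ← sum_div]; ring

/-- The sum of products over pairs of neighbouring intervals. -/
noncomputable def nearSum {α : Type*} (F : ℕ → ℤ → α → ℂ) (r : ℕ) (x : α) : ℂ :=
  ∑ a ∈ chd r 0, ∑ a' ∈ chd r 0, if |a - a'| ≤ 1 then F r a x * F r a' x else 0

lemma nrm_pair_sum_le {α : Type*} [Fintype α] {d : ℕ} (hd : 1 ≤ d) (s : Finset ℤ)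
    (p : ℤ → ℤ → Prop) [∀ u u', Decidable (p u u')] (F : ℤ → α → ℂ) (S : ℤ → ℝ) (hS : ∀ u, 0 ≤ S u)
    (K : ℕ) (hp : ∀ u u', p u u' → |u - u'| ≤ K) {β : ℝ} (hβ : 0 ≤ β)
    (h : ∀ u u', p u u' → nrm d (fun x => ‖F u x‖ * ‖F u' x‖) ≤ β * ((S u + S u') / 2)) :
    nrm d (fun x => ‖∑ u ∈ s, ∑ u' ∈ s, if p u u' then F u x * F u' x else 0‖) ≤
      (2 * K + 1) * β * ∑ u ∈ s, S u := by
  calc nrm d (fun x => ‖∑ u ∈ s, ∑ u' ∈ s, if p u u' then F u x * F u' x else 0‖)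
      ≤ nrm d (fun x => ∑ u ∈ s, ∑ u' ∈ s, if p u u' then ‖F u x‖ * ‖F u' x‖ else 0) := by
        refine nrm_mono fun x => ?_
        rw [abs_norm, abs_of_nonneg]
        · refine (norm_sum_le _ _).trans (sum_le_sum fun u _ => (norm_sum_le _ _).trans
            (sum_le_sum fun u' _ => ?_))
          split_ifs <;> simp
        · exact sum_nonneg fun u _ => sum_nonneg fun u' _ => by split_ifs <;> positivity
    _ ≤ ∑ u ∈ s, ∑ u' ∈ s, nrm d (fun x => if p u u' then ‖F u x‖ * ‖F u' x‖ else 0) :=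
        (nrm_sum_le hd s _).trans (sum_le_sum fun u _ => nrm_sum_le hd s _)
    _ ≤ ∑ u ∈ s, ∑ u' ∈ s, β * (if |u - u'| ≤ K then (S u + S u') / 2 else 0) := by
        refine sum_le_sum fun u _ => sum_le_sum fun u' _ => ?_
        have hu := hS u
        have hu' := hS u'
        by_cases hpu : p u u'
        · simp only [if_pos hpu, if_pos (hp u u' hpu)]
          exact h u u' hpu
        · simp only [if_neg hpu, nrm_zero hd]
          split_ifs <;> positivity
    _ = β * ∑ u ∈ s, ∑ u' ∈ s, (if |u - u'| ≤ K then (S u + S u') / 2 else 0) := by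
        simp only [mul_sum]
    _ ≤ β * ((2 * K + 1) * ∑ u ∈ s, S u) := by
        gcongr
        exact sum_close_pairs_le s S hS K
    _ = _ := by ring

lemma nearSum_succ {α : Type*} (F : ℕ → ℤ → α → ℂ) (r : ℕ)
    (hF : ∀ a, F r a = ∑ u ∈ chd 1 a, F (r + 1) u) (x : α) :
    nearSum F r x = nearSum F (r + 1) x +
      ∑ u ∈ chd (r + 1) 0, ∑ u' ∈ chd (r + 1) 0,
        if |u / 2 - u' / 2| ≤ 1 ∧ 2 ≤ |u - u'| then F (r + 1) u x * F (r + 1) u' x else 0 := by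
  have h1 : nearSum F r x = ∑ u ∈ chd (r + 1) 0, ∑ u' ∈ chd (r + 1) 0,
      if |u / 2 - u' / 2| ≤ 1 then F (r + 1) u x * F (r + 1) u' x else 0 := by
    unfold nearSum
    rw [sum_chd_add]
    refine sum_congr rfl fun a _ => ?_
    simp only [sum_chd_add r 1 0]
    rw [sum_comm]
    refine sum_congr rfl fun a' _ => ?_
    have hu : ∀ u ∈ chd 1 a, u / 2 = a := fun u hu => by simpa using mem_chd.1 hu
    have hu' : ∀ u ∈ chd 1 a', u / 2 = a' := fun u hu => by simpa using mem_chd.1 hu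
    have : ∀ u ∈ chd 1 a, ∀ u' ∈ chd 1 a',
        (if |u / 2 - u' / 2| ≤ 1 then F (r + 1) u x * F (r + 1) u' x else 0) =
        if |a - a'| ≤ 1 then F (r + 1) u x * F (r + 1) u' x else 0 :=
      fun u h u' h' => by rw [hu u h, hu' u' h']
    rw [sum_congr rfl fun u h => sum_congr rfl fun u' h' => this u h u' h']
    split_ifs
    · rw [hF, hF, Finset.sum_apply, Finset.sum_apply, sum_mul_sum]
    · simp
  rw [h1]
  unfold nearSum
  rw [← sum_add_distrib]
  refine sum_congr rfl fun u _ => ?_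
  rw [← sum_add_distrib]
  refine sum_congr rfl fun u' _ => ?_
  by_cases h2 : |u - u'| ≤ 1
  · have : |u / 2 - u' / 2| ≤ 1 := by rw [abs_le] at *; omega
    rw [if_pos this, if_pos h2, if_neg (by omega), add_zero]
  · rw [if_neg h2, zero_add]
    have h3 : 2 ≤ |u - u'| := by omega
    simp only [h3, and_true]

theorem DecAt_of_BLAt {k : ℕ} (hk : 1 ≤ k) {A : ℝ} {Λ : ℤ} {v l n : ℕ} (hl : l ≤ k) {β : ℕ → ℝ}
    (hβ : ∀ m, 0 ≤ β m) (h : ∀ m < n, BLAt k A Λ v l m 0 0 (β m ^ dd k)) :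
    DecAt k A Λ v n (3 + 7 * ∑ m ∈ range n, β m) := by
  intro f hf
  have hd := one_le_dd hk
  have hdl := dd_mono hl
  set F : ℕ → ℤ → Gp v k → ℂ := fun r a => ∑ b ∈ chd (n - r) a, f b with hF
  set S : ℕ → ℤ → ℝ := fun r a => ∑ b ∈ chd (n - r) a, nsq (dd k) (f b) with hS
  set Z := ∑ b ∈ chd n 0, nsq (dd k) (f b) with hZ
  have hS0 : ∀ r a, 0 ≤ S r a := fun r a => sum_nsq_nonneg _ _ _
  have hSZ : ∀ r ≤ n, ∑ a ∈ chd r 0, S r a = Z := by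
    intro r hr
    rw [hZ]
    conv_rhs => rw [show n = r + (n - r) by omega, sum_chd_add]
  have hstep : ∀ r < n, nrm (dd k) (fun x => ‖nearSum F r x‖) ≤
      nrm (dd k) (fun x => ‖nearSum F (r + 1) x‖) + 7 * β (n - 1 - r) * Z := by
    intro r hr
    have hFr : ∀ a, F r a = ∑ u ∈ chd 1 a, F (r + 1) u := by
      intro a
      simp only [hF]
      rw [show n - r = 1 + (n - (r + 1)) by omega, sum_chd_add]
    have hpair : ∀ u u' : ℤ, |u / 2 - u' / 2| ≤ 1 ∧ 2 ≤ |u - u'| →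
        nrm (dd k) (fun x => ‖F (r + 1) u x‖ * ‖F (r + 1) u' x‖) ≤
          β (n - 1 - r) * ((S (r + 1) u + S (r + 1) u') / 2) := by
      intro u u' ⟨hp, h2⟩
      have h3 : |u - u'| ≤ 3 := by rw [abs_le] at *; omega
      have hb := h (n - 1 - r) (by omega)
      have hf' : Fam k A Λ v ((r + 1) + (n - 1 - r)) f := by
        rwa [show (r + 1) + (n - 1 - r) = n by omega]
      have e : n - 1 - r = n - (r + 1) := by omega
      have b1 := hb.block (r + 1) h2 h3 hf'
      have b2 := hb.block (r + 1) (by rwa [abs_sub_comm] at h2) (by rwa [abs_sub_comm] at h3) hf'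
      refine nrm_mul_le_of_bilinear hd (p := dd l) (q := dd k - dd l) (by omega) _ _ (hβ _)
        (hS0 _ _) (hS0 _ _) ?_ ?_
      · simp only [hF, hS]; rw [← e]; exact b1
      · simp only [hF, hS]; rw [← e]; exact b2
    have h7 := nrm_pair_sum_le hd (chd (r + 1) 0) _ (F (r + 1)) (S (r + 1)) (hS0 _) 3
      (fun u u' hp => by obtain ⟨hp, -⟩ := hp; push_cast; rw [abs_le] at *; omega) (hβ _) hpair
    rw [hSZ _ (by omega)] at h7
    calc nrm (dd k) (fun x => ‖nearSum F r x‖)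
        ≤ nrm (dd k) (fun x => ‖nearSum F (r + 1) x‖ + ‖∑ u ∈ chd (r + 1) 0, ∑ u' ∈ chd (r + 1) 0,
          if |u / 2 - u' / 2| ≤ 1 ∧ 2 ≤ |u - u'| then F (r + 1) u x * F (r + 1) u' x else 0‖) := by
          refine nrm_mono fun x => ?_
          rw [nearSum_succ F r hFr, abs_norm, abs_of_nonneg (by positivity)]
          exact norm_add_le _ _
      _ ≤ _ := (nrm_add_le hd _ _).trans (by
          gcongr
          refine h7.trans (le_of_eq ?_)
          push_cast; ring)
  have hind : ∀ r ≤ n, nrm (dd k) (fun x => ‖nearSum F 0 x‖) ≤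
      nrm (dd k) (fun x => ‖nearSum F r x‖) + 7 * (∑ i ∈ range r, β (n - 1 - i)) * Z := by
    intro r
    induction r with
    | zero => simp
    | succ r ih =>
      intro hr
      have := hstep r (by omega)
      rw [sum_range_succ]
      linarith [ih (by omega)]
  have hlast : nrm (dd k) (fun x => ‖nearSum F n x‖) ≤ 3 * Z := by
    have h3 := nrm_pair_sum_le hd (chd n 0) (fun u u' => |u - u'| ≤ 1) (F n) (S n) (hS0 _) 1
      (fun u u' hp => by exact_mod_cast hp) zero_le_one (fun u u' _ => by
        have e1 : ∀ u, S n u = nsq (dd k) (F n u) := by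
          intro u; simp only [hS, hF, Nat.sub_self, chd_zero, sum_singleton]
        rw [e1, e1, one_mul]
        calc nrm (dd k) (fun x => ‖F n u x‖ * ‖F n u' x‖)
            ≤ nrm (dd k) (fun x => 1 / 2 * ‖F n u x‖ ^ 2 + 1 / 2 * ‖F n u' x‖ ^ 2) := by
              refine nrm_mono fun x => ?_
              rw [abs_of_nonneg (by positivity), abs_of_nonneg (by positivity)]
              nlinarith [sq_nonneg (‖F n u x‖ - ‖F n u' x‖)]
          _ ≤ 1 / 2 * nsq (dd k) (F n u) + 1 / 2 * nsq (dd k) (F n u') := by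
              refine (nrm_add_le hd _ _).trans ?_
              rw [nrm_const_mul hd, nrm_const_mul hd, abs_of_pos (by norm_num)]
              rfl
          _ = _ := by ring)
    rw [hSZ n le_rfl] at h3
    refine h3.trans (le_of_eq ?_)
    push_cast; ring
  have h0 : nsq (dd k) (∑ b ∈ chd n 0, f b) = nrm (dd k) (fun x => ‖nearSum F 0 x‖) := by
    unfold nsq
    congr 1
    funext x
    simp only [nearSum, chd_zero, sum_singleton, sub_self, abs_zero]
    rw [if_pos zero_le_one, norm_mul, ← sq]
    simp only [hF, Nat.sub_zero]
  rw [h0]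
  refine (hind n le_rfl).trans ?_
  have : ∑ i ∈ range n, β (n - 1 - i) = ∑ i ∈ range n, β i := Finset.sum_range_reflect β n
  rw [this]
  linarith

lemma Dec_of_BL {k : ℕ} (hk : 1 ≤ k) {A : ℝ} {l : ℕ} (hl : l ≤ k) {β : ℕ → ℝ}
    (hβ : ∀ m, 0 ≤ β m) (h : ∀ m, BL k A l m 0 0 (β m ^ dd k)) (n : ℕ) :
    Dec k A n (3 + 7 * ∑ m ∈ range n, β m) := by
  intro Λ hΛ
  have : ∀ᶠ v in Filter.atTop, ∀ m ∈ range n, BLAt k A Λ v l m 0 0 (β m ^ dd k) :=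
    (Filter.eventually_all_finset _).2 fun m _ => h m Λ hΛ
  filter_upwards [this] with v hv
  exact DecAt_of_BLAt hk hl hβ fun m hm => hv m (mem_range.2 hm)

lemma Dec_two_pow {k : ℕ} (hk : 1 ≤ k) (A : ℝ) (n : ℕ) : Dec k A n (2 ^ n) := by
  intro Λ _
  refine Filter.Eventually.of_forall fun v f _ => ?_
  refine (nsq_sum_le (one_le_dd hk) _ _).trans (le_of_eq ?_)
  rw [card_chd]; push_cast; rfl

lemma exists_nat_le_two_rpow {ε : ℝ} (hε : 0 < ε) :
    ∃ C : ℝ, 1 ≤ C ∧ ∀ n : ℕ, (n : ℝ) ≤ C * 2 ^ (ε * n) := by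
  refine ⟨max 1 (1 / (ε * Real.log 2)), le_max_left _ _, fun n => ?_⟩
  have hl : 0 < Real.log 2 := Real.log_pos (by norm_num)
  have h1 : ε * n * Real.log 2 ≤ 2 ^ (ε * n) := by
    have := Real.add_one_le_exp (Real.log 2 * (ε * n))
    rw [Real.rpow_def_of_pos (by norm_num)]
    linarith
  calc (n : ℝ) = 1 / (ε * Real.log 2) * (ε * n * Real.log 2) := by field_simp
    _ ≤ max 1 (1 / (ε * Real.log 2)) * 2 ^ (ε * n) := by
      gcongr
      exact le_max_right _ _

lemma ExpDec_of_BL {k : ℕ} (hk : 1 ≤ k) {A : ℝ} {l : ℕ} (hl : l ≤ k) {C : ℝ} (hC : 1 ≤ C)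
    {x y : ℝ} (hx : 0 ≤ x) (hyx : y ≤ x) (h : ∀ n : ℕ, BL k A l n 0 0 ((C * 2 ^ (y * n)) ^ dd k)) :
    ExpDec k A x := by
  intro ε hε
  obtain ⟨C', hC', h'⟩ := exists_nat_le_two_rpow hε
  refine ⟨3 + 7 * C * C', by nlinarith, fun n => ?_⟩
  refine (Dec_of_BL hk hl (fun m => by positivity) h n).mono ?_
  have h1 : ∑ m ∈ range n, C * (2 : ℝ) ^ (y * m) ≤ C * C' * 2 ^ ((x + ε) * n) := by
    calc ∑ m ∈ range n, C * (2 : ℝ) ^ (y * m) ≤ ∑ m ∈ range n, C * (2 : ℝ) ^ (x * n) := by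
          refine sum_le_sum fun m hm => ?_
          have hm : (m : ℝ) ≤ n := by exact_mod_cast (mem_range.1 hm).le
          have : y * m ≤ x * n := by
            calc y * m ≤ x * m := by gcongr
              _ ≤ _ := by gcongr
          have := Real.rpow_le_rpow_of_exponent_le (by norm_num : (1 : ℝ) ≤ 2) this
          gcongr
      _ = n * (C * 2 ^ (x * n)) := by simp
      _ ≤ (C' * 2 ^ (ε * n)) * (C * 2 ^ (x * n)) := by
          gcongr
          exact h' n
      _ = _ := by rw [add_mul, Real.rpow_add (by norm_num)]; ring
  have h2 : (1 : ℝ) ≤ 2 ^ ((x + ε) * n) := Real.one_le_rpow (by norm_num) (by positivity)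
  calc 3 + 7 * ∑ m ∈ range n, C * (2 : ℝ) ^ (y * m)
      ≤ 3 * 2 ^ ((x + ε) * n) + 7 * (C * C' * 2 ^ ((x + ε) * n)) := by gcongr; linarith
    _ = _ := by ring

lemma ExpDec_one {k : ℕ} (hk : 1 ≤ k) (A : ℝ) : ExpDec k A 1 := by
  intro ε hε
  refine ⟨1, le_rfl, fun n => (Dec_two_pow hk A n).mono ?_⟩
  rw [one_mul, ← Real.rpow_natCast]
  refine Real.rpow_le_rpow_of_exponent_le (by norm_num) ?_
  have : (0 : ℝ) ≤ n := by positivity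
  nlinarith

lemma ExpDec.of_forall_gt {k : ℕ} {A η : ℝ} (h : ∀ x > η, ExpDec k A x) : ExpDec k A η := by
  intro ε hε
  obtain ⟨C, hC, hD⟩ := h (η + ε / 2) (by linarith) (ε / 2) (by positivity)
  refine ⟨C, hC, fun n => ?_⟩
  have := hD n
  rwa [show η + ε / 2 + ε / 2 = η + ε by ring] at this

lemma ExpDec.mono {k : ℕ} {A x y : ℝ} (h : ExpDec k A x) (hxy : x ≤ y) : ExpDec k A y := by
  intro ε hε
  obtain ⟨C, hC, hD⟩ := h (ε + (y - x)) (by linarith)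
  refine ⟨C, hC, fun n => ?_⟩
  have := hD n
  rwa [show x + (ε + (y - x)) = y + ε by ring] at this

/-- Decoupling for the moment curve, with a loss that is smaller than any power. -/
theorem ExpDec_zero (k : ℕ) (hk : 1 ≤ k) : ∀ A : ℝ, 1 ≤ A → ExpDec k A 0 := by
  induction k using Nat.strong_induction_on with
  | _ k ih =>
    intro A hA
    rcases eq_or_lt_of_le hk with rfl | hk2
    · intro ε hε
      refine ⟨4 * A + 1, by linarith, fun n => (dec_one (by linarith) n).mono ?_⟩
      have : (1 : ℝ) ≤ 2 ^ ((0 + ε) * n) := Real.one_le_rpow (by norm_num) (by positivity)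
      nlinarith
    set E : Set ℝ := {x | 0 ≤ x ∧ ExpDec k A x} with hE
    have hne : E.Nonempty := ⟨1, zero_le_one, ExpDec_one hk A⟩
    have hbd : BddBelow E := ⟨0, fun x hx => hx.1⟩
    set η := sInf E with hη
    have hη0 : 0 ≤ η := le_csInf hne fun x hx => hx.1
    have hηE : ExpDec k A η := by
      refine ExpDec.of_forall_gt fun x hx => ?_
      obtain ⟨y, hy, hyx⟩ := exists_lt_of_csInf_lt hne hx
      exact hy.2.mono hyx.le
    rcases hη0.eq_or_lt with h0 | hpos
    · rwa [← h0] at hηE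
    · exfalso
      obtain ⟨δ, hδ, C, hC, l, hl, hlk, hBL⟩ := exists_linear_gain k hk2 A hA η hpos
        (fun l hl hlk => ih l hlk hl) hηE
      have h1 : ExpDec k A (max (η - δ) 0) :=
        ExpDec_of_BL hk hlk.le hC (le_max_right _ _) (le_max_left _ _) hBL
      have h2 : η ≤ max (η - δ) 0 := csInf_le hbd ⟨le_max_right _ _, h1⟩
      rcases le_max_iff.1 h2 with h | h <;> linarith

/-! ### Counting approximate solutions -/

lemma re_sum_ex_nonneg {l v : ℕ} (ξ : Fin l → ℤ) : 0 ≤ (∑ x : Gp v l, ex ξ x).re := by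
  by_cases h : ∃ i, (ξ i : ZMod (2 * v + 1)) ≠ 0
  · obtain ⟨i, hi⟩ := h
    rw [sum_ex_eq_zero hi]; simp
  · push Not at h
    have : ∀ x : Gp v l, ex ξ x = 1 := by
      intro x
      unfold ex
      simp [h]
    simp only [this, sum_const, card_univ, nsmul_eq_mul, mul_one, Complex.natCast_re]
    positivity

lemma ex_sum {l v : ℕ} {ι : Type*} (s : Finset ι) (ξ : ι → Fin l → ℤ) (x : Gp v l) :
    ex (∑ i ∈ s, ξ i) x = ∏ i ∈ s, ex (ξ i) x := by
  classical
  induction s using Finset.induction_on with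
  | empty => simp
  | insert a s ha ih => rw [sum_insert ha, prod_insert ha, ex_add, ih]

/-- The alternating sum of a tuple of `s + s` vectors. -/
def altSum {l s : ℕ} (ξ : Fin (s + s) → Fin l → ℤ) : Fin l → ℤ :=
  ∑ i, ξ (Fin.castAdd s i) + ∑ i, -ξ (Fin.natAdd s i)

lemma card_mul_le_sum_norm_pow {l v s : ℕ} {ι : Type*} [DecidableEq ι] (T : Finset ι)
    (ξ : ι → Fin l → ℤ) (e : Fin l → ℤ) :
    (((Fintype.piFinset fun _ : Fin (s + s) => T).filter
      fun p => altSum (fun i => ξ (p i)) = e).card : ℝ) * Fintype.card (Gp v l) ≤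
      ∑ x : Gp v l, ‖∑ m ∈ T, ex (ξ m) x‖ ^ (2 * s) := by
  set P := Fintype.piFinset fun _ : Fin (s + s) => T
  set g : Gp v l → ℂ := fun x => ∑ m ∈ T, ex (ξ m) x with hg
  set g' : Gp v l → ℂ := fun x => ∑ m ∈ T, ex (-ξ m) x with hg'
  have hnorm : ∀ x, ‖g' x‖ = ‖g x‖ := by
    intro x
    have : g' x = (starRingEnd ℂ) (g x) := by
      simp only [hg, hg', ex_neg, map_sum]
    rw [this, Complex.norm_conj]
  have hprod : ∀ x, g x ^ s * g' x ^ s = ∑ p ∈ P, ex (altSum fun i => ξ (p i)) x := by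
    intro x
    have h1 : ∀ p : Fin (s + s) → ι, ex (altSum fun i => ξ (p i)) x =
        ∏ i, Fin.addCases (motive := fun _ => ι → ℂ) (fun _ m => ex (ξ m) x)
          (fun _ m => ex (-ξ m) x) i (p i) := by
      intro p
      rw [altSum, ex_add, ex_sum, ex_sum, Fin.prod_univ_add]
      simp only [Fin.addCases_left, Fin.addCases_right]
    simp only [h1]
    rw [← Finset.prod_univ_sum, Fin.prod_univ_add]
    simp only [Fin.addCases_left, Fin.addCases_right, prod_const, card_univ, Fintype.card_fin, hg,
      hg']
  have hre : ((P.filter fun p => altSum (fun i => ξ (p i)) = e).card : ℝ) * Fintype.card (Gp v l) ≤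
      (∑ x, g x ^ s * g' x ^ s * ex (-e) x).re := by
    have h2 : ∑ x, g x ^ s * g' x ^ s * ex (-e) x =
        ∑ p ∈ P, ∑ x : Gp v l, ex ((altSum fun i => ξ (p i)) + -e) x := by
      rw [sum_comm]
      refine sum_congr rfl fun x _ => ?_
      rw [hprod, sum_mul]
      exact sum_congr rfl fun p _ => (ex_add _ _ _).symm
    rw [h2, Complex.re_sum, card_filter, Nat.cast_sum, sum_mul]
    refine sum_le_sum fun p _ => ?_
    split_ifs with h
    · rw [h, add_neg_cancel]
      simp only [ex_zero, sum_const, card_univ, nsmul_eq_mul, mul_one, Complex.natCast_re,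
        Nat.cast_one, one_mul, le_refl]
    · simpa using re_sum_ex_nonneg _
  refine hre.trans ((Complex.re_le_norm _).trans ((norm_sum_le _ _).trans (le_of_eq ?_)))
  refine sum_congr rfl fun x _ => ?_
  rw [norm_mul, norm_mul, norm_pow, norm_pow, hnorm, norm_ex, mul_one]
  ring

lemma nrm_one_pow {α : Type*} [Fintype α] {d : ℕ} (hd : 1 ≤ d) :
    nrm d (fun _ : α => (1 : ℝ)) ^ d = Fintype.card α := by
  rw [nrm_pow hd]; simp

lemma sum_norm_pow_le_of_le {α : Type*} [Fintype α] {d s : ℕ} (hd : 1 ≤ d) (hs : s ≤ d)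
    (f : α → ℂ) {X : ℝ} (h : nsq d f ≤ X * nrm d (fun _ : α => (1 : ℝ))) :
    ∑ x, ‖f x‖ ^ (2 * s) ≤ X ^ s * Fintype.card α := by
  have h1 := sum_mul_pow_le hd (Nat.add_sub_cancel' hs) (fun x => ‖f x‖ ^ 2) (fun _ => 1)
    (fun x => by positivity) (fun _ => zero_le_one)
  simp only [one_pow, mul_one, ← pow_mul] at h1
  have h0 := nrm_nonneg d (fun _ : α => (1 : ℝ))
  calc _ ≤ nsq d f ^ s * nrm d (fun _ : α => (1 : ℝ)) ^ (d - s) := h1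
    _ ≤ (X * nrm d (fun _ : α => (1 : ℝ))) ^ s * nrm d (fun _ : α => (1 : ℝ)) ^ (d - s) := by
        have := nsq_nonneg d f
        gcongr
    _ = X ^ s * nrm d (fun _ : α => (1 : ℝ)) ^ d := by
        rw [mul_pow, mul_assoc, ← pow_add, Nat.add_sub_cancel' hs]
    _ = _ := by rw [nrm_one_pow hd]

lemma sum_norm_pow_le_of_ge {α : Type*} [Fintype α] {d s : ℕ} (hd : 1 ≤ d) (hs : d ≤ s)
    (f : α → ℂ) {X M : ℝ} (h : nsq d f ≤ X * nrm d (fun _ : α => (1 : ℝ)))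
    (hM : ∀ x, ‖f x‖ ≤ M) :
    ∑ x, ‖f x‖ ^ (2 * s) ≤ M ^ (2 * s - 2 * d) * X ^ d * Fintype.card α := by
  have h2 := sum_norm_pow_le_of_le hd le_rfl f h
  rw [mul_assoc]
  rcases isEmpty_or_nonempty α with hα | ⟨⟨x₀⟩⟩
  · simp
  have hM0 : 0 ≤ M := (norm_nonneg _).trans (hM x₀)
  calc ∑ x, ‖f x‖ ^ (2 * s) ≤ ∑ x, M ^ (2 * s - 2 * d) * ‖f x‖ ^ (2 * d) := by
        refine sum_le_sum fun x _ => ?_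
        rw [show 2 * s = (2 * s - 2 * d) + 2 * d by omega, pow_add]
        rw [show 2 * s - 2 * d + 2 * d - 2 * d = 2 * s - 2 * d by omega]
        have := hM x
        gcongr
    _ ≤ _ := by rw [← mul_sum]; gcongr

lemma mem_U_floor {k n : ℕ} {τ : ℝ} (h0 : 0 ≤ τ) (h1 : τ < 1) {ξ : Fin k → ℤ}
    (hξ : ∀ r : Fin k, |(ξ r : ℝ) - (2 ^ n) ^ k * τ ^ ((r : ℕ) + 1)| ≤ 1) :
    ξ ∈ U k (2 ^ k + 1) ((2 ^ n) ^ k) n ⌊2 ^ n * τ⌋ := by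
  intro m hm
  set b := ⌊(2 : ℝ) ^ n * τ⌋ with hb
  have hQ : (1 : ℝ) ≤ 2 ^ n := one_le_pow₀ (by norm_num)
  have hb0 : (0 : ℝ) ≤ b := by
    have : 0 ≤ b := Int.floor_nonneg.2 (by positivity)
    exact_mod_cast this
  have hb1 : (b : ℝ) ≤ 2 ^ n * τ := Int.floor_le _
  have hb2 : (2 : ℝ) ^ n * τ < b + 1 := Int.lt_floor_add_one _
  have hbQ : (b : ℝ) ≤ 2 ^ n := by nlinarith
  let φ : ℝ[X] →ₗ[ℝ] ℝ := ev (R := ℝ) ((2 ^ n) ^ k) ξ - ((2 ^ n) ^ k : ℝ) • leval τ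
  have hφ : ∀ r ≤ m, |φ (X ^ r)| ≤ 1 := by
    intro r hr
    simp only [φ, LinearMap.sub_apply, LinearMap.smul_apply, leval_apply, smul_eq_mul, ev_apply,
      eval_pow, eval_X, coeff_X_pow]
    rcases r with _ | r
    · simp
    · have e : ∑ i : Fin k, (ξ i : ℝ) * (if (i : ℕ) + 1 = r + 1 then 1 else 0) = ξ ⟨r, by omega⟩ := by
        rw [Finset.sum_eq_single ⟨r, by omega⟩]
        · simp
        · intro i _ hi
          have : (i : ℕ) ≠ r := fun h => hi (Fin.ext h)
          simp [this]
        · simp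
      rw [e]
      simpa using hξ ⟨r, by omega⟩
  have h2 := abs_map_affine_pow_le φ X hφ (2 ^ n) (-b)
  have elin : C ((2 : ℝ) ^ n) * X + C (-(b : ℝ)) = lin n b := by
    unfold lin; rw [C_neg, sub_eq_add_neg]
  rw [elin, mul_one, abs_of_nonneg (zero_le_one.trans hQ), abs_neg, abs_of_nonneg hb0] at h2
  have h3 : ((2 : ℝ) ^ n + b) ^ m ≤ 2 ^ k * (2 ^ n) ^ k := by
    calc ((2 : ℝ) ^ n + b) ^ m ≤ (2 * 2 ^ n) ^ m := by gcongr; linarith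
      _ ≤ (2 * 2 ^ n) ^ k := pow_le_pow_right₀ (by linarith) hm
      _ = _ := mul_pow _ _ _
  have h4 : |(((2 : ℝ) ^ n) ^ k) * (lin n b ^ m).eval τ| ≤ (2 ^ n) ^ k := by
    rw [abs_mul, abs_of_nonneg (by positivity)]
    refine mul_le_of_le_one_right (by positivity) ?_
    rw [eval_pow, abs_pow]
    refine pow_le_one₀ (abs_nonneg _) ?_
    simp only [lin, eval_sub, eval_mul, eval_C, eval_X]
    rw [abs_le]; constructor <;> linarith
  have h5 : ev (R := ℝ) ((2 ^ n) ^ k) ξ (lin n b ^ m) =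
      φ (lin n b ^ m) + ((2 : ℝ) ^ n) ^ k * (lin n b ^ m).eval τ := by
    simp [φ]
  rw [h5]
  push_cast
  calc _ ≤ _ := abs_add_le _ _
    _ ≤ 2 ^ k * (2 ^ n) ^ k + (2 ^ n) ^ k := add_le_add (h2.trans h3) h4
    _ = _ := by ring

lemma card_floor_fiber_le {N : ℕ} (hN : 1 ≤ N) {t : ℕ → ℝ}
    (ht : ∀ n : ℕ, 1 ≤ n → n ≤ N → ((n : ℝ) - 1) / N < t n ∧ t n < (n : ℝ) / N)
    {q : ℝ} (hq : N ≤ q) (b : ℤ) :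
    ((Finset.Icc 1 N).filter fun m => ⌊q * t m⌋ = b).card ≤ 2 := by
  set E := (Finset.Icc 1 N).filter fun m => ⌊q * t m⌋ = b
  rcases E.eq_empty_or_nonempty with h | h
  · simp [h]
  have hN0 : (0 : ℝ) < N := by exact_mod_cast hN
  have hsub : E ⊆ Finset.Icc (E.min' h) (E.min' h + 1) := by
    intro m hm
    have hmin := E.min'_mem h
    have hle := E.min'_le m hm
    set m₀ := E.min' h
    rw [Finset.mem_Icc]
    refine ⟨hle, ?_⟩
    rw [mem_filter, Finset.mem_Icc, Int.floor_eq_iff] at hm hmin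
    have h1 := (ht m hm.1.1 hm.1.2).1
    have h2 := (ht m₀ hmin.1.1 hmin.1.2).2
    rw [div_lt_iff₀ hN0] at h1
    rw [lt_div_iff₀ hN0] at h2
    have h3 : q * (t m - t m₀) < 1 := by linarith [hm.2.2, hmin.2.1]
    by_contra hcon
    have h4 : (m₀ : ℝ) + 2 ≤ m := by exact_mod_cast (by omega : m₀ + 2 ≤ m)
    have h5 : 1 < (t m - t m₀) * N := by linarith
    have h6 : 0 < t m - t m₀ := by
      by_contra h; push Not at h; nlinarith
    nlinarith
  refine (card_le_card hsub).trans ?_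
  rw [Nat.card_Icc]; omega

/-- The integer vector nearest to `q ^ k` times the point of the moment curve at `τ`. -/
noncomputable def nearFreq (k : ℕ) (q τ : ℝ) : Fin k → ℤ := fun r => round (q ^ k * τ ^ ((r : ℕ) + 1))

lemma abs_nearFreq_sub_le (k : ℕ) (q τ : ℝ) (r : Fin k) :
    |(nearFreq k q τ r : ℝ) - q ^ k * τ ^ ((r : ℕ) + 1)| ≤ 1 / 2 := by
  rw [abs_sub_comm]; exact abs_sub_round _

/-- The exponential sum attached to the points `t` is controlled by the decoupling constant. -/
lemma nsq_sum_ex_le {k : ℕ} (hk : 1 ≤ k) {N n v : ℕ} (hN : 1 ≤ N) (hn : N ≤ 2 ^ n) {D : ℝ}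
    (hD : 0 ≤ D) (hdec : DecAt k (2 ^ k + 1) ((2 ^ n) ^ k) v n D) {t : ℕ → ℝ}
    (ht : ∀ n : ℕ, 1 ≤ n → n ≤ N → ((n : ℝ) - 1) / N < t n ∧ t n < (n : ℝ) / N) :
    nsq (dd k) (fun x : Gp v k => ∑ m ∈ Finset.Icc 1 N, ex (nearFreq k (2 ^ n) (t m)) x) ≤
      4 * D * 2 ^ n * nrm (dd k) (fun _ : Gp v k => (1 : ℝ)) := by
  have hd := one_le_dd hk
  have hN0 : (0 : ℝ) < N := by exact_mod_cast hN
  have ht01 : ∀ m ∈ Finset.Icc 1 N, 0 ≤ t m ∧ t m < 1 := by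
    intro m hm
    rw [Finset.mem_Icc] at hm
    have h := ht m hm.1 hm.2
    have h1 : (1 : ℝ) ≤ m := by exact_mod_cast hm.1
    have h2 : (m : ℝ) ≤ N := by exact_mod_cast hm.2
    constructor
    · refine le_trans (div_nonneg ?_ hN0.le) h.1.le
      linarith
    · exact h.2.trans_le ((div_le_one hN0).2 h2)
  set fib : ℤ → Finset ℕ := fun b => (Finset.Icc 1 N).filter fun m => ⌊(2 : ℝ) ^ n * t m⌋ = b
    with hfib
  set f : ℤ → Gp v k → ℂ := fun b => ∑ m ∈ fib b, ex (nearFreq k (2 ^ n) (t m)) with hf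
  have hfam : Fam k (2 ^ k + 1) ((2 ^ n) ^ k) v n f := by
    intro b
    refine Submodule.sum_mem _ fun m hm => ex_mem_Sp ?_
    rw [hfib, mem_filter] at hm
    obtain ⟨h0, h1⟩ := ht01 m hm.1
    rw [← hm.2]
    exact mem_U_floor h0 h1 fun r => (abs_nearFreq_sub_le k _ _ r).trans (by norm_num)
  have hsum : (fun x : Gp v k => ∑ m ∈ Finset.Icc 1 N, ex (nearFreq k (2 ^ n) (t m)) x) =
      ∑ b ∈ chd n 0, f b := by
    rw [hf]
    simp only [hfib]
    rw [Finset.sum_fiberwise_of_maps_to (g := fun m => ⌊(2 : ℝ) ^ n * t m⌋)]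
    · funext x; rw [Finset.sum_apply]
    · intro m hm
      obtain ⟨h0, h1⟩ := ht01 m hm
      have hQ : (0 : ℝ) < 2 ^ n := by positivity
      unfold chd
      rw [Finset.mem_Ico, zero_mul, zero_add, one_mul]
      refine ⟨Int.floor_nonneg.2 (by positivity), Int.floor_lt.2 ?_⟩
      push_cast
      nlinarith
  have hfb : ∀ b, nsq (dd k) (f b) ≤ 4 * nrm (dd k) (fun _ : Gp v k => (1 : ℝ)) := by
    intro b
    have h4 : nrm (dd k) (fun _ : Gp v k => (4 : ℝ) * 1) =
        4 * nrm (dd k) (fun _ : Gp v k => (1 : ℝ)) := by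
      rw [nrm_const_mul hd, abs_of_pos (by norm_num)]
    rw [← h4]
    refine nrm_mono fun x => ?_
    rw [abs_of_nonneg (by positivity), mul_one, abs_of_pos (by norm_num)]
    have h2 : ‖f b x‖ ≤ 2 := by
      simp only [hf, Finset.sum_apply]
      refine (norm_sum_le _ _).trans ?_
      simp only [norm_ex, sum_const, nsmul_eq_mul, mul_one]
      exact_mod_cast card_floor_fiber_le hN ht (by exact_mod_cast hn) b
    nlinarith [norm_nonneg (f b x)]
  rw [hsum]
  calc _ ≤ D * ∑ b ∈ chd n 0, nsq (dd k) (f b) := hdec f hfam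
    _ ≤ D * ∑ b ∈ chd n 0, 4 * nrm (dd k) (fun _ : Gp v k => (1 : ℝ)) := by
        gcongr with b _
        exact hfb b
    _ = _ := by
        rw [sum_const, card_chd, nsmul_eq_mul]; push_cast; ring

/-- The tuples which are approximate solutions of the Vinogradov system. -/
def ApproxSol (k s N : ℕ) (t : ℕ → ℝ) (n : Fin (s + s) → ℕ) : Prop :=
  (∀ i, 1 ≤ n i ∧ n i ≤ N) ∧ ∀ j : ℕ, 1 ≤ j → j ≤ k →
    |∑ i : Fin s, t (n (Fin.castAdd s i)) ^ j - ∑ i : Fin s, t (n (Fin.natAdd s i)) ^ j| <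
      (N : ℝ) ^ (-(k : ℝ))

lemma altSum_nearFreq_mem {k s N n : ℕ} (hN : 1 ≤ N) (hn : 2 ^ n ≤ 2 * N) {t : ℕ → ℝ}
    {p : Fin (s + s) → ℕ} (hp : ApproxSol k s N t p) :
    altSum (fun i => nearFreq k (2 ^ n) (t (p i))) ∈
      Fintype.piFinset fun _ : Fin k => Finset.Icc (-((2 : ℤ) ^ k + s)) (2 ^ k + s) := by
  rw [Fintype.mem_piFinset]
  intro r
  rw [Finset.mem_Icc, ← abs_le]
  have hN0 : (0 : ℝ) < N := by exact_mod_cast hN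
  have h1 := hp.2 (r + 1) (by omega) r.2
  set τ : ℕ → ℝ := fun m => t m ^ ((r : ℕ) + 1) with hτ
  set δ : ℕ → ℝ := fun m => (nearFreq k (2 ^ n) (t m) r : ℝ) - (2 ^ n) ^ k * τ m with hδ
  have hδ1 : ∀ m, |δ m| ≤ 1 / 2 := fun m => abs_nearFreq_sub_le k _ _ r
  have e : ((altSum (fun i => nearFreq k (2 ^ n) (t (p i))) r : ℤ) : ℝ) =
      (2 ^ n) ^ k * (∑ i : Fin s, τ (p (Fin.castAdd s i)) - ∑ i : Fin s, τ (p (Fin.natAdd s i))) +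
        (∑ i : Fin s, δ (p (Fin.castAdd s i)) - ∑ i : Fin s, δ (p (Fin.natAdd s i))) := by
    simp only [altSum, Pi.add_apply, Finset.sum_apply, Pi.neg_apply, hδ, sum_sub_distrib,
      sum_neg_distrib, ← mul_sum]
    push_cast
    ring
  have hb : ∀ c : Fin s → ℕ, |∑ i, δ (c i)| ≤ s / 2 := by
    intro c
    refine (abs_sum_le_sum_abs _ _).trans ((sum_le_sum fun i _ => hδ1 (c i)).trans (le_of_eq ?_))
    simp; ring
  have hmain : |(2 ^ n) ^ k * (∑ i : Fin s, τ (p (Fin.castAdd s i)) -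
      ∑ i : Fin s, τ (p (Fin.natAdd s i)))| ≤ 2 ^ k := by
    rw [abs_mul, abs_of_nonneg (by positivity)]
    have hn' : (2 : ℝ) ^ n ≤ 2 * N := by exact_mod_cast hn
    calc _ ≤ (2 * (N : ℝ)) ^ k * (N : ℝ) ^ (-(k : ℝ)) := by gcongr
      _ = 2 ^ k := by
        rw [Real.rpow_neg hN0.le, Real.rpow_natCast, mul_pow]
        field_simp
  have : |((altSum (fun i => nearFreq k (2 ^ n) (t (p i))) r : ℤ) : ℝ)| ≤ 2 ^ k + s := by
    rw [e]
    have h3 := hb fun i => p (Fin.castAdd s i)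
    have h4 := hb fun i => p (Fin.natAdd s i)
    refine (abs_add_le _ _).trans ((add_le_add hmain (abs_sub _ _)).trans ?_)
    linarith
  exact_mod_cast this

lemma card_approxSol_le {k s N n v : ℕ} (hN : 1 ≤ N) (hn : 2 ^ n ≤ 2 * N) {t : ℕ → ℝ} {Y : ℝ}
    (hY : ∑ x : Gp v k, ‖∑ m ∈ Finset.Icc 1 N, ex (nearFreq k (2 ^ n) (t m)) x‖ ^ (2 * s) ≤
      Y * Fintype.card (Gp v k)) (hY0 : 0 ≤ Y) :
    (Nat.card {p : Fin (s + s) → ℕ // ApproxSol k s N t p} : ℝ) ≤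
      Y * (2 * (2 ^ k + s) + 1) ^ k := by
  classical
  set P := Fintype.piFinset fun _ : Fin (s + s) => Finset.Icc 1 N with hP
  set E := P.filter (ApproxSol k s N t) with hE
  have hcard : Nat.card {p : Fin (s + s) → ℕ // ApproxSol k s N t p} = E.card := by
    refine Nat.subtype_card E fun p => ?_
    rw [hE, mem_filter, hP, Fintype.mem_piFinset]
    refine ⟨fun h => h.2, fun h => ⟨fun i => Finset.mem_Icc.2 (h.1 i), h⟩⟩
  set ξ : ℕ → Fin k → ℤ := fun m => nearFreq k (2 ^ n) (t m)
  have hfib : ∀ e : Fin k → ℤ, (E.filter fun p => altSum (fun i => ξ (p i)) = e).card ≤ ⌊Y⌋₊ := by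
    intro e
    have h1 := card_mul_le_sum_norm_pow (v := v) (s := s) (Finset.Icc 1 N) ξ e
    have hG : (0 : ℝ) < Fintype.card (Gp v k) := by exact_mod_cast Fintype.card_pos
    have h2 := le_of_mul_le_mul_right (h1.trans hY) hG
    refine le_trans (card_le_card ?_) (Nat.le_floor h2)
    exact filter_subset_filter _ (filter_subset _ _)
  have hmaps : ∀ p ∈ E, altSum (fun i => ξ (p i)) ∈
      Fintype.piFinset fun _ : Fin k => Finset.Icc (-((2 : ℤ) ^ k + s)) (2 ^ k + s) :=
    fun p hp => altSum_nearFreq_mem hN hn (mem_filter.1 hp).2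
  have h3 := card_le_mul_card_image_of_maps_to hmaps _ fun e _ => hfib e
  rw [hcard]
  calc (E.card : ℝ) ≤ ⌊Y⌋₊ * ((Fintype.piFinset fun _ : Fin k =>
        Finset.Icc (-((2 : ℤ) ^ k + s)) (2 ^ k + s)).card : ℝ) := by exact_mod_cast h3
    _ = ⌊Y⌋₊ * (2 * (2 ^ k + s) + 1) ^ k := by
        rw [Fintype.card_piFinset_const, Int.card_Icc]
        have : ((2 : ℤ) ^ k + s + 1 - -(2 ^ k + s)).toNat = 2 * (2 ^ k + s) + 1 := by
          have h : (2 : ℤ) ^ k + s + 1 - -(2 ^ k + s) = ((2 * (2 ^ k + s) + 1 : ℕ) : ℤ) := by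
            push_cast; ring
          rw [h, Int.toNat_natCast]
        rw [this]; push_cast; rfl
    _ ≤ _ := by
        gcongr
        exact Nat.floor_le hY0

lemma exists_two_pow {N : ℕ} (hN : 1 ≤ N) : ∃ n : ℕ, N ≤ 2 ^ n ∧ 2 ^ n ≤ 2 * N := by
  refine ⟨Nat.log 2 N + 1, (Nat.lt_pow_succ_log_self (by norm_num) N).le, ?_⟩
  rw [pow_succ, mul_comm]
  exact Nat.mul_le_mul_left _ (Nat.pow_log_le_self 2 (by omega))

end MomentCurve

theorem approximate_solution_counting (k s : ℕ) (hk : 2 ≤ k) (hs : 1 ≤ s)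
    (ε : ℝ) (hε : 0 < ε) :
    ∃ C : ℝ, ∀ N : ℕ, 1 ≤ N → ∀ t : ℕ → ℝ,
      (∀ n : ℕ, 1 ≤ n → n ≤ N → ((n : ℝ) - 1) / N < t n ∧ t n < (n : ℝ) / N) →
      (Nat.card {n : Fin (s + s) → ℕ //
          (∀ i, 1 ≤ n i ∧ n i ≤ N) ∧
          ∀ j : ℕ, 1 ≤ j → j ≤ k →
            |∑ i : Fin s, t (n (Fin.castAdd s i)) ^ j -
              ∑ i : Fin s, t (n (Fin.natAdd s i)) ^ j| < (N : ℝ) ^ (-(k : ℝ))} : ℝ)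
        ≤ C * (N : ℝ) ^ ε *
            ((N : ℝ) ^ (s : ℝ) + (N : ℝ) ^ ((2 * s : ℝ) - k * (k + 1) / 2)) := by
  have hk1 : 1 ≤ k := by omega
  have hd := MomentCurve.one_le_dd hk1
  set d := MomentCurve.dd k with hd_def
  set δ := ε / d with hδ
  have hd0 : (0 : ℝ) < d := by exact_mod_cast hd
  have hδ0 : 0 < δ := by positivity
  obtain ⟨C₀, hC₀, hdec⟩ := MomentCurve.ExpDec_zero k hk1 (2 ^ k + 1) (by
    have : (0 : ℝ) ≤ 2 ^ k := by positivity
    linarith) δ hδ0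
  set C₁ : ℝ := 4 * C₀ * 2 ^ (1 + δ) with hC₁
  have h2δ : (1 : ℝ) ≤ 2 ^ (1 + δ) := Real.one_le_rpow (by norm_num) (by positivity)
  have hC₁1 : 1 ≤ C₁ := by nlinarith
  refine ⟨C₁ ^ d * (2 * (2 ^ k + s) + 1) ^ k, fun N hN t ht => ?_⟩
  have hN1 : (1 : ℝ) ≤ N := by exact_mod_cast hN
  obtain ⟨n, hn, hn2⟩ := MomentCurve.exists_two_pow hN
  obtain ⟨v, hv⟩ := (hdec n ((2 ^ n) ^ k) (one_le_pow₀ (one_le_pow₀ (by norm_num)))).exists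
  have hnsq := MomentCurve.nsq_sum_ex_le hk1 hN hn (by positivity) hv ht
  set f : MomentCurve.Gp v k → ℂ :=
    fun x => ∑ m ∈ Finset.Icc 1 N, MomentCurve.ex (MomentCurve.nearFreq k (2 ^ n) (t m)) x
  have hX : 4 * (C₀ * 2 ^ ((0 + δ) * n)) * 2 ^ n ≤ C₁ * (N : ℝ) ^ (1 + δ) := by
    have e : (2 : ℝ) ^ ((0 + δ) * n) * 2 ^ n = (2 ^ n) ^ (1 + δ) := by
      rw [← Real.rpow_natCast 2 n, ← Real.rpow_mul (by norm_num), ← Real.rpow_add (by norm_num)]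
      ring_nf
    have hn2' : (2 : ℝ) ^ n ≤ 2 * N := by exact_mod_cast hn2
    calc _ = 4 * C₀ * (2 ^ ((0 + δ) * n) * 2 ^ n) := by ring
      _ = 4 * C₀ * (2 ^ n) ^ (1 + δ) := by rw [e]
      _ ≤ 4 * C₀ * (2 * N) ^ (1 + δ) := by gcongr
      _ = _ := by rw [Real.mul_rpow (by norm_num) (by positivity)]; ring
  have hnsq' : MomentCurve.nsq d f ≤ C₁ * (N : ℝ) ^ (1 + δ) *
      MomentCurve.nrm d (fun _ : MomentCurve.Gp v k => (1 : ℝ)) := by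
    refine hnsq.trans ?_
    have := MomentCurve.nrm_nonneg d (fun _ : MomentCurve.Gp v k => (1 : ℝ))
    gcongr
  have hpow : ∀ m : ℕ, (C₁ * (N : ℝ) ^ (1 + δ)) ^ m = C₁ ^ m * (N : ℝ) ^ ((1 + δ) * m) := by
    intro m
    rw [mul_pow, ← Real.rpow_natCast (N ^ (1 + δ) : ℝ), ← Real.rpow_mul (by positivity)]
  have hδd : δ * d = ε := by rw [hδ]; field_simp
  have hdR : (k : ℝ) * (k + 1) / 2 = d := by
    have : (2 : ℝ) * d = k * (k + 1) := by exact_mod_cast MomentCurve.two_mul_dd k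
    linarith
  have hP : (0 : ℝ) ≤ N ^ ε := by positivity
  have hmoment : ∃ Y : ℝ, 0 ≤ Y ∧ ∑ x, ‖f x‖ ^ (2 * s) ≤ Y * Fintype.card (MomentCurve.Gp v k) ∧
      Y ≤ C₁ ^ d * (N : ℝ) ^ ε *
        ((N : ℝ) ^ (s : ℝ) + (N : ℝ) ^ ((2 * s : ℝ) - k * (k + 1) / 2)) := by
    rcases le_total s d with hsd | hsd
    · refine ⟨_, by positivity, MomentCurve.sum_norm_pow_le_of_le hd hsd f hnsq', ?_⟩
      have hsdR : (s : ℝ) ≤ d := by exact_mod_cast hsd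
      calc (C₁ * (N : ℝ) ^ (1 + δ)) ^ s = C₁ ^ s * (N : ℝ) ^ ((1 + δ) * s) := hpow s
        _ ≤ C₁ ^ d * (N : ℝ) ^ (ε + s) := by
          gcongr
          nlinarith
        _ = C₁ ^ d * (N : ℝ) ^ ε * (N : ℝ) ^ (s : ℝ) := by
          rw [Real.rpow_add (by positivity)]; ring
        _ ≤ _ := by
          gcongr
          exact le_add_of_nonneg_right (by positivity)
    · have hfN : ∀ x, ‖f x‖ ≤ N := by
        intro x
        refine (norm_sum_le _ _).trans (le_of_eq ?_)
        simp
      refine ⟨_, by positivity, MomentCurve.sum_norm_pow_le_of_ge hd hsd f hnsq' hfN, ?_⟩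
      calc (N : ℝ) ^ (2 * s - 2 * d) * (C₁ * (N : ℝ) ^ (1 + δ)) ^ d
          = (N : ℝ) ^ ((2 * s : ℝ) - 2 * d) * (C₁ ^ d * (N : ℝ) ^ ((1 + δ) * d)) := by
            rw [hpow, ← Real.rpow_natCast (N : ℝ) (2 * s - 2 * d), Nat.cast_sub (by omega)]
            push_cast; rfl
        _ = C₁ ^ d * (N : ℝ) ^ ε * (N : ℝ) ^ ((2 * s : ℝ) - k * (k + 1) / 2) := by
          rw [hdR, mul_left_comm, mul_assoc, ← Real.rpow_add (by positivity),
            ← Real.rpow_add (by positivity), ← hδd]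
          ring_nf
        _ ≤ _ := by
          gcongr
          exact le_add_of_nonneg_left (by positivity)
  obtain ⟨Y, hY0, hY, hYle⟩ := hmoment
  refine (MomentCurve.card_approxSol_le hN hn2 hY hY0).trans ?_
  calc _ ≤ (C₁ ^ d * (N : ℝ) ^ ε *
        ((N : ℝ) ^ (s : ℝ) + (N : ℝ) ^ ((2 * s : ℝ) - k * (k + 1) / 2))) *
        (2 * (2 ^ k + s) + 1) ^ k := by gcongr
    _ = _ := by ring
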